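/- Let q ≥ 0 and 1 ≤ t ≤ 2^q be integers, let m = 2^{q+1} − t and d = 7·2^q − 2t. Then for any m masses μ_1, …, μ_m on ℝ^d there exist four pairwise orthogonal hyperplanes H_1, H_2, H_3, H_4 in ℝ^d such that any 3 of the four hyperplanes equipartition each μ_i (each of the eight regions determined by any three of the hyperplanes carries exactly one eighth of each mass). -/

import Mathlib

open MeasureTheory RealInnerProductSpace

noncomputable section

/-- The closed half-space determined by the hyperplane `{x | ⟪a, x⟫ = b}`:
`true` corresponds to `H⁺ = {x | ⟪a, x⟫ ≥ b}`, `false` to `H⁻ = {x | ⟪a, x⟫ ≤ b}`. -/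
def halfSpace {d : ℕ} (a : EuclideanSpace ℝ (Fin d)) (b : ℝ) (ε : Bool) :
    Set (EuclideanSpace ℝ (Fin d)) :=
  if ε then {x | b ≤ ⟪a, x⟫} else {x | ⟪a, x⟫ ≤ b}

/-- The region `⋂ i ∈ s, H i ^ (ε i)` determined by the hyperplanes indexed by `s`. -/
def region {d k : ℕ} (a : Fin k → EuclideanSpace ℝ (Fin d)) (b : Fin k → ℝ)
    (s : Finset (Fin k)) (ε : Fin k → Bool) : Set (EuclideanSpace ℝ (Fin d)) :=
  ⋂ i ∈ s, halfSpace (a i) (b i) (ε i)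


set_option linter.all false

namespace EQ

abbrev V (d : ℕ) := Fin 4 × Fin (d+1) → ℤ

variable {d : ℕ}

def cov (x y : V d) : Prop :=
  ∃ c, Even (x c) ∧ (y c = x c + 1 ∨ y c = x c - 1) ∧ ∀ c', c' ≠ c → y c' = x c'

def TopB (M : ℤ) (D : Fin 4 → ℕ) (v : V d) (k : Fin 4) (r0 : Fin (d+1)) : Prop :=
  (r0 : ℕ) ≤ D k ∧ (v (k, r0) = M ∨ v (k, r0) = -M) ∧
  (∀ r, r ≠ r0 → (r : ℕ) ≤ D k → Odd (v (k, r)) ∧ -M < v (k, r) ∧ v (k, r) < M) ∧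
  ∀ r : Fin (d+1), D k < (r : ℕ) → v (k, r) = 0

def Top (M : ℤ) (D : Fin 4 → ℕ) (v : V d) : Prop := ∀ k, ∃ r0, TopB M D v k r0

lemma TopB.congr {M : ℤ} {D : Fin 4 → ℕ} {v w : V d} {k r0} (h : TopB M D v k r0)
    (hw : ∀ r, w (k, r) = v (k, r)) : TopB M D w k r0 := by
  simpa [TopB, hw] using h

lemma TopB.even_iff {M : ℤ} (hM : Even M) {D : Fin 4 → ℕ} {v : V d} {k r0}
    (h : TopB M D v k r0) {r : Fin (d+1)} (hr : Even (v (k, r))) (hD : (r : ℕ) ≤ D k) :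
    r = r0 := by
  by_contra hne
  have := (h.2.2.1 r hne hD).1
  exact (Int.not_even_iff_odd.2 this) hr

lemma TopB.odd {M : ℤ} (hM : Even M) {D : Fin 4 → ℕ} {v : V d} {k r0}
    (h : TopB M D v k r0) {r : Fin (d+1)} (hr : Odd (v (k, r))) :
    r ≠ r0 ∧ (r : ℕ) ≤ D k ∧ -M < v (k, r) ∧ v (k, r) < M := by
  have h1 : r ≠ r0 := by
    rintro rfl
    rcases h.2.1 with h | h <;> rw [h] at hr
    · exact (Int.not_even_iff_odd.2 hr) hM
    · exact (Int.not_even_iff_odd.2 hr) hM.neg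
  have h2 : (r : ℕ) ≤ D k := by
    by_contra h3
    rw [h.2.2.2 r (by omega)] at hr
    exact absurd hr (by decide)
  exact ⟨h1, h2, (h.2.2.1 r h1 h2).2⟩

lemma top_flip {M : ℤ} (hM : Even M) (hM0 : 0 < M) {D : Fin 4 → ℕ} {x z : V d}
    (hxz : cov x z) (hz : Top M D z) :
    ∃ y, y ≠ z ∧ cov x y ∧ Top M D y ∧ ∀ y', y' ≠ z → cov x y' → Top M D y' → y' = y := by
  obtain ⟨⟨k, r⟩, hxe, hzc, hoth⟩ := hxz
  obtain ⟨r0, hB⟩ := hz k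
  have hzo : Odd (z (k, r)) := by
    rcases hzc with h | h <;> rw [h]
    · exact hxe.add_one
    · exact hxe.sub_odd odd_one
  obtain ⟨hr0, hrD, hb1, hb2⟩ := hB.odd hM hzo
  -- the reflected value
  set e := x (k, r) with he
  have hMx : ∀ N : ℤ, Odd N → N ≠ M ∧ N ≠ -M := by
    intro N hN; constructor <;> rintro rfl
    · exact (Int.not_even_iff_odd.2 hN) hM
    · exact (Int.not_even_iff_odd.2 hN) hM.neg
  have hfo : Odd (2 * e - z (k, r)) := (even_two_mul e).sub_odd hzo
  -- any other candidate
  have key : ∀ y', y' ≠ z → cov x y' → Top M D y' →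
      (y' = Function.update x (k, r) (2 * e - z (k, r)) ∧ -M < 2 * e - z (k, r) ∧
        2 * e - z (k, r) < M) ∨
      ((e = M ∨ e = -M) ∧ y' = Function.update x (k, r0)
        (if x (k, r0) = M then M - 1 else -M + 1)) := by
    intro y hyz ⟨⟨k', r'⟩, hxe', hyc, hoth'⟩ hy
    have hyo : Odd (y (k', r')) := by
      rcases hyc with h | h <;> rw [h]
      · exact hxe'.add_one
      · exact hxe'.sub_odd odd_one
    by_cases hc : (k', r') = (k, r)
    · left
      obtain ⟨rfl, rfl⟩ := Prod.mk.inj hc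
      have hv : y (k', r') = 2 * e - z (k', r') := by
        by_contra hne
        apply hyz
        funext c
        by_cases hcc : c = (k', r')
        · subst hcc; omega
        · rw [hoth _ hcc, hoth' _ hcc]
      obtain ⟨r1, hB1⟩ := hy k'
      obtain ⟨-, -, h1, h2⟩ := hB1.odd hM hyo
      refine ⟨?_, by omega, by omega⟩
      funext c
      by_cases hcc : c = (k', r')
      · subst hcc; simp [hv]
      · simp [hcc, hoth' _ hcc]
    · right
      obtain ⟨r1, hB1⟩ := hy k'
      obtain ⟨h1, h2, h3, h4⟩ := hB1.odd hM hyo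
      have hkk : k' = k := by
        by_contra hkk
        obtain ⟨r2, hB2⟩ := hz k'
        have e1 : z (k', r') = x (k', r') := hoth _ hc
        have e2 : z (k', r1) = x (k', r1) := hoth _ (by simp [hkk])
        have e3 : y (k', r1) = x (k', r1) := hoth' _ (by simpa using fun h => h1 h.symm)
        have f1 := hB2.even_iff hM (by rw [e1]; exact hxe') h2
        have f2 : r1 = r2 := hB2.even_iff hM (by
          rw [e2, ← e3]
          rcases hB1.2.1 with h | h <;> rw [h]
          · exact hM
          · exact hM.neg) hB1.1
        exact h1 (f1.trans f2.symm)
      subst hkk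
      have hrr : r' ≠ r := fun h => hc (by rw [h])
      have e1 : z (k', r') = x (k', r') := hoth _ hc
      have f1 : r' = r0 := hB.even_iff hM (by rw [e1]; exact hxe') h2
      have e2 : y (k', r) = x (k', r) := hoth' _ (by simpa using hrr.symm)
      have f2 : r = r1 := hB1.even_iff hM (by rw [e2]; exact hxe) hrD
      subst f1 f2
      have f3 := hB1.2.1
      have f4 := hB.2.1
      rw [e2] at f3
      rw [e1] at f4
      refine ⟨f3, ?_⟩
      funext c
      by_cases hcc : c = (k', r')
      · subst hcc
        simp only [Function.update_self]
        split_ifs with h <;> omega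
      · simp [hcc, hoth' _ hcc]
  have hzr0 : z (k, r0) = x (k, r0) := hoth _ (by simpa using hr0.symm)
  have hx0 := hB.2.1
  rw [hzr0] at hx0
  by_cases hcase : -M < 2 * e - z (k, r) ∧ 2 * e - z (k, r) < M
  · have heM : e ≠ M ∧ e ≠ -M := by constructor <;> omega
    refine ⟨Function.update x (k, r) (2 * e - z (k, r)), ?_, ?_, ?_, ?_⟩
    · intro h
      have := congrFun h (k, r)
      simp at this
      omega
    · refine ⟨(k, r), hxe, ?_, ?_⟩
      · simp; omega
      · intro c hc; simp [hc]
    · intro k'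
      by_cases hk : k' = k
      · subst hk
        refine ⟨r0, hB.1, ?_, ?_, ?_⟩
        · simpa [hr0.symm] using hx0
        · intro s hs hsD
          by_cases hsr : s = r
          · subst hsr; simp; exact ⟨hfo, by omega, by omega⟩
          · have := hB.2.2.1 s hs hsD
            rw [hoth _ (by simpa using hsr)] at this
            simpa [hsr] using this
        · intro s hs
          have hsr : s ≠ r := by rintro rfl; omega
          have := hB.2.2.2 s hs
          rw [hoth _ (by simpa using hsr)] at this
          simpa [hsr] using this
      · obtain ⟨r2, hB2⟩ := hz k'
        exact ⟨r2, hB2.congr fun s => by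
          rw [hoth (k', s) (by simp [hk])]; simp [hk]⟩
    · intro y' h1 h2 h3
      rcases key y' h1 h2 h3 with h | h
      · exact h.1
      · exfalso; rcases h.1 with h | h <;> omega
  · have heM : e = M ∨ e = -M := by
      obtain ⟨a, ha⟩ := hxe
      obtain ⟨b, hb⟩ := hM
      omega
    have hx0e : Even (x (k, r0)) := by
      rcases hx0 with h | h <;> rw [h]
      · exact hM
      · exact hM.neg
    obtain ⟨b, hb⟩ := hM
    refine ⟨Function.update x (k, r0) (if x (k, r0) = M then M - 1 else -M + 1), ?_, ?_, ?_, ?_⟩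
    · intro h
      have := congrFun h (k, r)
      simp [hr0] at this
      omega
    · refine ⟨(k, r0), hx0e, ?_, ?_⟩
      · simp; split_ifs <;> omega
      · intro c hc; simp [hc]
    · intro k'
      by_cases hk : k' = k
      · subst hk
        refine ⟨r, hrD, ?_, ?_, ?_⟩
        · simpa [hr0] using heM
        · intro s hs hsD
          by_cases hsr : s = r0
          · subst hsr; simp
            split_ifs
            · exact ⟨⟨b - 1, by omega⟩, by omega, by omega⟩
            · exact ⟨⟨-b, by omega⟩, by omega, by omega⟩
          · have := hB.2.2.1 s hsr hsD
            rw [hoth _ (by simpa using hs)] at this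
            simpa [hsr] using this
        · intro s hs
          have hsr : s ≠ r := by rintro rfl; omega
          have hsr0 : s ≠ r0 := by rintro rfl; have := hB.1; omega
          have := hB.2.2.2 s hs
          rw [hoth _ (by simpa using hsr)] at this
          simpa [hsr0] using this
      · obtain ⟨r2, hB2⟩ := hz k'
        exact ⟨r2, hB2.congr fun s => by
          rw [hoth (k', s) (by simp [hk])]; simp [hk]⟩
    · intro y' h1 h2 h3
      rcases key y' h1 h2 h3 with h | h
      · exact absurd h.2 hcase
      · exact h.2

structure Chain (M : ℤ) (D : Fin 4 → ℕ) (n : ℕ) (v : ℕ → V d) : Prop where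
  ev : ∀ c, Even (v 0 c)
  cv : ∀ j, j < n → cov (v j) (v (j+1))
  tp : Top M D (v n)
  zr : ∀ j, n < j → v j = 0

lemma cov_odd {x y : V d} {c} (he : Even (x c)) (h : y c = x c + 1 ∨ y c = x c - 1) :
    Odd (y c) := by
  rcases h with h | h <;> rw [h]
  · exact he.add_one
  · exact he.sub_odd odd_one

lemma flip_zero {x z : V d} (hx : ∀ c, Even (x c)) (hxz : cov x z) :
    ∃ y, y ≠ x ∧ (∀ c, Even (y c)) ∧ cov y z ∧
      ∀ y', y' ≠ x → (∀ c, Even (y' c)) → cov y' z → y' = y := by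
  obtain ⟨c, hxe, hzc, hoth⟩ := hxz
  refine ⟨Function.update x c (2 * z c - x c), ?_, ?_, ?_, ?_⟩
  · intro h
    have := congrFun h c
    simp at this; omega
  · intro c'
    by_cases h : c' = c
    · subst h; simp; exact (even_two_mul _).sub hxe
    · simp [h, hx]
  · refine ⟨c, ?_, ?_, ?_⟩
    · simp; exact (even_two_mul _).sub hxe
    · simp; omega
    · intro c' h; simp [h, hoth _ h]
  · intro y hy hye ⟨c', hye', hzc', hoth'⟩
    have hcc : c' = c := by
      by_contra hcc
      have h1 := cov_odd hxe hzc
      rw [hoth' _ (Ne.symm hcc)] at h1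
      exact (Int.not_even_iff_odd.2 h1) (hye c)
    subst hcc
    have : y c' = 2 * z c' - x c' := by
      by_contra hne
      apply hy
      funext b
      by_cases hb : b = c'
      · subst hb; omega
      · rw [← hoth _ hb, ← hoth' _ hb]
    funext b
    by_cases hb : b = c'
    · subst hb; simp [this]
    · simp [hb, ← hoth _ hb, ← hoth' _ hb]

lemma flip_mid {x w z : V d} (h1 : cov x w) (h2 : cov w z) :
    ∃ y, y ≠ w ∧ cov x y ∧ cov y z ∧ ∀ y', y' ≠ w → cov x y' → cov y' z → y' = y := by
  obtain ⟨c1, he1, hv1, ho1⟩ := h1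
  obtain ⟨c2, he2, hv2, ho2⟩ := h2
  have hw1 := cov_odd he1 hv1
  have hne : c2 ≠ c1 := by
    rintro rfl; exact (Int.not_even_iff_odd.2 hw1) he2
  have hwx2 := ho1 _ hne
  have hzw1 := ho2 _ hne.symm
  refine ⟨Function.update x c2 (z c2), ?_, ?_, ?_, ?_⟩
  · intro h
    have := congrFun h c2
    simp at this; omega
  · refine ⟨c2, by rwa [← hwx2], ?_, ?_⟩
    · simp; omega
    · intro c hc; simp [hc]
  · refine ⟨c1, ?_, ?_, ?_⟩
    · simpa [hne.symm] using he1
    · simp [hne.symm]; omega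
    · intro c hc
      by_cases hc2 : c = c2
      · subst hc2; simp
      · simp [hc2, ho2 _ hc2, ho1 _ hc]
  · intro y hy ⟨b1, hb1, hu1, hp1⟩ ⟨b2, hb2, hu2, hp2⟩
    have hy1 := cov_odd hb1 hu1
    have hbne : b2 ≠ b1 := by
      rintro rfl; exact (Int.not_even_iff_odd.2 hy1) hb2
    have hb1c : b1 = c1 ∨ b1 = c2 := by
      by_contra hcon
      push Not at hcon
      have := hp2 _ hbne.symm
      have := ho1 _ hcon.1
      have := ho2 _ hcon.2
      omega
    rcases hb1c with h | h
    · exfalso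
      subst h
      apply hy
      funext c
      by_cases hc : c = b1
      · subst hc; rw [← hp2 _ hbne.symm, hzw1]
      · rw [hp1 _ hc, ho1 _ hc]
    · subst h
      funext c
      by_cases hc : c = b1
      · subst hc; simp; rw [hp2 _ hbne.symm]
      · simp [hc, hp1 _ hc]

lemma chain_update {M : ℤ} {D : Fin 4 → ℕ} {n : ℕ} {v : ℕ → V d} (hv : Chain M D n v)
    {j : ℕ} (hj : j ≤ n) {y : V d} (h0 : j = 0 → ∀ c, Even (y c))
    (h1 : ∀ i, j = i + 1 → cov (v i) y) (h2 : j < n → cov y (v (j+1)))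
    (h3 : j = n → Top M D y) : Chain M D n (Function.update v j y) := by
  refine ⟨?_, ?_, ?_, ?_⟩
  · by_cases h : j = 0
    · subst h; simpa using h0 rfl
    · simpa [Function.update_of_ne (Ne.symm h)] using hv.ev
  · intro i hi
    by_cases h : i = j
    · subst h; simpa using h2 hi
    · by_cases h' : i + 1 = j
      · subst h'; simpa using h1 i rfl
      · simpa [Function.update_of_ne h, Function.update_of_ne h'] using hv.cv i hi
  · by_cases h : n = j
    · subst h; simpa using h3 rfl
    · simpa [Function.update_of_ne h] using hv.tp
  · intro i hi
    rw [Function.update_of_ne (by omega)]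
    exact hv.zr i hi

theorem flip {M : ℤ} (hM : Even M) (hM0 : 0 < M) {D : Fin 4 → ℕ} {n : ℕ} (hn : 0 < n)
    {v : ℕ → V d} (hv : Chain M D n v) {j : ℕ} (hj : j ≤ n) :
    ∃ y, y ≠ v j ∧ Chain M D n (Function.update v j y) ∧
      ∀ y', y' ≠ v j → Chain M D n (Function.update v j y') → y' = y := by
  rcases Nat.eq_zero_or_pos j with rfl | hj0
  · obtain ⟨y, h1, h2, h3, h4⟩ := flip_zero hv.ev (hv.cv 0 hn)
    refine ⟨y, h1, chain_update hv hj (fun _ => h2) (by omega) (fun _ => h3) (by omega), ?_⟩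
    intro y' e1 e2
    refine h4 y' e1 (by simpa using e2.ev) (by simpa using e2.cv 0 hn)
  · obtain ⟨i, rfl⟩ : ∃ i, j = i + 1 := ⟨j - 1, by omega⟩
    rcases Nat.lt_or_ge (i+1) n with hjn | hjn
    · obtain ⟨y, h1, h2, h3, h4⟩ := flip_mid (hv.cv i (by omega)) (hv.cv (i+1) hjn)
      refine ⟨y, h1, chain_update hv hj (by omega) (fun i' h => ?_) (fun _ => h3) (by omega), ?_⟩
      · obtain rfl : i = i' := by omega
        exact h2
      · intro y' e1 e2
        refine h4 y' e1 (by simpa using e2.cv i (by omega)) (by simpa using e2.cv (i+1) hjn)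
    · obtain rfl : n = i + 1 := by omega
      obtain ⟨y, h1, h2, h3, h4⟩ := top_flip hM hM0 (hv.cv i (by omega)) hv.tp
      refine ⟨y, h1, chain_update hv hj (by omega) (fun i' h => ?_) (by omega) (fun _ => h3), ?_⟩
      · obtain rfl : i = i' := by omega
        exact h2
      · intro y' e1 e2
        refine h4 y' e1 (by simpa using e2.cv i (by omega)) (by simpa using e2.tp)

/-- vertices -/
def S (M : ℤ) (v : V d) : Prop :=
  (∀ c, -M ≤ v c ∧ v c ≤ M) ∧ ∀ k, ∃ r, v (k, r) = M ∨ v (k, r) = -M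

lemma Chain.close {M : ℤ} {D : Fin 4 → ℕ} {n : ℕ} {v : ℕ → V d} (hv : Chain M D n v)
    (c) : ∀ i j, i + j ≤ n → (v (i+j) c = v i c ∨ (Even (v i c) ∧ Odd (v (i+j) c) ∧ (v (i+j) c = v i c + 1 ∨ v (i+j) c = v i c - 1))) := by
  intro i j
  induction j with
  | zero => intro h; left; rfl
  | succ j ih =>
    intro h
    obtain ⟨b, hb, hb1, hb2⟩ := hv.cv (i+j) (by omega)
    rw [← add_assoc]
    by_cases hc : c = b
    · subst hc
      have ho := cov_odd hb hb1
      rcases ih (by omega) with h1 | h1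
      · right; rw [h1] at hb hb1; exact ⟨hb, ho, hb1⟩
      · exact absurd hb (Int.not_even_iff_odd.2 h1.2.1)
    · rw [hb2 _ hc]; exact ih (by omega)

lemma Chain.mem_S {M : ℤ} (hM : Even M) (hM0 : 0 < M) {D : Fin 4 → ℕ} {n : ℕ} {v : ℕ → V d}
    (hv : Chain M D n v) {i : ℕ} (hi : i ≤ n) : S M (v i) := by
  obtain ⟨j, rfl⟩ := Nat.exists_eq_add_of_le hi
  constructor
  · rintro ⟨k, r⟩
    obtain ⟨r0, hB⟩ := hv.tp k
    rcases hv.close (k, r) i j le_rfl with h | ⟨-, h1, h2⟩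
    · rw [← h]
      by_cases hr : r = r0
      · subst hr; have := hB.2.1; omega
      · by_cases hD : (r : ℕ) ≤ D k
        · have := hB.2.2.1 r hr hD; omega
        · have := hB.2.2.2 r (by omega); omega
    · have := hB.odd hM h1
      omega
  · intro k
    obtain ⟨r0, hB⟩ := hv.tp k
    refine ⟨r0, ?_⟩
    rcases hv.close (k, r0) i j le_rfl with h | ⟨-, h1, h2⟩
    · rw [← h]; exact hB.2.1
    · exact absurd rfl (hB.odd hM h1).1

lemma finite_S (M : ℤ) : {v : V d | S M v}.Finite := by
  refine Set.Finite.subset (Set.finite_Icc (fun _ => -M) (fun _ => M)) ?_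
  intro v hv
  exact ⟨fun c => (hv.1 c).1, fun c => (hv.1 c).2⟩

lemma finite_chain {M : ℤ} (hM : Even M) (hM0 : 0 < M) (D : Fin 4 → ℕ) (n : ℕ) :
    {v : ℕ → V d | Chain M D n v}.Finite := by
  have hf : (Set.univ.pi fun _ : Fin (n+1) => {v : V d | S M v}).Finite :=
    Set.Finite.pi fun _ => finite_S M
  refine Set.Finite.of_finite_image (f := fun v (i : Fin (n+1)) => v i) (hf.subset ?_) ?_
  · rintro _ ⟨v, hv, rfl⟩ i -
    exact Chain.mem_S hM hM0 hv (by omega)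
  · intro v hv w hw h
    funext j
    by_cases hj : j ≤ n
    · exact congrFun h ⟨j, by omega⟩
    · rw [hv.zr j (by omega), hw.zr j (by omega)]

/-- number of odd coordinates -/
def dim (v : V d) : ℕ := (Finset.univ.filter fun c => Odd (v c)).card

lemma cov_dim {x y : V d} (h : cov x y) : dim y = dim x + 1 := by
  obtain ⟨c, he, hc, ho⟩ := h
  have : (Finset.univ.filter fun b => Odd (y b)) =
      insert c (Finset.univ.filter fun b => Odd (x b)) := by
    ext b
    by_cases hb : b = c
    · subst hb; simp [cov_odd he hc]
    · simp [hb, ho _ hb]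
  rw [dim, this, Finset.card_insert_of_notMem, dim]
  simp
  exact he

lemma Chain.dim {M : ℤ} {D : Fin 4 → ℕ} {n : ℕ} {v : ℕ → V d} (hv : Chain M D n v)
    {i : ℕ} (hi : i ≤ n) : dim (v i) = i := by
  induction i with
  | zero =>
    rw [EQ.dim, Finset.card_eq_zero, Finset.filter_eq_empty_iff]
    intro c _
    exact Int.not_odd_iff_even.2 (hv.ev c)
  | succ i ih => rw [cov_dim (hv.cv i (by omega)), ih (by omega)]

end EQ


namespace EQ
open Finset

abbrev F2 := ZMod 2

variable {d : ℕ}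

lemma F2.two (x : F2) : x + x = 0 := by revert x; decide

/-- admissible mesh -/
def Adm (M : ℤ) : Prop := Even M ∧ 0 < M

open scoped Classical in
def X (M : ℤ) (D : Fin 4 → ℕ) (n : ℕ) : Finset (ℕ → V d) :=
  if h : Even M ∧ 0 < M then (finite_chain h.1 h.2 D n).toFinset else ∅

lemma mem_X {M : ℤ} (hM : Adm M) {D : Fin 4 → ℕ} {n : ℕ} {v : ℕ → V d} :
    v ∈ X M D n ↔ Chain M D n v := by
  unfold X
  rw [dif_pos (show Even M ∧ 0 < M from hM)]; simp

def face {α : Type*} (j : ℕ) (v : ℕ → α) : ℕ → α := fun i => if i < j then v i else v (i+1)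
def sh {α : Type*} (v : ℕ → α) : ℕ → α := fun i => v (i+1)

lemma face_zero {α : Type*} (v : ℕ → α) : face 0 v = sh v := by
  funext i; simp [face, sh]

lemma face_update {α : Type*} (j : ℕ) (v : ℕ → α) (y : α) :
    face j (Function.update v j y) = face j v := by
  funext i
  unfold face
  split_ifs with h
  · rw [Function.update_of_ne (by omega)]
  · rw [Function.update_of_ne (by omega)]

lemma sh_update {α : Type*} (v : ℕ → α) (y : α) : sh (Function.update v 0 y) = sh v := by
  rw [← face_zero, face_update, face_zero]

lemma face_comp {α β : Type*} (m : α → β) (j : ℕ) (v : ℕ → α) :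
    face j (m ∘ v) = m ∘ face j v := by
  funext i; simp only [face, Function.comp]; split_ifs <;> rfl

lemma sh_comp {α β : Type*} (m : α → β) (v : ℕ → α) : sh (m ∘ v) = m ∘ sh v := rfl

lemma sh_face {α : Type*} (j : ℕ) (v : ℕ → α) : sh (face (j+1) v) = face j (sh v) := by
  funext i; simp [sh, face]

lemma face_head {α : Type*} (j : ℕ) (v : ℕ → α) : face (j+1) v 0 = v 0 := by
  simp [face]

theorem flip_sum {M : ℤ} (hM : Adm M) {D : Fin 4 → ℕ} {n : ℕ} (hn : 0 < n) {j : ℕ} (hj : j ≤ n)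
    (F : (ℕ → V d) → F2)
    (hF : ∀ v ∈ X M D n, ∀ y, Function.update v j y ∈ X M D n → F (Function.update v j y) = F v) :
    ∑ v ∈ X M D n, F v = 0 := by
  classical
  have hfl : ∀ v ∈ X (d := d) M D n, ∃ y, y ≠ v j ∧ Chain M D n (Function.update v j y) ∧
      ∀ y', y' ≠ v j → Chain M D n (Function.update v j y') → y' = y :=
    fun v hv => flip hM.1 hM.2 hn ((mem_X hM).1 hv) hj
  choose! y h1 h2 h3 using hfl
  refine Finset.sum_involution (fun v hv => Function.update v j (y v)) ?_ ?_ ?_ ?_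
  · intro v hv
    rw [hF v hv _ ((mem_X hM).2 (h2 v hv)), F2.two]
  · intro v hv _ h
    apply h1 v hv
    have := congrFun h j
    simpa using this
  · intro v hv
    exact (mem_X hM).2 (h2 v hv)
  · intro v hv
    have hm := (mem_X hM).2 (h2 v hv)
    have := h3 _ hm (v j) (by simpa using (h1 v hv).symm) (by simpa using (mem_X hM).1 hv)
    rw [← this]; simp

lemma flip0 {M : ℤ} (hM : Adm M) {D : Fin 4 → ℕ} {n : ℕ} (hn : 0 < n)
    (F : (ℕ → V d) → F2) : ∑ v ∈ X M D n, F (sh v) = 0 :=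
  flip_sum hM hn (Nat.zero_le _) _ fun v _ y _ => by rw [sh_update]

/-- symmetries -/
structure Sym (M : ℤ) (D : Fin 4 → ℕ) (m : V d → V d) : Prop where
  inv : ∀ v, m (m v) = v
  cov : ∀ x y, cov x y → cov (m x) (m y)
  ev : ∀ x, (∀ c, Even (x c)) → ∀ c, Even (m x c)
  tp : ∀ x, Top M D x → Top M D (m x)
  zr : m 0 = 0

lemma Sym.mem {M : ℤ} (hM : Adm M) {D : Fin 4 → ℕ} {n : ℕ} {m : V d → V d} (hm : Sym M D m)
    {v : ℕ → V d} (hv : v ∈ X M D n) : m ∘ v ∈ X M D n := by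
  rw [mem_X hM] at hv ⊢
  exact ⟨hm.ev _ hv.ev, fun j hj => hm.cov _ _ (hv.cv j hj), hm.tp _ hv.tp, fun j hj => by
    simp [hv.zr j hj, hm.zr]⟩

lemma Sym.comp {M : ℤ} {D : Fin 4 → ℕ} {m : V d → V d} (hm : Sym M D m) (v : ℕ → V d) :
    m ∘ (m ∘ v) = v := by
  funext i; simp [hm.inv]

lemma Sym.sum {M : ℤ} (hM : Adm M) {D : Fin 4 → ℕ} {n : ℕ} {m : V d → V d} (hm : Sym M D m)
    (F : (ℕ → V d) → F2) : ∑ v ∈ X M D n, F (m ∘ v) = ∑ v ∈ X M D n, F v := by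
  refine Finset.sum_nbij' (fun v => m ∘ v) (fun v => m ∘ v) ?_ ?_ ?_ ?_ ?_
  · intro v hv; exact hm.mem hM hv
  · intro v hv; exact hm.mem hM hv
  · intro v hv; exact hm.comp v
  · intro v hv; exact hm.comp v
  · intro v hv; rfl

theorem switch {M : ℤ} (hM : Adm M) {D : Fin 4 → ℕ} {n : ℕ} {m : V d → V d} (hm : Sym M D m)
    (ψ u u' : (ℕ → V d) → F2) (hψ : ∀ v ∈ X M D n, ψ (m ∘ v) = ψ v)
    (hu : ∀ v ∈ X M D n, ψ v ≠ 0 → u (m ∘ v) = u v + 1)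
    (hu' : ∀ v ∈ X M D n, ψ v ≠ 0 → u' (m ∘ v) = u' v + 1) :
    ∑ v ∈ X M D n, u v * ψ v = ∑ v ∈ X M D n, u' v * ψ v := by
  have h1 : ∑ v ∈ X M D n, u v * ψ v + ∑ v ∈ X M D n, u' v * ψ v =
      ∑ v ∈ X M D n, (u v * (u v + u' v) * ψ v) +
      ∑ v ∈ X M D n, (u (m ∘ v) * (u (m ∘ v) + u' (m ∘ v)) * ψ (m ∘ v)) := by
    rw [← Finset.sum_add_distrib, ← Finset.sum_add_distrib]
    refine Finset.sum_congr rfl fun v hv => ?_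
    rw [hψ v hv]
    by_cases h : ψ v = 0
    · simp [h]
    · rw [hu v hv h, hu' v hv h]
      generalize u v = a; generalize u' v = b; generalize ψ v = c
      revert a b c; decide
  rw [hm.sum hM (fun v => u v * (u v + u' v) * ψ v), F2.two] at h1
  have : ∀ a b : F2, a + b = 0 → a = b := by decide
  exact this _ _ h1

/-- negate block k -/
def ng (k : Fin 4) (v : V d) : V d := fun c => if c.1 = k then - v c else v c

lemma ng_sym (M : ℤ) (D : Fin 4 → ℕ) (k : Fin 4) : Sym (d := d) M D (ng k) := by
  refine ⟨?_, ?_, ?_, ?_, ?_⟩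
  · intro v; funext c; unfold ng; split_ifs <;> simp
  · rintro x y ⟨c, h1, h2, h3⟩
    refine ⟨c, ?_, ?_, ?_⟩
    · unfold ng; split_ifs <;> simpa using h1
    · unfold ng; split_ifs <;> omega
    · intro b hb; unfold ng; rw [h3 b hb]
  · intro x hx c; unfold ng; split_ifs <;> simpa using hx c
  · intro x hx k'
    obtain ⟨r0, h1, h2, h3, h4⟩ := hx k'
    refine ⟨r0, h1, ?_, ?_, ?_⟩
    · unfold ng; split_ifs <;> omega
    · intro r hr hD
      obtain ⟨e1, e2, e3⟩ := h3 r hr hD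
      unfold ng; split_ifs
      · refine ⟨by simpa using e1.neg, by omega, by omega⟩
      · exact ⟨e1, e2, e3⟩
    · intro r hr; unfold ng; split_ifs <;> simp [h4 r hr]
  · funext c; simp [ng]

/-- permute blocks -/
def pm (σ : Equiv.Perm (Fin 4)) (v : V d) : V d := fun c => v (σ c.1, c.2)

lemma pm_sym (M : ℤ) (D : Fin 4 → ℕ) (σ : Equiv.Perm (Fin 4)) (hσ : ∀ k, σ (σ k) = k)
    (hD : ∀ k, D (σ k) = D k) : Sym (d := d) M D (pm σ) := by
  refine ⟨?_, ?_, ?_, ?_, ?_⟩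
  · intro v; funext c; simp [pm, hσ]
  · rintro x y ⟨⟨k, r⟩, h1, h2, h3⟩
    refine ⟨(σ k, r), by simpa [pm, hσ] using h1, by simpa [pm, hσ] using h2, ?_⟩
    intro b hb
    apply h3
    intro h
    apply hb
    rw [Prod.mk.injEq] at h
    rw [← h.1, ← h.2, hσ]
  · intro x hx c; exact hx _
  · intro x hx k'
    obtain ⟨r0, h1, h2, h3, h4⟩ := hx (σ k')
    rw [hD] at h1 h3 h4
    exact ⟨r0, h1, h2, h3, h4⟩
  · rfl

open scoped Classical in
/-- sign of the last nonzero coordinate in block k -/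
def g (k : Fin 4) (v : V d) : F2 :=
  if ∃ r, 0 < v (k, r) ∧ ∀ r', r < r' → v (k, r') = 0 then 1 else 0

lemma exists_last {v : V d} {k : Fin 4} (h : ∃ r, v (k, r) ≠ 0) :
    ∃ r, v (k, r) ≠ 0 ∧ ∀ r', r < r' → v (k, r') = 0 := by
  classical
  obtain ⟨r, hr⟩ := h
  have hne : (Finset.univ.filter fun r => v (k, r) ≠ 0).Nonempty := ⟨r, by simpa using hr⟩
  refine ⟨_, (Finset.mem_filter.1 (Finset.max'_mem _ hne)).2, ?_⟩
  intro r' hr'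
  by_contra hcon
  exact absurd (Finset.le_max' _ r' (by simpa using hcon)) (not_le.2 hr')

lemma g_eq {v : V d} {k : Fin 4} {r} (h : ∀ r', r < r' → v (k, r') = 0) (h0 : v (k, r) ≠ 0) :
    g k v = if 0 < v (k, r) then 1 else 0 := by
  unfold g
  congr 1
  rw [eq_iff_iff]
  constructor
  · rintro ⟨r1, h1, h2⟩
    rcases lt_trichotomy r r1 with h3 | h3 | h3
    · rw [h r1 h3] at h1; omega
    · rwa [h3]
    · exact absurd (h2 r h3) h0
  · intro h1; exact ⟨r, h1, h⟩

lemma g_ng_same {v : V d} {k : Fin 4} (h : ∃ r, v (k, r) ≠ 0) : g k (ng k v) = g k v + 1 := by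
  obtain ⟨r, h0, h1⟩ := exists_last h
  rw [g_eq h1 h0, g_eq (r := r) (fun r' hr' => by simp [ng, h1 r' hr']) (by simpa [ng] using h0)]
  simp only [ng]
  split_ifs <;> first | omega | decide

lemma g_ng_ne {v : V d} {k k' : Fin 4} (h : k ≠ k') : g k (ng k' v) = g k v := by
  simp [g, ng, h]

lemma g_pm (v : V d) (k : Fin 4) (σ) : g k (pm σ v) = g (σ k) v := by
  unfold g; rfl

lemma S.ne {M : ℤ} (hM : Adm M) {v : V d} (hv : S M v) (k : Fin 4) : ∃ r, v (k, r) ≠ 0 := by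
  obtain ⟨r, hr⟩ := hv.2 k
  have := hM.2
  exact ⟨r, by omega⟩

lemma X_S {M : ℤ} (hM : Adm M) {D : Fin 4 → ℕ} {n : ℕ} {v : ℕ → V d} (hv : v ∈ X M D n) {i : ℕ}
    (hi : i ≤ n) : S M (v i) := ((mem_X hM).1 hv).mem_S hM.1 hM.2 hi

lemma Gstep {M : ℤ} (hM : Adm M) {D : Fin 4 → ℕ} {n : ℕ} (ψ : (ℕ → V d) → F2)
    (p : Fin 4 → ℕ) (hp : ∀ k, p k ≤ n) (k : Fin 4) (j : ℕ) (hj : j ≤ n)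
    (hψ : ∀ v ∈ X M D n, ψ (ng k ∘ v) = ψ v) :
    ∑ v ∈ X M D n, (∏ k, g k (v (p k))) * ψ v =
    ∑ v ∈ X M D n, (∏ k', g k' (v (Function.update p k j k'))) * ψ v := by
  classical
  have h1 : ∀ v : ℕ → V d, (∏ k, g k (v (p k))) * ψ v =
      g k (v (p k)) * ((∏ k' ∈ univ.erase k, g k' (v (p k'))) * ψ v) := by
    intro v; rw [← mul_assoc, Finset.mul_prod_erase _ (fun k => g k (v (p k))) (mem_univ k)]
  have h2 : ∀ v : ℕ → V d, (∏ k', g k' (v (Function.update p k j k'))) * ψ v =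
      g k (v j) * ((∏ k' ∈ univ.erase k, g k' (v (p k'))) * ψ v) := by
    intro v; rw [← mul_assoc, ← Finset.mul_prod_erase _ _ (mem_univ k)]
    simp only [Function.update_self]
    congr 2
    refine Finset.prod_congr rfl fun k' hk' => ?_
    rw [Function.update_of_ne (Finset.ne_of_mem_erase hk')]
  simp only [h1, h2]
  refine switch hM (ng_sym M D k) _ (fun v => g k (v (p k))) (fun v => g k (v j)) ?_ ?_ ?_
  · intro v hv
    rw [hψ v hv]
    congr 1
    refine Finset.prod_congr rfl fun k' hk' => ?_
    exact g_ng_ne (Finset.ne_of_mem_erase hk')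
  · intro v hv _
    exact g_ng_same ((X_S hM hv (hp k)).ne hM k)
  · intro v hv _
    exact g_ng_same ((X_S hM hv hj).ne hM k)

lemma Gswitch {M : ℤ} (hM : Adm M) {D : Fin 4 → ℕ} {n : ℕ} (ψ : (ℕ → V d) → F2)
    (p p' : Fin 4 → ℕ) (hp : ∀ k, p k ≤ n) (hp' : ∀ k, p' k ≤ n)
    (hψ : ∀ k, p k ≠ p' k → ∀ v ∈ X M D n, ψ (ng k ∘ v) = ψ v) :
    ∑ v ∈ X M D n, (∏ k, g k (v (p k))) * ψ v = ∑ v ∈ X M D n, (∏ k, g k (v (p' k))) * ψ v := by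
  have step : ∀ (q : Fin 4 → ℕ) (k : Fin 4), (∀ k, q k ≤ n) → (q k = p k) →
      ∑ v ∈ X M D n, (∏ k, g k (v (q k))) * ψ v =
      ∑ v ∈ X M D n, (∏ k', g k' (v (Function.update q k (p' k) k'))) * ψ v := by
    intro q k hq hqk
    by_cases h : p k = p' k
    · rw [← h, ← hqk, Function.update_eq_self]
    · exact Gstep hM ψ q hq k _ (hp' k) (hψ k h)
  have up : ∀ (q : Fin 4 → ℕ) (k : Fin 4), (∀ k, q k ≤ n) →
      ∀ k', Function.update q k (p' k) k' ≤ n := by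
    intro q k hq k'
    by_cases h : k' = k
    · subst h; simpa using hp' k'
    · simpa [h] using hq k'
  rw [step p 0 hp rfl, step _ 1 (up _ _ hp) (by simp), step _ 2 (up _ _ (up _ _ hp)) (by simp),
    step _ 3 (up _ _ (up _ _ (up _ _ hp))) (by simp)]
  have : Function.update (Function.update (Function.update (Function.update p 0 (p' 0)) 1 (p' 1))
    2 (p' 2)) 3 (p' 3) = p' := by
    funext k; fin_cases k <;> simp
  rw [this]

def G (v : V d) : F2 := ∏ k, g k v

def Itg (M : ℤ) (D : Fin 4 → ℕ) (n : ℕ) (φ : (ℕ → V d) → F2) : F2 :=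
  ∑ v ∈ X M D n, G (v 0) * φ v

def dl (n : ℕ) (ω : (ℕ → V d) → F2) (v : ℕ → V d) : F2 := ∑ j ∈ range (n+1), ω (face j v)

/-- only the zeroth face survives -/
lemma stokes_core {M : ℤ} (hM : Adm M) {D : Fin 4 → ℕ} {n : ℕ} (hn : 0 < n) (w : V d → F2)
    (ω : (ℕ → V d) → F2) :
    ∑ v ∈ X M D n, w (v 0) * dl n ω v = ∑ v ∈ X M D n, w (v 0) * ω (sh v) := by
  simp only [dl, Finset.mul_sum]
  rw [Finset.sum_comm, Finset.sum_range_succ', face_zero_sum]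
  · simp only [face_zero]
where
  face_zero_sum : ∑ k ∈ range n, ∑ v ∈ X M D n, w (v 0) * ω (face (k+1) v) +
    ∑ v ∈ X M D n, w (v 0) * ω (face 0 v) = ∑ v ∈ X M D n, w (v 0) * ω (face 0 v) := by
    rw [Finset.sum_eq_zero, zero_add]
    intro k hk
    refine flip_sum hM hn (j := k+1) (by simpa using hk) _ ?_
    intro v hv y _
    rw [face_update, Function.update_of_ne (by omega)]

lemma switch01 {M : ℤ} (hM : Adm M) {D : Fin 4 → ℕ} {n : ℕ} (hn : 0 < n)
    (ψ : (ℕ → V d) → F2) (hψ : ∀ k, ∀ v ∈ X M D n, ψ (ng k ∘ v) = ψ v) :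
    ∑ v ∈ X M D n, G (v 0) * ψ v = ∑ v ∈ X M D n, G (v 1) * ψ v :=
  Gswitch hM ψ (fun _ => 0) (fun _ => 1) (by simp) (by intro; omega) fun k _ => hψ k

theorem stokes {M : ℤ} (hM : Adm M) {D : Fin 4 → ℕ} {n : ℕ} (hn : 0 < n)
    (ω : (ℕ → V d) → F2) (hω : ∀ k, ∀ v ∈ X M D n, ω (sh (ng k ∘ v)) = ω (sh v)) :
    Itg M D n (dl n ω) = 0 := by
  rw [Itg, stokes_core hM hn, switch01 hM hn (fun v => ω (sh v)) hω]
  exact flip0 hM hn (fun v => G (v 0) * ω v)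

end EQ


namespace EQ
open Finset

variable {d : ℕ}

/-- lowering one dimension -/
def low (D : Fin 4 → ℕ) (i : Fin 4) : Fin 4 → ℕ := Function.update D i (D i - 1)

lemma top_last {M : ℤ} (hM : Adm M) {D : Fin 4 → ℕ} {v : V d} (hv : Top M D v) (i : Fin 4)
    (hD : D i < d + 1) : v (i, ⟨D i, hD⟩) ≠ 0 ∧
      g i v = if 0 < v (i, ⟨D i, hD⟩) then 1 else 0 := by
  obtain ⟨r0, h1, h2, h3, h4⟩ := hv i
  have h0 : v (i, ⟨D i, hD⟩) ≠ 0 := by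
    have := hM.2
    by_cases h : (⟨D i, hD⟩ : Fin (d+1)) = r0
    · rw [h]; omega
    · intro h5
      have := (h3 _ h le_rfl).1
      rw [h5] at this
      exact absurd this (by decide)
  refine ⟨h0, g_eq ?_ h0⟩
  intro r' hr'
  exact h4 r' hr'

lemma face_last_mem {M : ℤ} (hM : Adm M) {D : Fin 4 → ℕ} {n : ℕ} {v : ℕ → V d}
    (hv : Chain M D (n+1) v) (i : Fin 4) (hD : D i < d + 1)
    (h0 : v n (i, ⟨D i, hD⟩) = 0) (h1 : v (n+1) (i, ⟨D i, hD⟩) = 1) :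
    0 < D i ∧ Chain M (low D i) n (face (n+1) v) ∧
    v (n+1) = Function.update (v n) (i, ⟨D i, hD⟩) 1 := by
  obtain ⟨c, hc, hc1, hc2⟩ := hv.cv n (by omega)
  have hcc : c = (i, ⟨D i, hD⟩) := by
    by_contra h
    have := hc2 _ (Ne.symm h)
    omega
  subst hcc
  have hpos : 0 < D i := by
    obtain ⟨r0, hB⟩ := hv.tp i
    have := hB.odd hM.1 (r := ⟨D i, hD⟩) (by rw [h1]; decide)
    by_contra h3
    have h4 := hB.1
    apply this.1
    apply Fin.ext
    simp; omega
  refine ⟨hpos, ⟨?_, ?_, ?_, ?_⟩, ?_⟩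
  · intro c; simpa [face] using hv.ev c
  · intro j hj
    have := hv.cv j (by omega)
    simpa [face, show j < n + 1 by omega, hj] using this
  · have : face (n+1) v n = v n := by simp [face]
    rw [this]
    intro k
    obtain ⟨r0, hB⟩ := hv.tp k
    by_cases hk : k = i
    · subst hk
      have hne := (hB.odd hM.1 (r := ⟨D k, hD⟩) (by rw [h1]; decide)).1
      have hr0 : (r0 : ℕ) ≠ D k := fun h => hne (Fin.ext h.symm)
      have hB1 := hB.1
      have hval : ∀ r : Fin (d+1), (r : ℕ) ≠ D k → v n (k, r) = v (n+1) (k, r) := by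
        intro r hr
        rw [hc2 (k, r)]
        intro h
        apply hr
        rw [Prod.mk.injEq] at h
        rw [h.2]
      refine ⟨r0, ?_, ?_, ?_, ?_⟩
      · simp [low]; omega
      · rw [hval r0 hr0]; exact hB.2.1
      · intro r hr hrD
        simp [low] at hrD
        rw [hval r (by omega)]
        exact hB.2.2.1 r hr (by omega)
      · intro r hr
        simp [low] at hr
        by_cases hrD : (r : ℕ) = D k
        · have : r = ⟨D k, hD⟩ := Fin.ext hrD
          rw [this, h0]
        · rw [hval r hrD]
          exact hB.2.2.2 r (by omega)
    · refine ⟨r0, ?_⟩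
      have : TopB M D (v n) k r0 := hB.congr fun r => by rw [hc2 (k, r) (by simp [hk])]
      simpa [TopB, low, hk] using this
  · intro j hj
    have : ¬ (j < n + 1) := by omega
    simp only [face, this, if_false]
    exact hv.zr _ (by omega)
  · funext c
    by_cases h : c = (i, ⟨D i, hD⟩)
    · subst h; simp [h1]
    · simp [h, hc2 _ h]

lemma ext_last_mem {M : ℤ} (hM : Adm M) {D : Fin 4 → ℕ} {n : ℕ} {x : ℕ → V d}
    (i : Fin 4) (hD : D i < d + 1) (hpos : 0 < D i) (hx : Chain M (low D i) n x) :
    x n (i, ⟨D i, hD⟩) = 0 ∧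
    Chain M D (n+1) (Function.update x (n+1) (Function.update (x n) (i, ⟨D i, hD⟩) 1)) := by
  obtain ⟨r0, hB⟩ := hx.tp i
  have h0 : x n (i, ⟨D i, hD⟩) = 0 := hB.2.2.2 _ (by simp [low]; omega)
  have hM2 : 1 < M := by
    obtain ⟨b, hb⟩ := hM.1
    have := hM.2
    omega
  refine ⟨h0, ⟨?_, ?_, ?_, ?_⟩⟩
  · intro c; simpa using hx.ev c
  · intro j hj
    by_cases hjn : j = n
    · subst hjn
      simp only [Function.update_self]
      rw [Function.update_of_ne (by omega)]
      refine ⟨(i, ⟨D i, hD⟩), by rw [h0]; decide, ?_, ?_⟩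
      · simp [h0]
      · intro c hc; simp [hc]
    · rw [Function.update_of_ne (by omega), Function.update_of_ne (by omega)]
      exact hx.cv j (by omega)
  · simp only [Function.update_self]
    intro k
    by_cases hk : k = i
    · subst hk
      have h1 := hB.1
      simp [low] at h1
      have hr0 : r0 ≠ ⟨D k, hD⟩ := by
        intro h; rw [h] at h1; simp at h1; omega
      refine ⟨r0, by omega, ?_, ?_, ?_⟩
      · simpa [hr0] using hB.2.1
      · intro r hr hrD
        by_cases h : r = ⟨D k, hD⟩
        · subst h; simp; omega
        · have h2 : (r : ℕ) ≠ D k := fun h' => h (Fin.ext h')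
          simpa [h] using hB.2.2.1 r hr (by simp [low]; omega)
      · intro r hr
        have h : r ≠ ⟨D k, hD⟩ := by
          rintro rfl; simp at hr
        simpa [h] using hB.2.2.2 r (by simp [low]; omega)
    · obtain ⟨r1, hB1⟩ := hx.tp k
      refine ⟨r1, ?_⟩
      have : TopB M D (x n) k r1 := by simpa [TopB, low, hk] using hB1
      exact this.congr fun r => by simp [hk]
  · intro j hj
    rw [Function.update_of_ne (by omega)]
    exact hx.zr j (by omega)

theorem top_sum {M : ℤ} (hM : Adm M) {D : Fin 4 → ℕ} {n : ℕ} (i : Fin 4) (hD : D i < d + 1)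
    (H : (ℕ → V d) → F2) :
    ∑ v ∈ X M D (n+1), g i (v (n+1)) * H (face (n+1) v) =
      if 0 < D i then ∑ x ∈ X M (low D i) n, H x else 0 := by
  classical
  set c : Fin 4 × Fin (d+1) := (i, ⟨D i, hD⟩) with hc
  rw [← Finset.sum_filter_add_sum_filter_not (X M D (n+1)) (fun v => v n c = 0)]
  have hz : ∑ v ∈ (X M D (n+1)).filter (fun v => ¬ v n c = 0), g i (v (n+1)) * H (face (n+1) v) = 0 := by
    rw [Finset.sum_filter]
    refine flip_sum hM (by omega) (j := n+1) le_rfl _ ?_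
    have aux : ∀ v ∈ X M D (n+1), v n c ≠ 0 → g i (v (n+1)) = if 0 < v n c then 1 else 0 := by
      intro v hv h0
      rw [mem_X hM] at hv
      obtain ⟨h1, h2⟩ := top_last hM hv.tp i hD
      rw [h2]
      congr 1
      have := hv.close c n 1 le_rfl
      rw [← hc] at *
      rcases this with h | ⟨⟨a, ha⟩, -, h⟩
      · rw [h]
      · rw [eq_iff_iff]; constructor <;> intro <;> omega
    intro v hv y hy
    have e1 : Function.update v (n+1) y n = v n := Function.update_of_ne (by omega) _ _
    rw [face_update]
    by_cases h0 : v n c = 0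
    · simp [e1, h0]
    · rw [if_pos (by rwa [e1]), if_pos h0, aux v hv h0, aux _ hy (by rwa [e1]), e1]
  rw [hz, add_zero]
  have h1 : ∑ v ∈ (X M D (n+1)).filter (fun v => v n c = 0), g i (v (n+1)) * H (face (n+1) v) =
      ∑ v ∈ (X M D (n+1)).filter (fun v => v n c = 0 ∧ v (n+1) c = 1), H (face (n+1) v) := by
    rw [Finset.sum_filter, Finset.sum_filter]
    refine Finset.sum_congr rfl fun v hv => ?_
    rw [mem_X hM] at hv
    by_cases h0 : v n c = 0
    · obtain ⟨h1, h2⟩ := top_last hM hv.tp i hD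
      have := hv.close c n 1 le_rfl
      rw [← hc] at *
      simp only [h0, true_and, if_true]
      rw [h2]
      by_cases h5 : v (n+1) c = 1
      · simp [h5]
      · rw [if_neg (by omega), if_neg h5, zero_mul]
    · simp [h0]
  rw [h1]
  split_ifs with hpos
  · refine Finset.sum_nbij' (fun v => face (n+1) v)
      (fun x => Function.update x (n+1) (Function.update (x n) c 1)) ?_ ?_ ?_ ?_ ?_
    · intro v hv
      rw [Finset.mem_filter, mem_X hM] at hv
      rw [mem_X hM]
      exact (face_last_mem hM hv.1 i hD hv.2.1 hv.2.2).2.1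
    · intro x hx
      rw [mem_X hM] at hx
      rw [Finset.mem_filter, mem_X hM]
      obtain ⟨e1, e2⟩ := ext_last_mem hM i hD hpos hx
      refine ⟨e2, ?_, ?_⟩
      · rw [Function.update_of_ne (by omega)]; exact e1
      · simp
    · intro v hv
      rw [Finset.mem_filter, mem_X hM] at hv
      have := (face_last_mem hM hv.1 i hD hv.2.1 hv.2.2).2.2
      funext j
      by_cases hj : j = n+1
      · subst hj
        rw [Function.update_self, this]
        simp [face, hc]
      · rw [Function.update_of_ne hj]
        unfold face
        split_ifs with h
        · rfl
        · rw [hv.1.zr _ (by omega), hv.1.zr _ (by omega)]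
    · intro x hx
      rw [mem_X hM] at hx
      rw [face_update]
      funext j
      unfold face
      split_ifs with h
      · rfl
      · rw [hx.zr _ (by omega), hx.zr _ (by omega)]
    · intro v hv; rfl
  · refine Finset.sum_eq_zero fun v hv => ?_
    rw [Finset.mem_filter, mem_X hM] at hv
    exact absurd (face_last_mem hM hv.1 i hD hv.2.1 hv.2.2).1 hpos

/-- cup product with the coboundary of a function in front -/
def cup (s : V d → F2) (φ : (ℕ → V d) → F2) (v : ℕ → V d) : F2 := (s (v 0) + s (v 1)) * φ (sh v)

lemma dl_mul (n : ℕ) (b : V d → F2) (φ : (ℕ → V d) → F2) (v : ℕ → V d) :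
    dl n (fun x => b (x 0) * φ x) v = cup b φ v + b (v 0) * dl n φ v := by
  simp only [dl, cup]
  rw [Finset.sum_range_succ', Finset.sum_range_succ' (fun j => φ (face j v)), mul_add, Finset.mul_sum]
  simp only [face_head, face_zero]
  have : sh v 0 = v 1 := rfl
  rw [this]
  have h2 : ∀ a b c s : F2, s + b * c = (a + b) * c + (s + a * c) := by decide
  apply h2

theorem front_g {M : ℤ} (hM : Adm M) {D : Fin 4 → ℕ} {n : ℕ} (i : Fin 4) (hD : D i < d + 1)
    (φ : (ℕ → V d) → F2)
    (hφ : ∀ k, ∀ v ∈ X M D (n+1), φ (sh (ng k ∘ v)) = φ (sh v))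
    (hδ : ∀ v ∈ X M D (n+1), dl (n+1) φ v = 0) :
    Itg M D (n+1) (cup (g i) φ) = if 0 < D i then Itg M (low D i) n φ else 0 := by
  classical
  set p : Fin 4 → ℕ := fun k => if k = i then n+1 else 0 with hp
  set θ : (ℕ → V d) → F2 := fun x => g i (x 0) * φ x with hθ
  have e1 : Itg M D (n+1) (cup (g i) φ) =
      ∑ v ∈ X M D (n+1), (∏ k, g k (v (p k))) * cup (g i) φ v := by
    unfold Itg G
    refine Gswitch hM _ (fun _ => 0) p (by simp) (by intro k; simp only [hp]; split_ifs <;> omega) ?_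
    intro k hk v hv
    unfold cup
    rw [hφ k v hv]
    congr 1
    by_cases hki : i = k
    · subst hki
      simp only [Function.comp]
      rw [g_ng_same ((X_S hM hv (Nat.zero_le _)).ne hM _), g_ng_same ((X_S hM hv (by omega)).ne hM _)]
      generalize g i (v 0) = a; generalize g i (v 1) = b
      revert a b; decide
    · simp [g_ng_ne hki]
  have e2 : ∀ v ∈ X M D (n+1), cup (g i) φ v = dl (n+1) θ v := by
    intro v hv
    rw [hθ, dl_mul, hδ v hv, mul_zero, add_zero]
  rw [e1, Finset.sum_congr rfl (fun v hv => by rw [e2 v hv])]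
  simp only [dl, Finset.mul_sum]
  rw [Finset.sum_comm, Finset.sum_range_succ, Finset.sum_range_succ']
  have hmid : ∀ j ∈ range n, ∑ v ∈ X M D (n+1), (∏ k, g k (v (p k))) * θ (face (j+1) v) = 0 := by
    intro j hj
    rw [Finset.mem_range] at hj
    refine flip_sum hM (by omega) (j := j+1) (by omega) _ ?_
    intro v hv y _
    rw [face_update]
    congr 1
    refine Finset.prod_congr rfl fun k _ => ?_
    rw [Function.update_of_ne]
    simp only [hp]; split_ifs <;> omega
  have hzero : ∑ v ∈ X M D (n+1), (∏ k, g k (v (p k))) * θ (face 0 v) = 0 := by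
    rw [Gswitch hM (fun v => θ (face 0 v)) p (fun k => if k = i then n + 1 else 1)
      (by intro k; simp only [hp]; split_ifs <;> omega) (by intro k; split_ifs <;> omega)]
    · have : ∀ v : ℕ → V d, (∏ k, g k (v (if k = i then n + 1 else 1))) * θ (face 0 v) =
          (fun x : ℕ → V d => (∏ k, g k (x (if k = i then n else 0))) * θ x) (sh v) := by
        intro v
        dsimp only
        rw [face_zero]
        congr 1
        refine Finset.prod_congr rfl fun k _ => ?_
        simp only [sh]
        split_ifs <;> rfl
      simp only [this]
      exact flip0 hM (by omega) (fun x : ℕ → V d => (∏ k, g k (x (if k = i then n else 0))) * θ x)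
    · intro k hk v hv
      have hki : i ≠ k := by
        rintro rfl; simp [hp] at hk
      simp only [hθ, face_zero]
      rw [hφ k v hv]
      simp [sh, g_ng_ne hki]
  rw [Finset.sum_eq_zero hmid, hzero, zero_add, zero_add]
  unfold Itg
  rw [← top_sum hM i hD (fun x => G (x 0) * φ x)]
  refine Finset.sum_congr rfl fun v _ => ?_
  have h3 : ∏ k, g k (v (p k)) = g i (v (n+1)) * ∏ k ∈ univ.erase i, g k (v 0) := by
    rw [← Finset.mul_prod_erase _ _ (mem_univ i)]
    congr 1
    · simp [hp]
    · refine Finset.prod_congr rfl fun k hk => ?_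
      simp [hp, Finset.ne_of_mem_erase hk]
  have h4 : G (v 0) = g i (v 0) * ∏ k ∈ univ.erase i, g k (v 0) :=
    (Finset.mul_prod_erase _ _ (mem_univ i)).symm
  simp only [hθ, face_head]
  rw [h3, h4]
  ring

lemma cup_add (s s' : V d → F2) (φ) (v) : cup (fun x => s x + s' x) φ v = cup s φ v + cup s' φ v := by
  unfold cup; ring

lemma Itg_add (M D n) (φ ψ : (ℕ → V d) → F2) :
    Itg M D n (fun v => φ v + ψ v) = Itg M D n φ + Itg M D n ψ := by
  unfold Itg; rw [← Finset.sum_add_distrib]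
  exact Finset.sum_congr rfl fun v _ => mul_add _ _ _

lemma Itg_congr {M D n} {φ ψ : (ℕ → V d) → F2} (h : ∀ v ∈ X M D n, φ v = ψ v) :
    Itg M D n φ = Itg M D n ψ :=
  Finset.sum_congr rfl fun v hv => by rw [h v hv]

theorem front {M : ℤ} (hM : Adm M) {D : Fin 4 → ℕ} {n : ℕ} (hD : ∀ i, D i < d + 1)
    (φ : (ℕ → V d) → F2)
    (hφ : ∀ k, ∀ v ∈ X M D (n+1), φ (sh (ng k ∘ v)) = φ (sh v))
    (hδ : ∀ v ∈ X M D (n+1), dl (n+1) φ v = 0)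
    (s : V d → F2) (χ : Finset (Fin 4))
    (hs : ∀ v : V d, S M v → ∀ k, s (ng k v) = s v + if k ∈ χ then 1 else 0) :
    Itg M D (n+1) (cup s φ) = ∑ i ∈ χ, if 0 < D i then Itg M (low D i) n φ else 0 := by
  classical
  set b : V d → F2 := fun v => s v + ∑ i ∈ χ, g i v with hb
  have hbz : ∀ v : V d, S M v → ∀ k, b (ng k v) = b v := by
    intro v hv k
    simp only [hb]
    rw [hs v hv k]
    by_cases hk : k ∈ χ
    · rw [← Finset.add_sum_erase _ _ hk, ← Finset.add_sum_erase _ (fun i => g i v) hk, g_ng_same (hv.ne hM k)]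
      rw [Finset.sum_congr rfl (fun i hi => g_ng_ne (Finset.ne_of_mem_erase hi)), if_pos hk]
      generalize ∑ i ∈ χ.erase k, g i v = t
      generalize g k v = u; generalize s v = w
      revert t u w; decide
    · rw [Finset.sum_congr rfl (fun i hi => g_ng_ne (k' := k) (v := v) (by rintro rfl; exact hk hi)), if_neg hk,
        add_zero]
  have hcup : ∀ v, cup s φ v = cup b φ v + ∑ i ∈ χ, cup (g i) φ v := by
    intro v
    simp only [cup, hb]
    rw [← Finset.sum_mul, Finset.sum_add_distrib]
    generalize ∑ i ∈ χ, g i (v 0) = t; generalize ∑ i ∈ χ, g i (v 1) = t'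
    generalize s (v 0) = u; generalize s (v 1) = w; generalize φ (sh v) = z
    revert t t' u w z; decide
  have hI : Itg M D (n+1) (cup s φ) = Itg M D (n+1) (cup b φ) +
      ∑ i ∈ χ, Itg M D (n+1) (cup (g i) φ) := by
    unfold Itg
    rw [Finset.sum_comm, ← Finset.sum_add_distrib]
    refine Finset.sum_congr rfl fun v _ => ?_
    rw [hcup, mul_add, Finset.mul_sum]
  rw [hI]
  have h0 : Itg M D (n+1) (cup b φ) = 0 := by
    rw [← stokes hM (D := D) (n := n+1) (by omega) (fun x => b (x 0) * φ x)]
    · refine Itg_congr fun v hv => ?_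
      rw [dl_mul, hδ v hv, mul_zero, add_zero]
    · intro k v hv
      rw [hφ k v hv]
      congr 1
      exact hbz _ (X_S hM hv (by omega)) k
  rw [h0, zero_add]
  exact Finset.sum_congr rfl fun i _ => front_g hM i (hD i) φ hφ hδ

end EQ


namespace EQ
open Finset

section lin
variable {ι : Type*} [Fintype ι] [DecidableEq ι]

def Pz (K : Submodule ℝ (ι → ℝ)) (j : ι) (w : ι → ℝ) : Prop :=
  w ∈ K ∧ w j = 0 ∧ ∀ i, i ≠ j → 0 < w i

variable {K : Submodule ℝ (ι → ℝ)}

lemma prop_of_zero (hK : ∀ w ∈ K, ∀ i j, i ≠ j → w i = 0 → w j = 0 → w = 0) {w u : ι → ℝ} (hw : w ∈ K) (hu : u ∈ K) {i j : ι} (hij : i ≠ j)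
    (h1 : w j = 0) (h2 : u j = 0) : u i • w = w i • u := by
  have : u i • w - w i • u = 0 := by
    apply hK _ (K.sub_mem (K.smul_mem _ hw) (K.smul_mem _ hu)) i j hij
    · simp; ring
    · simp [h1, h2]
  exact sub_eq_zero.1 this

lemma Pz_unique (hK : ∀ w ∈ K, ∀ i j, i ≠ j → w i = 0 → w j = 0 → w = 0) [Nontrivial ι] {j : ι} {w u : ι → ℝ} (hw : Pz K j w) (hu : Pz K j u) :
    ∃ c : ℝ, 0 < c ∧ u = c • w := by
  obtain ⟨i, hi⟩ := exists_ne j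
  have h := prop_of_zero hK hw.1 hu.1 hi hw.2.1 hu.2.1
  have p1 := hw.2.2 i hi
  have p2 := hu.2.2 i hi
  refine ⟨u i / w i, by positivity, ?_⟩
  rw [div_eq_inv_mul, mul_smul, h, smul_smul, inv_mul_cancel₀ p1.ne', one_smul]

lemma Pz_pos (hK : ∀ w ∈ K, ∀ i j, i ≠ j → w i = 0 → w j = 0 → w = 0) (hd : ∀ i, ∃ u ∈ K, u i = 0 ∧ u ≠ 0) [Nontrivial ι] {j : ι} {w : ι → ℝ} (hw : Pz K j w) : ∃ w0 ∈ K, ∀ i, 0 < w0 i := by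
  obtain ⟨i, hi⟩ := exists_ne j
  obtain ⟨u, hu, hui, hu0⟩ := hd i
  have huj : u j ≠ 0 := fun h => hu0 (hK u hu i j hi hui h)
  -- wlog u j > 0
  obtain ⟨u', hu', huj'⟩ : ∃ u' ∈ K, 0 < u' j := by
    rcases lt_or_gt_of_ne huj with h | h
    · exact ⟨-u, K.neg_mem hu, by simpa using h⟩
    · exact ⟨u, hu, h⟩
  obtain ⟨B, hB⟩ : ∃ B : ℝ, ∀ i, i ≠ j → 0 < B * w i + u' i := by
    have : ∀ i, ∃ B : ℝ, i ≠ j → ∀ B' ≥ B, 0 < B' * w i + u' i := by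
      intro i
      by_cases h : i = j
      · exact ⟨0, fun h' => absurd h h'⟩
      · have := hw.2.2 i h
        refine ⟨(|u' i| + 1) / w i, fun _ B' hB' => ?_⟩
        have h1 : |u' i| + 1 ≤ B' * w i := by
          rwa [ge_iff_le, div_le_iff₀ this] at hB'
        have := neg_abs_le (u' i)
        linarith
    choose B hB using this
    refine ⟨∑ i, |B i|, fun i hi => hB i hi _ ?_⟩
    calc B i ≤ |B i| := le_abs_self _
      _ ≤ _ := Finset.single_le_sum (f := fun i => |B i|) (fun i _ => abs_nonneg _) (mem_univ i)
  refine ⟨B • w + u', K.add_mem (K.smul_mem _ hw.1) hu', fun i => ?_⟩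
  by_cases h : i = j
  · subst h; simpa [hw.2.1] using huj'
  · simpa using hB i h

lemma pos_pair (hK : ∀ w ∈ K, ∀ i j, i ≠ j → w i = 0 → w j = 0 → w = 0) (hd : ∀ i, ∃ u ∈ K, u i = 0 ∧ u ≠ 0) [Nontrivial ι] {w0 : ι → ℝ} (hw : w0 ∈ K) (hp : ∀ i, 0 < w0 i) :
    ∃ j1 j2 W1 W2, j1 ≠ j2 ∧ Pz K j1 W1 ∧ Pz K j2 W2 ∧ ∀ j w, Pz K j w → j = j1 ∨ j = j2 := by
  obtain ⟨i0, -⟩ := exists_pair_ne ι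
  obtain ⟨u, hu, hui, hu0⟩ := hd i0
  set c : ι → ℝ := fun i => u i / w0 i with hc
  have hcu : ∀ i, u i = c i * w0 i := fun i => by
    rw [hc]; field_simp [(hp i).ne']
  have hinj : ∀ i j, i ≠ j → c i ≠ c j := by
    intro i j hij h
    have h0 := hK (u - c i • w0) (K.sub_mem hu (K.smul_mem _ hw)) i j hij
      (by simp [hcu i]) (by simp [hcu j, h])
    have h1 := congrFun h0 i0
    simp [hui] at h1
    rcases h1 with h1 | h1
    · rw [h1, zero_smul, sub_zero] at h0; exact hu0 h0
    · exact absurd h1 (hp i0).ne'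
  obtain ⟨j1, -, h1⟩ := Finset.exists_max_image univ c ⟨i0, mem_univ _⟩
  obtain ⟨j2, -, h2⟩ := Finset.exists_min_image univ c ⟨i0, mem_univ _⟩
  have hj : j1 ≠ j2 := by
    rintro rfl
    obtain ⟨i, hi⟩ := exists_ne j1
    exact hinj i j1 hi (le_antisymm (h1 i (mem_univ _)) (h2 i (mem_univ _)))
  refine ⟨j1, j2, c j1 • w0 - u, u - c j2 • w0, hj, ⟨?_, ?_, ?_⟩, ⟨?_, ?_, ?_⟩, ?_⟩
  · exact K.sub_mem (K.smul_mem _ hw) hu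
  · simp [hcu j1]
  · intro i hi
    have := lt_of_le_of_ne (h1 i (mem_univ _)) (hinj i j1 hi)
    simp [hcu i]
    exact mul_lt_mul_of_pos_right this (hp i)
  · exact K.sub_mem hu (K.smul_mem _ hw)
  · simp [hcu j2]
  · intro i hi
    have := lt_of_le_of_ne (h2 i (mem_univ _)) (hinj j2 i hi.symm)
    simp [hcu i]
    exact mul_lt_mul_of_pos_right this (hp i)
  · intro j w hjw
    by_contra hcon
    push Not at hcon
    have hzj : (u - c j • w0) j = 0 := by simp [hcu j]
    have hm := K.sub_mem hu (K.smul_mem (c j) hw)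
    have e1 := prop_of_zero hK hjw.1 hm hcon.1.symm hjw.2.1 hzj
    have e2 := congrFun e1 j2
    simp only [Pi.smul_apply, Pi.sub_apply, smul_eq_mul, hcu] at e2
    have p1 := hjw.2.2 j1 hcon.1.symm
    have p2 := hjw.2.2 j2 hcon.2.symm
    have q1 : 0 < c j1 * w0 j1 - c j * w0 j1 := by
      have := lt_of_le_of_ne (h1 j (mem_univ _)) (hinj j j1 hcon.1)
      nlinarith [hp j1]
    have q2 : c j2 * w0 j2 - c j * w0 j2 < 0 := by
      have := lt_of_le_of_ne (h2 j (mem_univ _)) (hinj j2 j hcon.2.symm)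
      nlinarith [hp j2]
    have : 0 < (c j1 * w0 j1 - c j * w0 j1) * w j2 := mul_pos q1 p2
    have : w j1 * (c j2 * w0 j2 - c j * w0 j2) < 0 := mul_neg_of_pos_of_neg p1 q2
    linarith

def sg (x : ℝ) : F2 := if 0 < x then 1 else 0

lemma sg_pos_mul {c x : ℝ} (hc : 0 < c) : sg (c * x) = sg x := by
  unfold sg; simp [hc]

lemma sg_ne_iff (a b : F2) : a ≠ b ↔ a + b = 1 := by revert a b; decide

open scoped Classical in
theorem lin_main (hK : ∀ w ∈ K, ∀ i j, i ≠ j → w i = 0 → w j = 0 → w = 0) (hd : ∀ i, ∃ u ∈ K, u i = 0 ∧ u ≠ 0) [Nontrivial ι] (l : (ι → ℝ) →ₗ[ℝ] ℝ)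
    (hl : ∀ w ∈ K, ∀ j, w j = 0 → l w = 0 → w = 0) (s : ι → F2) :
    (∑ j, (if ∃ w, Pz K j w then (1 : F2) else 0)) = 0 ∧
    (if ∃ w ∈ K, (∀ i, 0 < w i) ∧ l w = 0 then (1 : F2) else 0) +
      ∑ j, (if ∃ w, Pz K j w ∧ sg (l w) ≠ s j then (1 : F2) else 0) =
      ∑ j, (if ∃ w, Pz K j w then s j else 0) := by
  by_cases hpos : ∃ w0 ∈ K, ∀ i, 0 < w0 i
  · obtain ⟨w0, hw, hp⟩ := hpos
    obtain ⟨j1, j2, W1, W2, hj, h1, h2, h3⟩ := pos_pair hK hd hw hp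
    have hsum : ∀ f : ι → F2, (∀ j, (¬ ∃ w, Pz K j w) → f j = 0) → ∑ j, f j = f j1 + f j2 := by
      intro f hf
      rw [← Finset.sum_pair hj]
      symm
      apply Finset.sum_subset (Finset.subset_univ _)
      intro j _ hj'
      apply hf
      rintro ⟨w, hw⟩
      apply hj'
      rcases h3 j w hw with h | h <;> simp [h]
    have nz : ∀ j W, Pz K j W → l W ≠ 0 := by
      intro j W hW h0
      obtain ⟨i, hi⟩ := exists_ne j
      have := hl W hW.1 j hW.2.1 h0
      have h4 := hW.2.2 i hi
      rw [this] at h4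
      exact lt_irrefl _ h4
    refine ⟨?_, ?_⟩
    · rw [hsum _ (fun j h => if_neg h), if_pos ⟨W1, h1⟩, if_pos ⟨W2, h2⟩]; decide
    · have hom : ∀ j W, Pz K j W →
          (if ∃ w, Pz K j w ∧ sg (l w) ≠ s j then (1 : F2) else 0) = sg (l W) + s j := by
        intro j W hW
        have : (∃ w, Pz K j w ∧ sg (l w) ≠ s j) ↔ sg (l W) ≠ s j := by
          constructor
          · rintro ⟨w, hw, hs⟩
            obtain ⟨c, hc, rfl⟩ := Pz_unique hK hW hw
            rwa [map_smul, smul_eq_mul, sg_pos_mul hc] at hs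
          · intro h; exact ⟨W, hW, h⟩
        simp only [this]
        generalize sg (l W) = a; generalize s j = b
        revert a b; decide
      rw [hsum _ (fun j h => if_neg (fun h' => h ⟨_, h'.choose_spec.1⟩)), hsum _ (fun j h => if_neg h),
        hom j1 W1 h1, hom j2 W2 h2,
        if_pos (c := ∃ w, Pz K j1 w) ⟨W1, h1⟩, if_pos (c := ∃ w, Pz K j2 w) ⟨W2, h2⟩]
      have hE : (if ∃ w ∈ K, (∀ i, 0 < w i) ∧ l w = 0 then (1 : F2) else 0) =
          sg (l W1) + sg (l W2) := by
        have n1 := nz _ _ h1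
        have n2 := nz _ _ h2
        have p12 := h1.2.2 j2 hj.symm
        have p21 := h2.2.2 j1 hj
        by_cases hs : l W1 * l W2 < 0
        · rw [if_pos]
          · unfold sg
            rcases mul_neg_iff.1 hs with h | h
            · rw [if_pos h.1, if_neg (by linarith)]; decide
            · rw [if_neg (by linarith), if_pos h.2]; decide
          · refine ⟨|l W2| • W1 + |l W1| • W2, K.add_mem (K.smul_mem _ h1.1) (K.smul_mem _ h2.1),
              ?_, ?_⟩
            · have a1 := abs_pos.2 n1
              have a2 := abs_pos.2 n2
              intro i
              simp only [Pi.add_apply, Pi.smul_apply, smul_eq_mul]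
              by_cases e1 : i = j1
              · subst e1; rw [h1.2.1]; simp; positivity
              · have := h1.2.2 i e1
                by_cases e2 : i = j2
                · subst e2; rw [h2.2.1]; simp; positivity
                · have := h2.2.2 i e2
                  positivity
            · simp only [map_add, map_smul, smul_eq_mul]
              rcases mul_neg_iff.1 hs with h | h
              · rw [abs_of_pos h.1, abs_of_neg h.2]; ring
              · rw [abs_of_neg h.1, abs_of_pos h.2]; ring
        · rw [if_neg]
          · have hs' : 0 < l W1 * l W2 := lt_of_le_of_ne (not_lt.1 hs) (mul_ne_zero n1 n2).symm
            unfold sg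
            rcases mul_pos_iff.1 hs' with h | h
            · rw [if_pos h.1, if_pos h.2]; decide
            · rw [if_neg (by linarith), if_neg (by linarith)]; decide
          · rintro ⟨w, hwK, hwp, hwl⟩
            set a := w j2 / W1 j2 with ha
            have hapos : 0 < a := div_pos (hwp _) p12
            have hv2 : (w - a • W1) j2 = 0 := by
              simp [ha, p12.ne']
            have hv1 : (w - a • W1) j1 = w j1 := by simp [h1.2.1]
            have e := prop_of_zero hK (K.sub_mem hwK (K.smul_mem a h1.1)) h2.1 hj hv2 h2.2.1
            have e2 := congrArg l e
            simp only [map_smul, map_sub, smul_eq_mul, hv1, hwl] at e2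
            have := hwp j1
            apply hs
            have h5 : W2 j1 * a * (l W1 * l W1) + w j1 * (l W1 * l W2) = 0 := by
              linear_combination (-l W1) * e2
            have h6 : 0 < W2 j1 * a * (l W1 * l W1) := by
              have := mul_self_pos.2 n1
              positivity
            by_contra h7
            have : 0 ≤ w j1 * (l W1 * l W2) := mul_nonneg (hwp j1).le (not_lt.1 h7)
            linarith
      rw [hE]
      generalize sg (l W1) = a; generalize sg (l W2) = b
      generalize s j1 = a'; generalize s j2 = b'
      revert a b a' b'; decide
  · have hno : ∀ j, ¬ ∃ w, Pz K j w := fun j ⟨w, hw⟩ => hpos (Pz_pos hK hd hw)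
    refine ⟨Finset.sum_eq_zero fun j _ => if_neg (hno j), ?_⟩
    rw [if_neg (fun ⟨w, h1, h2, _⟩ => hpos ⟨w, h1, h2⟩), Finset.sum_eq_zero, Finset.sum_eq_zero]
    · simp
    · intro j _; exact if_neg (hno j)
    · intro j _; exact if_neg (fun ⟨w, h1, h2⟩ => hno j ⟨w, h1⟩)
end lin

variable {α L : Type*}

open scoped Classical in
/-- the convex cochain -/
def E (F : L → α → ℝ) (R : List L) (v : ℕ → α) : F2 :=
  if ∃ w : ℕ → ℝ, (∀ j, j ≤ R.length → 0 < w j) ∧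
    ∀ l ∈ R, ∑ j ∈ range (R.length + 1), w j * F l (v j) = 0 then 1 else 0

open scoped Classical in
def om (F : L → α → ℝ) (R : List L) (a : L) (v : ℕ → α) : F2 :=
  if ∃ w : ℕ → ℝ, (∀ j, j ≤ R.length → 0 < w j) ∧
    (∀ l ∈ R, ∑ j ∈ range (R.length + 1), w j * F l (v j) = 0) ∧
    sg (∑ j ∈ range (R.length + 1), w j * F a (v j)) ≠ sg (F a (v 0)) then 1 else 0

/-- genericity -/
def Gen (F : L → α → ℝ) (R : List L) (n : ℕ) (v : ℕ → α) : Prop :=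
  ∀ w : ℕ → ℝ, ((range (n+1)).filter (fun j => w j ≠ 0)).card ≤ R.length →
    (∀ l ∈ R, ∑ j ∈ range (n+1), w j * F l (v j) = 0) → ∀ j, j ≤ n → w j = 0

/-- relation space -/
def Ks (F : L → α → ℝ) (R : List L) (m : ℕ) (v : ℕ → α) : Submodule ℝ (Fin m → ℝ) where
  carrier := {w | ∀ l ∈ R, ∑ j, w j * F l (v j) = 0}
  add_mem' := by
    intro a b ha hb l hl
    simp only [Pi.add_apply, add_mul, Finset.sum_add_distrib, ha l hl, hb l hl, add_zero]
  zero_mem' := by intro l hl; simp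
  smul_mem' := by
    intro c a ha l hl
    simp only [Pi.smul_apply, smul_eq_mul, mul_assoc, ← Finset.mul_sum, ha l hl, mul_zero]

lemma face_succAbove (v : ℕ → α) {N : ℕ} (j : Fin (N+2)) (i : Fin (N+1)) :
    face j v i = v (j.succAbove i) := by
  unfold face Fin.succAbove
  simp only [Fin.lt_def, Fin.val_castSucc]
  split_ifs <;> simp

lemma sum_face (f : α → ℝ) (v : ℕ → α) {N : ℕ} (j : Fin (N+2)) (w : Fin (N+2) → ℝ) (hw : w j = 0) :
    ∑ i : Fin (N+1), w (j.succAbove i) * f (face j v i) = ∑ i, w i * f (v i) := by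
  rw [Fin.sum_univ_succAbove _ j, hw, zero_mul, zero_add]
  refine Finset.sum_congr rfl fun i _ => ?_
  rw [face_succAbove]

lemma exists_face (F : L → α → ℝ) (R : List L) (v : ℕ → α) (j : Fin (R.length + 2))
    (Q : (L → ℝ) → Prop) :
    (∃ w : ℕ → ℝ, (∀ j, j ≤ R.length → 0 < w j) ∧
      (∀ l ∈ R, ∑ i ∈ range (R.length + 1), w i * F l (face j v i) = 0) ∧
      Q (fun l => ∑ i ∈ range (R.length + 1), w i * F l (face j v i))) ↔
    ∃ w, Pz (Ks F R (R.length + 2) v) j w ∧ Q (fun l => ∑ i, w i * F l (v i)) := by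
  constructor
  · rintro ⟨w, h1, h2, h3⟩
    have hj : Fin.insertNth (α := fun _ => ℝ) j 0 (fun i : Fin (R.length+1) => w i) j = 0 := by simp
    have hs : ∀ l, ∑ i, Fin.insertNth (α := fun _ => ℝ) j 0 (fun i : Fin (R.length+1) => w i) i * F l (v i) =
        ∑ i ∈ range (R.length + 1), w i * F l (face j v i) := by
      intro l
      rw [← sum_face (F l) v j _ hj, Finset.sum_range]
      refine Finset.sum_congr rfl fun i _ => ?_
      rw [Fin.insertNth_apply_succAbove]
    refine ⟨Fin.insertNth (α := fun _ => ℝ) j 0 (fun i : Fin (R.length+1) => w i), ⟨?_, hj, ?_⟩, ?_⟩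
    · intro l hl
      rw [hs]; exact h2 l hl
    · intro i hi
      obtain ⟨i', rfl⟩ := Fin.exists_succAbove_eq hi
      rw [Fin.insertNth_apply_succAbove]
      exact h1 _ (by omega)
    · simp only [hs]; exact h3
  · rintro ⟨w, ⟨h1, h2, h3⟩, h4⟩
    have hs : ∀ l, ∑ i ∈ range (R.length + 1), (if h : i < R.length + 1 then w (j.succAbove ⟨i, h⟩) else 0) * F l (face j v i) =
        ∑ i, w i * F l (v i) := by
      intro l
      rw [← sum_face (F l) v j _ h2, Finset.sum_range]
      refine Finset.sum_congr rfl fun i _ => ?_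
      rw [dif_pos i.2]
    refine ⟨fun i => if h : i < R.length + 1 then w (j.succAbove ⟨i, h⟩) else 0, ?_, ?_, ?_⟩
    · intro i hi
      show 0 < dite _ _ _
      rw [dif_pos (by omega)]
      exact h3 _ (Fin.succAbove_ne _ _)
    · intro l hl
      rw [hs]; exact h1 l hl
    · simp only [hs]; exact h4

lemma Gen_fin {F : L → α → ℝ} {R : List L} {N : ℕ} {v : ℕ → α} (hG : Gen F R N v)
    (w : Fin (N+1) → ℝ) (hw : w ∈ Ks F R (N+1) v) (T : Finset (Fin (N+1)))
    (hT : ∀ i ∈ T, w i = 0) (hc : N + 1 ≤ R.length + T.card) : w = 0 := by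
  classical
  set w' : ℕ → ℝ := fun i => if h : i < N + 1 then w ⟨i, h⟩ else 0 with hw'
  have hwi : ∀ i : Fin (N+1), w' i = w i := fun i => dif_pos i.2
  have := hG w' ?_ ?_
  · funext i
    rw [← hwi]; exact this i (by omega)
  · have hsub : ((range (N+1)).filter (fun j => w' j ≠ 0)) ⊆ (Tᶜ).map Fin.valEmbedding := by
      intro i hi
      rw [Finset.mem_filter, Finset.mem_range] at hi
      rw [Finset.mem_map]
      refine ⟨⟨i, hi.1⟩, ?_, rfl⟩
      rw [Finset.mem_compl]
      intro h
      apply hi.2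
      rw [← hT _ h, ← hwi]
    have := Finset.card_le_card hsub
    rw [Finset.card_map, Finset.card_compl, Fintype.card_fin] at this
    omega
  · intro l hl
    rw [Finset.sum_range, ← hw l hl]
    exact Finset.sum_congr rfl fun i _ => by rw [hwi]

lemma Ks_dim (F : L → α → ℝ) (R : List L) (v : ℕ → α) (i : Fin (R.length + 2)) :
    ∃ u ∈ Ks F R (R.length + 2) v, u i = 0 ∧ u ≠ 0 := by
  classical
  let T : (Fin (R.length + 2) → ℝ) →ₗ[ℝ] (Option (Fin R.length) → ℝ) :=
    LinearMap.pi fun o => match o with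
      | none => LinearMap.proj i
      | some k => ∑ j : Fin (R.length + 2), (F (R.get k) (v j)) • LinearMap.proj j
  have hlt : Module.finrank ℝ (Option (Fin R.length) → ℝ) <
      Module.finrank ℝ (Fin (R.length + 2) → ℝ) := by
    rw [Module.finrank_fintype_fun_eq_card, Module.finrank_fintype_fun_eq_card]
    simp
  have hk := LinearMap.ker_ne_bot_of_finrank_lt (f := T) hlt
  obtain ⟨u, hu, hu0⟩ := (Submodule.ne_bot_iff _).1 hk
  rw [LinearMap.mem_ker] at hu
  refine ⟨u, ?_, ?_, hu0⟩
  · intro l hl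
    obtain ⟨k, rfl⟩ := List.get_of_mem hl
    have := congrFun hu (some k)
    simp [T] at this
    rw [← this]
    exact Finset.sum_congr rfl fun j _ => by simp [mul_comm]
  · have := congrFun hu none
    simpa [T] using this

theorem peel_cocycle (F : L → α → ℝ) (R : List L) (a : L) (v : ℕ → α)
    (h1 : Gen F R (R.length + 1) v) (h2 : Gen F (a :: R) (R.length + 1) v) :
    (∑ j ∈ range (R.length + 2), E F R (face j v) = 0) ∧
    E F (a :: R) v = (sg (F a (v 0)) + sg (F a (v 1))) * E F R (sh v) +
      ∑ j ∈ range (R.length + 2), om F R a (face j v) := by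
  classical
  have hK : ∀ w ∈ Ks F R (R.length + 2) v, ∀ i j, i ≠ j → w i = 0 → w j = 0 → w = 0 := by
    intro w hw i j hij hi hj
    refine Gen_fin h1 w hw {i, j} ?_ ?_
    · intro k hk; simp at hk; rcases hk with rfl | rfl <;> assumption
    · rw [Finset.card_pair hij]
  let l : (Fin (R.length + 2) → ℝ) →ₗ[ℝ] ℝ := ∑ j : Fin (R.length + 2), (F a (v j)) • LinearMap.proj j
  have hlv : ∀ w, l w = ∑ j, w j * F a (v j) := by
    intro w; simp [l, mul_comm]
  have hl : ∀ w ∈ Ks F R (R.length + 2) v, ∀ j, w j = 0 → l w = 0 → w = 0 := by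
    intro w hw j hj h0
    refine Gen_fin h2 w ?_ {j} ?_ ?_
    · intro b hb
      rcases List.mem_cons.1 hb with rfl | hb
      · rw [← hlv, h0]
      · exact hw b hb
    · intro k hk; simp at hk; rw [hk, hj]
    · simp
  obtain ⟨m1, m2⟩ := lin_main hK (Ks_dim F R v) l hl (fun j => sg (F a (face j v 0)))
  have hE : ∀ j : Fin (R.length + 2), E F R (face j v) =
      if ∃ w, Pz (Ks F R (R.length + 2) v) j w then 1 else 0 := by
    intro j
    unfold E
    congr 1
    have := exists_face F R v j (fun _ => True)
    simpa using this
  have hom : ∀ j : Fin (R.length + 2), om F R a (face j v) =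
      if ∃ w, Pz (Ks F R (R.length + 2) v) j w ∧ sg (l w) ≠ sg (F a (face j v 0)) then 1 else 0 := by
    intro j
    unfold om
    congr 1
    have := exists_face F R v j (fun f => sg (f a) ≠ sg (F a (face j v 0)))
    simp only [hlv]
    rw [eq_iff_iff]; exact this
  have hEa : E F (a :: R) v =
      if ∃ w ∈ Ks F R (R.length + 2) v, (∀ i, 0 < w i) ∧ l w = 0 then 1 else 0 := by
    unfold E
    congr 1
    rw [eq_iff_iff]
    constructor
    · rintro ⟨w, e1, e2⟩
      rw [List.length_cons] at e1 e2
      refine ⟨fun i => w i, ?_, fun i => e1 _ (by omega), ?_⟩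
      · intro b hb
        have := e2 b (List.mem_cons_of_mem _ hb)
        rw [Finset.sum_range] at this
        exact this
      · have := e2 a List.mem_cons_self
        rw [Finset.sum_range] at this
        rw [hlv]
        exact this
    · rintro ⟨w, e1, e2, e3⟩
      have hs : ∀ b, ∑ j ∈ range (R.length + 1 + 1), (if h : j < R.length + 2 then w ⟨j, h⟩ else 0) *
          F b (v j) = ∑ j, w j * F b (v j) := by
        intro b
        rw [Finset.sum_range]
        exact Finset.sum_congr rfl fun j _ => by rw [dif_pos j.2]
      refine ⟨fun i => if h : i < R.length + 2 then w ⟨i, h⟩ else 0, ?_, ?_⟩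
      · intro j hj
        rw [List.length_cons] at hj
        show 0 < dite _ _ _
        rw [dif_pos (by omega)]; exact e2 _
      · intro b hb
        rw [List.length_cons, hs]
        rcases List.mem_cons.1 hb with rfl | hb
        · rw [← hlv, e3]
        · exact e1 b hb
  constructor
  · rw [Finset.sum_range, ← m1]
    exact Finset.sum_congr rfl fun j _ => hE j
  · rw [← hEa] at m2
    rw [Finset.sum_range, Finset.sum_congr rfl (fun j _ => hom j)]
    have hR : ∑ j : Fin (R.length + 2), (if ∃ w, Pz (Ks F R (R.length + 2) v) j w then
        sg (F a (face j v 0)) else 0) = (sg (F a (v 0)) + sg (F a (v 1))) * E F R (sh v) := by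
      have : ∀ j : Fin (R.length + 2), (if ∃ w, Pz (Ks F R (R.length + 2) v) j w then
        sg (F a (face j v 0)) else 0) = sg (F a (face j v 0)) * E F R (face j v) := by
        intro j; rw [hE]; split_ifs <;> simp
      rw [Finset.sum_congr rfl (fun j _ => this j)]
      rw [Finset.sum_congr rfl (fun j _ => hE j |>.symm)] at m1
      rw [Fin.sum_univ_succ] at m1 ⊢
      simp only [Fin.val_zero, Fin.val_succ, face_head, face_zero] at m1 ⊢
      rw [← Finset.mul_sum]
      have e1 : sh v 0 = v 1 := rfl
      rw [e1]
      revert m1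
      generalize E F R (sh v) = p
      generalize ∑ i : Fin (R.length + 1), E F R (face (↑i + 1) v) = q
      generalize sg (F a (v 0)) = x; generalize sg (F a (v 1)) = y
      revert p q x y; decide
    rw [hR] at m2
    rw [← m2, add_assoc, F2.two, add_zero]

end EQ


namespace EQ
open Finset

variable {α L : Type*}

lemma E_mono {F : L → α → ℝ} {R : List L} {v v' : ℕ → α}
    (h : ∀ l ∈ R, ∃ l' ∈ R, ∃ c : ℝ, ∀ j, j ≤ R.length → F l (v' j) = c * F l' (v j))
    (hE : E F R v ≠ 0) : E F R v' = 1 := by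
  unfold E at *
  rw [if_pos]
  simp only [ne_eq, ite_eq_right_iff, one_ne_zero, imp_false, not_not] at hE
  obtain ⟨w, h1, h2⟩ := hE
  refine ⟨w, h1, fun l hl => ?_⟩
  obtain ⟨l', hl', c, hc⟩ := h l hl
  have := h2 l' hl'
  calc _ = ∑ j ∈ range (R.length + 1), c * (w j * F l' (v j)) := by
        refine Finset.sum_congr rfl fun j hj => ?_
        rw [Finset.mem_range] at hj
        rw [hc j (by omega)]; ring
    _ = 0 := by rw [← Finset.mul_sum, this, mul_zero]

lemma F2.cases {a b : F2} (h1 : a ≠ 0 → b = 1) (h2 : b ≠ 0 → a = 1) : a = b := by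
  revert a b; decide

lemma E_congr {F : L → α → ℝ} {R : List L} {v v' : ℕ → α}
    (h : ∀ l ∈ R, ∃ l' ∈ R, ∃ c : ℝ, ∀ j, j ≤ R.length → F l (v' j) = c * F l' (v j))
    (h' : ∀ l ∈ R, ∃ l' ∈ R, ∃ c : ℝ, ∀ j, j ≤ R.length → F l (v j) = c * F l' (v' j)) :
    E F R v' = E F R v := F2.cases (E_mono h') (E_mono h)

lemma sg_scale {c x : ℝ} (hc : c = 1 ∨ c = -1) (hx : x ≠ 0) :
    sg (c * x) = sg x + (if c = 1 then 0 else 1) := by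
  rcases hc with rfl | rfl
  · simp
  · rw [if_neg (by norm_num)]
    unfold sg
    rcases lt_or_gt_of_ne hx with h | h
    · rw [if_pos (by linarith), if_neg (by linarith)]; decide
    · rw [if_neg (by linarith), if_pos (by linarith)]; decide

lemma om_mono {F : L → α → ℝ} {R : List L} {a : L} {v v' : ℕ → α}
    (hG : Gen F (a :: R) R.length v) (h0 : F a (v 0) ≠ 0)
    (h : ∀ l ∈ R, ∃ l' ∈ R, ∃ c : ℝ, ∀ j, j ≤ R.length → F l (v' j) = c * F l' (v j))
    (ha : ∃ c : ℝ, (c = 1 ∨ c = -1) ∧ ∀ j, j ≤ R.length → F a (v' j) = c * F a (v j))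
    (hE : om F R a v ≠ 0) : om F R a v' = 1 := by
  unfold om at *
  rw [if_pos]
  simp only [ne_eq, ite_eq_right_iff, one_ne_zero, imp_false, not_not] at hE
  obtain ⟨w, h1, h2, h3⟩ := hE
  refine ⟨w, h1, fun l hl => ?_, ?_⟩
  · obtain ⟨l', hl', c, hc⟩ := h l hl
    have := h2 l' hl'
    calc _ = ∑ j ∈ range (R.length + 1), c * (w j * F l' (v j)) := by
          refine Finset.sum_congr rfl fun j hj => ?_
          rw [Finset.mem_range] at hj
          rw [hc j (by omega)]; ring
      _ = 0 := by rw [← Finset.mul_sum, this, mul_zero]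
  · obtain ⟨c, hc1, hc⟩ := ha
    have e1 : ∑ j ∈ range (R.length + 1), w j * F a (v' j) =
        c * ∑ j ∈ range (R.length + 1), w j * F a (v j) := by
      rw [Finset.mul_sum]
      refine Finset.sum_congr rfl fun j hj => ?_
      rw [Finset.mem_range] at hj
      rw [hc j (by omega)]; ring
    rw [e1, hc 0 (Nat.zero_le _), sg_scale hc1 h0, sg_scale hc1]
    · intro h4; exact h3 (add_right_cancel h4)
    · intro h5
      have := hG w ?_ ?_ 0 (Nat.zero_le _)
      · have := h1 0 (Nat.zero_le _)
        linarith
      · refine (Finset.card_filter_le _ _).trans ?_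
        simp
      · intro l hl
        rcases List.mem_cons.1 hl with rfl | hl
        · exact h5
        · exact h2 l hl

abbrev Lab := Finset (Fin 4) × ℕ

variable {d : ℕ}

/-- standing hypotheses on a system of functions -/
structure Sys (M : ℤ) (F : Lab → V d → ℝ) (R : List Lab) : Prop where
  odd : ∀ l v k, F l (ng k v) = (if k ∈ l.1 then (-1) else 1) * F l v
  nz : ∀ v, S M v → ∀ l ∈ R, F l v ≠ 0
  gen : ∀ R', R' <:+ R → ∀ n v, (∀ j, j ≤ n → S M (v j)) →
    (∀ i j, i < j → j ≤ n → dim (v i) < dim (v j)) → Gen F R' n v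

lemma Sys.suffix {M : ℤ} {F : Lab → V d → ℝ} {R R' : List Lab} (h : Sys M F R) (hs : R' <:+ R) :
    Sys M F R' :=
  ⟨h.odd, fun v hv l hl => h.nz v hv l (hs.subset hl), fun R'' h'' => h.gen R'' (h''.trans hs)⟩

lemma Sys.tail {M : ℤ} {F : Lab → V d → ℝ} {R : List Lab} {a : Lab} (h : Sys M F (a :: R)) :
    Sys M F R := h.suffix (List.suffix_cons _ _)

lemma E_ng {F : Lab → V d → ℝ} (hodd : ∀ l v k, F l (ng k v) = (if k ∈ l.1 then (-1) else 1) * F l v)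
    (R : List Lab) (k : Fin 4) (v : ℕ → V d) : E F R (ng k ∘ v) = E F R v := by
  refine E_congr (fun l hl => ⟨l, hl, _, fun j _ => hodd l (v j) k⟩) (fun l hl => ⟨l, hl, (if k ∈ l.1 then (-1) else 1), fun j _ => ?_⟩)
  simp only [Function.comp, hodd]
  split_ifs <;> ring

lemma om_ng {M : ℤ} {F : Lab → V d → ℝ} {R : List Lab} {a : Lab} (hS : Sys M F (a :: R))
    (k : Fin 4) (v : ℕ → V d) (hv : S M (v 0)) (hv' : S M (ng k (v 0)))
    (hg : Gen F (a :: R) R.length v) (hg' : Gen F (a :: R) R.length (ng k ∘ v)) :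
    om F R a (ng k ∘ v) = om F R a v := by
  have h1 : ∀ l ∈ R, ∃ l' ∈ R, ∃ c : ℝ, ∀ j, j ≤ R.length → F l ((ng k ∘ v) j) = c * F l' (v j) :=
    fun l hl => ⟨l, hl, _, fun j _ => hS.odd l (v j) k⟩
  have h2 : ∀ l ∈ R, ∃ l' ∈ R, ∃ c : ℝ, ∀ j, j ≤ R.length → F l (v j) = c * F l' ((ng k ∘ v) j) := by
    refine fun l hl => ⟨l, hl, (if k ∈ l.1 then (-1) else 1), fun j _ => ?_⟩
    simp only [Function.comp, hS.odd]
    split_ifs <;> ring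
  apply F2.cases
  · refine om_mono hg' (hS.nz _ hv' a List.mem_cons_self) h2 ⟨(if k ∈ a.1 then (-1) else 1), ?_, ?_⟩
    · split_ifs <;> simp
    · intro j _
      simp only [Function.comp, hS.odd]
      split_ifs <;> ring
  · refine om_mono hg (hS.nz _ hv a List.mem_cons_self) h1 ⟨(if k ∈ a.1 then (-1) else 1), ?_, ?_⟩
    · split_ifs <;> simp
    · intro j _
      simp only [Function.comp, hS.odd]

/-- genericity along chains -/
lemma Sys.genX {M : ℤ} (hM : Adm M) {F : Lab → V d → ℝ} {R R' : List Lab} (h : Sys M F R)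
    (hs : R' <:+ R) {D : Fin 4 → ℕ} {n : ℕ} {v : ℕ → V d} (hv : v ∈ X M D n) : Gen F R' n v := by
  refine h.gen R' hs n v (fun j hj => X_S hM hv hj) fun i j hij hj => ?_
  rw [mem_X hM] at hv
  rw [hv.dim hj, hv.dim (by omega)]; exact hij

/-- genericity along a reindexed chain -/
lemma Sys.genX' {M : ℤ} (hM : Adm M) {F : Lab → V d → ℝ} {R R' : List Lab} (h : Sys M F R)
    (hs : R' <:+ R) {D : Fin 4 → ℕ} {n : ℕ} {v : ℕ → V d} (hv : v ∈ X M D n) {m : ℕ} {f : ℕ → ℕ}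
    (hf : StrictMono f) (hfm : f m ≤ n) : Gen F R' m (fun i => v (f i)) := by
  refine h.gen R' hs m _ (fun j hj => X_S hM hv ?_) fun i j hij hj => ?_
  · exact (hf.monotone hj).trans hfm
  · rw [mem_X hM] at hv
    have := hf.monotone hj
    have := hf hij
    rw [hv.dim (by omega), hv.dim (by omega)]; exact this

lemma strictMono_succ : StrictMono (fun i : ℕ => i + 1) := fun a b h => by
  show a + 1 < b + 1
  omega

def Cf : List Lab → (Fin 4 → ℕ) → F2
  | [], D => if D = 0 then 1 else 0
  | a :: R, D => ∑ i ∈ a.1, if 0 < D i then Cf R (low D i) else 0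

lemma low_lt {D : Fin 4 → ℕ} {n : ℕ} (hD : ∀ i, D i < n) (k i : Fin 4) : low D k i < n := by
  unfold low
  by_cases h : i = k
  · subst h; simp; have := hD i; omega
  · simp [h, hD]

lemma Itg_base {M : ℤ} (hM : Adm M) {D : Fin 4 → ℕ} (hD : ∀ i, D i < d + 1)
    (φ : (ℕ → V d) → F2) (hφ : ∀ v, φ v = 1) : Itg M D 0 φ = if D = 0 then 1 else 0 := by
  classical
  unfold Itg
  simp only [hφ, mul_one]
  split_ifs with h
  · subst h
    set e : ℕ → V d := fun j => if j = 0 then (fun c => if c.2 = 0 then M else 0) else 0 with he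
    have hM2 := hM.2
    rw [Finset.sum_eq_single e]
    · unfold G
      refine Finset.prod_eq_one fun k _ => ?_
      have h00 : ∀ r, e 0 (k, r) = if r = 0 then M else 0 := fun r => rfl
      rw [g_eq (r := 0)]
      · rw [h00, if_pos rfl, if_pos hM2]
      · intro r hr
        have h5 : r ≠ 0 := hr.ne'
        rw [h00, if_neg h5]
      · rw [h00, if_pos rfl]; omega
    · intro v hv hne
      rw [mem_X hM] at hv
      by_contra hG
      apply hne
      funext j
      by_cases hj : j = 0
      · subst hj
        funext ⟨k, r⟩
        obtain ⟨r0, h1, h2, h3, h4⟩ := hv.tp k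
        have hr0 : r0 = 0 := by apply Fin.ext; simpa using h1
        subst hr0
        have hg : g k (v 0) ≠ 0 := by
          intro hg; apply hG; unfold G; exact Finset.prod_eq_zero (mem_univ k) hg
        have hne0 : v 0 (k, 0) ≠ 0 := by omega
        rw [g_eq (r := 0) (fun r hr => h4 r hr) hne0] at hg
        have hpos : 0 < v 0 (k, 0) := by
          by_contra h5; exact hg (if_neg h5)
        by_cases hr : r = 0
        · subst hr; simp [he]; omega
        · have := h4 r (by simpa [Nat.pos_iff_ne_zero] using hr)
          simp [he, hr, this]
      · rw [hv.zr j (by omega)]; simp [he, hj]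
    · intro hn
      exfalso
      apply hn
      rw [mem_X hM]
      refine ⟨?_, by omega, ?_, ?_⟩
      · intro c; simp only [he, if_true]; split_ifs
        · exact hM.1
        · exact Even.zero
      · intro k
        refine ⟨0, by simp, by simp [he], ?_, ?_⟩
        · intro r hr hr'
          exact absurd (Fin.ext (by simpa using hr')) hr
        · intro r hr
          have : r ≠ 0 := by rintro rfl; simp at hr
          simp [he, this]
      · intro j hj; simp [he, show j ≠ 0 by omega]
  · refine Finset.sum_eq_zero fun v hv => ?_
    rw [mem_X hM] at hv
    exfalso
    apply h
    funext k
    by_contra hk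
    simp at hk
    obtain ⟨r0, hB⟩ := hv.tp k
    by_cases hr : (r0 : ℕ) = 0
    · have := hB.even_iff hM.1 (r := ⟨D k, hD k⟩) (hv.ev _) le_rfl
      apply hk
      rw [← hr, ← this]
    · have := hB.even_iff hM.1 (r := 0) (hv.ev _) (by simp)
      exact hr (by rw [← this]; rfl)

lemma E_nil (F : L → α → ℝ) (v : ℕ → α) : E F [] v = 1 := by
  unfold E
  rw [if_pos]
  exact ⟨fun _ => 1, by simp, by simp⟩

/-- peel in terms of dl -/
lemma Sys.peel {M : ℤ} (hM : Adm M) {F : Lab → V d → ℝ} {R : List Lab} {a : Lab}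
    (h : Sys M F (a :: R)) {D : Fin 4 → ℕ} {n : ℕ} {v : ℕ → V d} (hv : v ∈ X M D n) {f : ℕ → ℕ}
    (hf : StrictMono f) (hfm : f (R.length + 1) ≤ n) :
    E F (a :: R) (fun i => v (f i)) = cup (fun x => sg (F a x)) (E F R) (fun i => v (f i)) +
      dl (R.length + 1) (om F R a) (fun i => v (f i)) :=
  (peel_cocycle F R a _ (h.genX' hM (List.suffix_cons _ _) hv hf hfm)
    (h.genX' hM List.suffix_rfl hv hf hfm)).2

lemma Sys.cocycle {M : ℤ} (hM : Adm M) {F : Lab → V d → ℝ} {R : List Lab} {a : Lab}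
    (h : Sys M F (a :: R)) {D : Fin 4 → ℕ} {n : ℕ} {v : ℕ → V d} (hv : v ∈ X M D n) {f : ℕ → ℕ}
    (hf : StrictMono f) (hfm : f (R.length + 1) ≤ n) :
    dl (R.length + 1) (E F R) (fun i => v (f i)) = 0 :=
  (peel_cocycle F R a _ (h.genX' hM (List.suffix_cons _ _) hv hf hfm)
    (h.genX' hM List.suffix_rfl hv hf hfm)).1

lemma Sys.om_sh {M : ℤ} (hM : Adm M) {F : Lab → V d → ℝ} {R : List Lab} {a : Lab}
    (h : Sys M F (a :: R)) {D : Fin 4 → ℕ} {n : ℕ} {v : ℕ → V d} (hv : v ∈ X M D n) {f : ℕ → ℕ}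
    (hf : StrictMono f) (hfm : f R.length ≤ n) (k : Fin 4) :
    om F R a (ng k ∘ fun i => v (f i)) = om F R a (fun i => v (f i)) := by
  have hf0 : f 0 ≤ n := (hf.monotone (Nat.zero_le _)).trans hfm
  have hv' := (ng_sym M D k).mem hM hv
  exact om_ng h k _ (X_S hM hv hf0) (X_S hM hv' hf0) (h.genX' hM List.suffix_rfl hv hf hfm)
    (h.genX' hM List.suffix_rfl hv' hf hfm)

lemma sg_ng {M : ℤ} {F : Lab → V d → ℝ} {R : List Lab} {a : Lab}
    (h : Sys M F (a :: R)) (v : V d) (hv : S M v) (k : Fin 4) :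
    sg (F a (ng k v)) = sg (F a v) + if k ∈ a.1 then 1 else 0 := by
  rw [h.odd, sg_scale (by split_ifs <;> simp) (h.nz v hv a List.mem_cons_self)]
  by_cases hk : k ∈ a.1
  · simp [hk]; norm_num
  · simp [hk]

theorem Itg_E {M : ℤ} (hM : Adm M) {F : Lab → V d → ℝ} : ∀ (R : List Lab) (D : Fin 4 → ℕ),
    (∀ i, D i < d + 1) → Sys M F R → Itg M D R.length (E F R) = Cf R D := by
  intro R
  induction R with
  | nil => intro D hD h; exact Itg_base hM hD _ (E_nil F)
  | cons a R ih =>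
    intro D hD h
    have hp : ∀ v ∈ X M D (R.length+1), E F (a::R) v =
        cup (fun x => sg (F a x)) (E F R) v + dl (R.length+1) (om F R a) v :=
      fun v hv => h.peel hM hv (f := id) strictMono_id le_rfl
    rw [List.length_cons, Itg_congr hp, Itg_add]
    have h2 : Itg M D (R.length + 1) (dl (R.length + 1) (om F R a)) = 0 :=
      stokes hM (by omega) _ fun k v hv => h.om_sh hM hv (f := fun i => i + 1) strictMono_succ le_rfl k
    rw [h2, add_zero]
    have h3 := front hM (n := R.length) hD (E F R) (fun k v hv => E_ng h.odd R k (sh v))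
      (fun v hv => h.cocycle hM hv (f := id) strictMono_id le_rfl) (fun x => sg (F a x)) a.1
      (fun v hv k => sg_ng h v hv k)
    refine h3.trans ?_
    rw [Cf]
    refine Finset.sum_congr rfl fun i _ => ?_
    split_ifs
    · exact ih _ (low_lt hD i) h.tail
    · rfl

end EQ


namespace EQ
open Finset

variable {d : ℕ}

/-- normalized block -/
def nb (k : Fin 4) (v : V d) : Fin (d+1) → ℤ := fun r => if g k v = 1 then v (k, r) else - v (k, r)

lemma F2.ne_one {x : F2} : x ≠ 1 ↔ x = 0 := by revert x; decide

lemma nb_ng (k k' : Fin 4) (v : V d) : nb k (ng k' v) = nb k v := by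
  by_cases h : k = k'
  · subst h
    by_cases h0 : ∃ r, v (k, r) ≠ 0
    · funext r
      simp only [nb, g_ng_same h0, ng, if_true]
      generalize g k v = x
      have : ∀ x : F2, x = 0 ∨ x = 1 := by decide
      rcases this x with rfl | rfl
      · simp
      · rw [if_neg (by decide), if_pos rfl]; simp
    · push Not at h0
      funext r
      simp [nb, ng, h0]
  · funext r
    simp [nb, g_ng_ne h, ng, h]

lemma nb_pm (k : Fin 4) (σ) (v : V d) : nb k (pm σ v) = nb (σ k) v := by
  funext r; simp only [nb, g_pm]; rfl

def rh (k : Fin 4) (v : V d) : Lex (Fin (d+1) → ℤ) := toLex (nb k v)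

def Good (v : V d) : Prop := Function.Injective fun k => nb k v

lemma Good.rh {v : V d} (hv : Good v) {i j : Fin 4} (h : i ≠ j) : rh i v ≠ rh j v := fun h' => h (hv h')

lemma rh_ng (k k' : Fin 4) (v : V d) : rh k (ng k' v) = rh k v := by unfold rh; rw [nb_ng]
lemma rh_pm (k : Fin 4) (σ) (v : V d) : rh k (pm σ v) = rh (σ k) v := by unfold rh; rw [nb_pm]

lemma Good.pm {v : V d} {σ : Equiv.Perm (Fin 4)} : Good (pm σ v) ↔ Good v := by
  unfold Good
  simp only [nb_pm]
  constructor
  · intro h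
    have : (fun k => nb k v) = (fun k => nb (σ k) v) ∘ σ.symm := by funext k; simp
    rw [this]; exact h.comp σ.symm.injective
  · intro h; exact h.comp σ.injective

def ltF {α : Type*} [LinearOrder α] (x y : α) : F2 := if x < y then 1 else 0

def wa (v : V d) : F2 := ltF (rh 0 v) (rh 1 v)
def wb (v : V d) : F2 := ltF (rh 2 v) (rh 3 v)
def wh (v : V d) : F2 := ltF (min (rh 0 v) (rh 1 v)) (min (rh 2 v) (rh 3 v))

def s01 : Equiv.Perm (Fin 4) := Equiv.swap 0 1
def s23 : Equiv.Perm (Fin 4) := Equiv.swap 2 3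
def tau : Equiv.Perm (Fin 4) := Equiv.swap 0 2 * Equiv.swap 1 3

lemma wa_ng (k) (v : V d) : wa (ng k v) = wa v := by unfold wa; simp only [rh_ng]
lemma wb_ng (k) (v : V d) : wb (ng k v) = wb v := by unfold wb; simp only [rh_ng]
lemma wh_ng (k) (v : V d) : wh (ng k v) = wh v := by unfold wh; simp only [rh_ng]

lemma flip_lt {α : Type*} [LinearOrder α] {x y : α} (h : x ≠ y) :
    ltF y x = ltF x y + 1 := by
  unfold ltF
  rcases lt_or_gt_of_ne h with h | h
  · rw [if_neg h.not_gt, if_pos h]; decide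
  · rw [if_pos h, if_neg h.not_gt]; decide

lemma s01_0 : s01 0 = 1 := by decide
lemma s01_1 : s01 1 = 0 := by decide
lemma s01_2 : s01 2 = 2 := by decide
lemma s01_3 : s01 3 = 3 := by decide
lemma s23_0 : s23 0 = 0 := by decide
lemma s23_1 : s23 1 = 1 := by decide
lemma s23_2 : s23 2 = 3 := by decide
lemma s23_3 : s23 3 = 2 := by decide
lemma tau_0 : tau 0 = 2 := by decide
lemma tau_1 : tau 1 = 3 := by decide
lemma tau_2 : tau 2 = 0 := by decide
lemma tau_3 : tau 3 = 1 := by decide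

lemma wa_s01 {v : V d} (hv : Good v) : wa (pm s01 v) = wa v + 1 := by
  unfold wa; simp only [rh_pm, s01_0, s01_1]
  exact flip_lt (hv.rh (show (0 : Fin 4) ≠ 1 by decide))
lemma wb_s23 {v : V d} (hv : Good v) : wb (pm s23 v) = wb v + 1 := by
  unfold wb; simp only [rh_pm, s23_2, s23_3]
  exact flip_lt (hv.rh (show (2 : Fin 4) ≠ 3 by decide))
lemma wb_s01 (v : V d) : wb (pm s01 v) = wb v := by
  unfold wb; simp only [rh_pm, s01_2, s01_3]
lemma wa_s23 (v : V d) : wa (pm s23 v) = wa v := by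
  unfold wa; simp only [rh_pm, s23_0, s23_1]
lemma wh_s01 (v : V d) : wh (pm s01 v) = wh v := by
  unfold wh; simp only [rh_pm, s01_0, s01_1, s01_2, s01_3, min_comm (rh 1 v)]
lemma wh_s23 (v : V d) : wh (pm s23 v) = wh v := by
  unfold wh; simp only [rh_pm, s23_0, s23_1, s23_2, s23_3, min_comm (rh 3 v)]
lemma wa_tau (v : V d) : wa (pm tau v) = wb v := by
  unfold wa wb; simp only [rh_pm, tau_0, tau_1]
lemma wb_tau (v : V d) : wb (pm tau v) = wa v := by
  unfold wa wb; simp only [rh_pm, tau_2, tau_3]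
lemma wh_tau {v : V d} (hv : Good v) : wh (pm tau v) = wh v + 1 := by
  unfold wh; simp only [rh_pm, tau_0, tau_1, tau_2, tau_3]
  have : min (rh 0 v) (rh 1 v) ≠ min (rh 2 v) (rh 3 v) := by
    have h1 := hv.rh (show (0 : Fin 4) ≠ 2 by decide)
    have h2 := hv.rh (show (0 : Fin 4) ≠ 3 by decide)
    have h3 := hv.rh (show (1 : Fin 4) ≠ 2 by decide)
    have h4 := hv.rh (show (1 : Fin 4) ≠ 3 by decide)
    rcases min_choice (rh 0 v) (rh 1 v) with e | e <;> rcases min_choice (rh 2 v) (rh 3 v) with e' | e' <;>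
      rw [e, e'] <;> assumption
  exact flip_lt this

lemma G_pm (σ) (v : V d) : G (pm σ v) = G v := by
  unfold G; simp only [g_pm]
  exact Equiv.prod_comp σ (fun k => g k v)

/-- cochain products with explicit front functions -/
def T1 (ω : V d → V d → F2) (φ : (ℕ → V d) → F2) (v : ℕ → V d) : F2 := ω (v 0) (v 1) * φ (sh v)
def T2 (ω : V d → V d → V d → F2) (φ : (ℕ → V d) → F2) (v : ℕ → V d) : F2 :=
  ω (v 0) (v 1) (v 2) * φ (sh (sh v))

lemma cup_T1 (s : V d → F2) (φ) : cup s φ = T1 (fun x y => s x + s y) φ := rfl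

lemma face_h1 {α : Type*} (j : ℕ) (v : ℕ → α) : face (j+2) v 1 = v 1 := by simp [face]
lemma face_h2 {α : Type*} (j : ℕ) (v : ℕ → α) : face (j+3) v 2 = v 2 := by simp [face]

lemma dl_T1 (n : ℕ) (ω : V d → V d → F2) (φ) (v : ℕ → V d) :
    dl (n+1) (T1 ω φ) v = (ω (v 1) (v 2) + ω (v 0) (v 2) + ω (v 0) (v 1)) * φ (sh (sh v)) +
      ω (v 0) (v 1) * dl n φ (sh v) := by
  simp only [dl, T1]
  rw [Finset.sum_range_succ', Finset.sum_range_succ', Finset.sum_range_succ' (fun j => φ (face j (sh v))),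
    mul_add, Finset.mul_sum]
  simp only [face_head, face_zero, sh_face, face_h1]
  have e1 : face (0+1) v 1 = v 2 := by simp [face]
  have e2 : sh v 0 = v 1 := rfl
  have e3 : sh v 1 = v 2 := rfl
  rw [e1, e2, e3]
  grind

lemma dl_T2 (n : ℕ) (ω : V d → V d → V d → F2) (φ) (v : ℕ → V d) :
    dl (n+2) (T2 ω φ) v = (ω (v 1) (v 2) (v 3) + ω (v 0) (v 2) (v 3) + ω (v 0) (v 1) (v 3) +
      ω (v 0) (v 1) (v 2)) * φ (sh (sh (sh v))) + ω (v 0) (v 1) (v 2) * dl n φ (sh (sh v)) := by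
  simp only [dl, T2]
  rw [Finset.sum_range_succ', Finset.sum_range_succ', Finset.sum_range_succ',
    Finset.sum_range_succ' (fun j => φ (face j (sh (sh v)))), mul_add, Finset.mul_sum]
  simp only [face_head, face_zero, sh_face, face_h1, face_h2]
  have e1 : face (0+1) v 1 = v 2 := by simp [face]
  have e1' : face (0+1) v 2 = v 3 := by simp [face]
  have e1'' : face (0+1+1) v 2 = v 3 := by simp [face]
  have e4 : face (0+1+1) v 1 = v 1 := by simp [face]
  have e2 : sh v 0 = v 1 := rfl
  have e3 : sh v 1 = v 2 := rfl
  have e5 : sh v 2 = v 3 := rfl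
  have e6 : face 0 (sh v) = sh (sh v) := face_zero _
  have e7 : sh (face 0 (sh v)) = sh (sh (sh v)) := by rw [face_zero]
  rw [e1, e1', e2, e3, e5]
  try simp only [e1'', e4, e7]
  grind

def Nf (s s' h : V d → F2) (x y z : V d) : F2 :=
  (s x + s y) * (s' y + s' z) + h y * (s y + s z) * (s' y + s' z) + h x * (s x + s z) * (s' x + s' z)
    + h x * (s x + s y) * (s' x + s' y)

lemma Nf_cocycle (s s' h : V d → F2) (x y z t : V d) :
    Nf s s' h y z t + Nf s s' h x z t + Nf s s' h x y t + Nf s s' h x y z = 0 := by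
  unfold Nf; grind

def om2 (s s' b b' h : V d → F2) (x y : V d) : F2 :=
  b x * (s' x + s' y) + (s x + s y) * b' y + b x * (b' x + b' y) +
  h x * ((s x + s y + (b x + b y)) * (s' x + s' y + (b' x + b' y)) - (s x + s y) * (s' x + s' y)) +
  (h x * b x * b' x + h y * b y * b' y)

lemma Nf_change (s s' b b' h : V d → F2) (x y z : V d) :
    Nf (fun x => s x + b x) (fun x => s' x + b' x) h x y z = Nf s s' h x y z +
      (om2 s s' b b' h y z + om2 s s' b b' h x z + om2 s s' b b' h x y) := by
  unfold Nf om2; grind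
end EQ


namespace EQ
open Finset

variable {d : ℕ}

def L01 : Lab := ({0, 1}, 0)
def L23 : Lab := ({2, 3}, 0)
def L13 : Lab := ({1, 3}, 0)

def lm (σ : Equiv.Perm (Fin 4)) (l : Lab) : Lab := (l.1.map σ.toEmbedding, l.2)

/-- constant sign along a chain -/
def CS (F : Lab → V d → ℝ) (l : Lab) (n : ℕ) (v : ℕ → V d) : Prop :=
  (∀ j, j ≤ n → 0 < F l (v j)) ∨ (∀ j, j ≤ n → F l (v j) < 0)

def cD (d : ℕ) : Fin 4 → ℕ := fun _ => d

def PS (σ : Equiv.Perm (Fin 4)) : Prop := σ = tau ∨ σ = s01 ∨ σ = s23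

structure Setup (M : ℤ) (F : Lab → V d → ℝ) (R : List Lab) : Prop where
  adm : Adm M
  sys : Sys M F (L01 :: L23 :: L13 :: R)
  bad : ∀ v ∈ X M (cD d) (R.length + 3), ∀ i, i ≤ R.length + 3 → ¬ Good (v i) →
    ∃ l ∈ R, CS F l (R.length + 3) v
  max : ∀ v ∈ X M (cD d) (R.length + 3),
    ∃ l ∈ (L01 :: L23 :: L13 :: R), CS F l (R.length + 3) v
  eqv : ∀ σ, PS σ → ∀ l v, S M v → Good v → F l (pm σ v) = F (lm σ l) v
  cl : ∀ σ, PS σ → ∀ l ∈ (L13 :: R), lm σ l ∈ (L13 :: R)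
  clt : ∀ l ∈ R, lm tau l ∈ R

lemma E_CS {F : Lab → V d → ℝ} {R : List Lab} {l : Lab} (hl : l ∈ R) {n : ℕ} {v : ℕ → V d}
    (h : CS F l n v) {f : ℕ → ℕ} (hf : StrictMono f) (hfn : f R.length ≤ n) :
    E F R (fun i => v (f i)) = 0 := by
  unfold E
  rw [if_neg]
  rintro ⟨w, h1, h2⟩
  have h3 := h2 l hl
  have hle : ∀ j ∈ range (R.length + 1), f j ≤ n := by
    intro j hj
    rw [Finset.mem_range] at hj
    exact (hf.monotone (show j ≤ R.length by omega)).trans hfn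
  have hw : ∀ j ∈ range (R.length + 1), 0 < w j := by
    intro j hj
    rw [Finset.mem_range] at hj
    exact h1 j (by omega)
  rcases h with h | h
  · have : 0 < ∑ j ∈ range (R.length + 1), w j * F l (v (f j)) :=
      Finset.sum_pos (fun j hj => mul_pos (hw j hj) (h _ (hle j hj))) ⟨0, by simp⟩
    exact this.ne' h3
  · have : ∑ j ∈ range (R.length + 1), w j * F l (v (f j)) < 0 :=
      Finset.sum_neg (fun j hj => mul_neg_of_pos_of_neg (hw j hj) (h _ (hle j hj))) ⟨0, by simp⟩
    exact this.ne h3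

lemma om_le_E {F : Lab → V d → ℝ} {R : List Lab} {a : Lab} {v : ℕ → V d} (h : E F R v = 0) :
    om F R a v = 0 := by
  unfold om
  rw [if_neg]
  rintro ⟨w, h1, h2, h3⟩
  unfold E at h
  rw [if_pos ⟨w, h1, h2⟩] at h
  exact absurd h (by decide)

lemma PS.inv {σ} (h : PS σ) : ∀ k, σ (σ k) = k := by
  rcases h with rfl | rfl | rfl <;> decide

lemma PS.sym (M : ℤ) {σ} (h : PS σ) : Sym (d := d) M (cD d) (pm σ) := pm_sym M _ σ h.inv fun _ => rfl

lemma lm_lm {σ} (h : PS σ) (l : Lab) : lm σ (lm σ l) = l := by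
  unfold lm
  refine Prod.ext ?_ rfl
  ext k
  simp only [Finset.mem_map_equiv]
  have : σ.symm = σ := by
    apply Equiv.ext
    intro k
    rw [Equiv.symm_apply_eq]
    exact (h.inv k).symm
  rw [this, h.inv]

namespace Setup
variable {M : ℤ} {F : Lab → V d → ℝ} {R : List Lab}

/-- all vertices good -/
def GX (R : List Lab) (v : ℕ → V d) : Prop := ∀ i, i ≤ R.length + 3 → Good (v i)

lemma GX_pm {σ} {v : ℕ → V d} (h : GX R v) : GX R (pm σ ∘ v) := fun i hi => Good.pm.2 (h i hi)

lemma E_bad (H : Setup M F R) {v : ℕ → V d} (hv : v ∈ X M (cD d) (R.length + 3)) (hb : ¬ GX R v) {R' : List Lab} (hR : ∀ l ∈ R, l ∈ R')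
    {f : ℕ → ℕ} (hf : StrictMono f) (hfn : f R'.length ≤ R.length + 3) :
    E F R' (fun i => v (f i)) = 0 := by
  unfold GX at hb
  push Not at hb
  obtain ⟨i, hi, hg⟩ := hb
  obtain ⟨l, hl, hc⟩ := H.bad v hv i hi hg
  exact E_CS (hR l hl) hc hf hfn

lemma E_pm (H : Setup M F R) {σ} (hσ : PS σ) {R' : List Lab} (hR : ∀ l ∈ R, l ∈ R') (hcl : ∀ l ∈ R', lm σ l ∈ R')
    {v : ℕ → V d} (hv : v ∈ X M (cD d) (R.length + 3)) {f : ℕ → ℕ} (hf : StrictMono f) (hfn : f R'.length ≤ R.length + 3) :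
    E F R' (fun i => (pm σ ∘ v) (f i)) = E F R' (fun i => v (f i)) := by
  by_cases hg : GX R v
  · have hle : ∀ j, j ≤ R'.length → f j ≤ R.length + 3 := fun j hj => (hf.monotone hj).trans hfn
    have key : ∀ l j, j ≤ R'.length → F l ((pm σ ∘ v) (f j)) = F (lm σ l) (v (f j)) :=
      fun l j hj => H.eqv σ hσ l _ (X_S H.adm hv (hle j hj)) (hg _ (hle j hj))
    refine E_congr (fun l hl => ⟨lm σ l, hcl l hl, 1, fun j hj => ?_⟩)
      (fun l hl => ⟨lm σ l, hcl l hl, 1, fun j hj => ?_⟩)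
    · rw [one_mul, key l j hj]
    · rw [one_mul, key _ j hj, lm_lm hσ]
  · rw [H.E_bad hv hg hR hf hfn, H.E_bad ((hσ.sym M).mem H.adm hv) _ hR hf hfn]
    intro h
    apply hg
    have := GX_pm (σ := σ) h
    rwa [(hσ.sym (d := d) M).comp] at this

lemma om_pm (H : Setup M F R) {v : ℕ → V d} (hv : v ∈ X M (cD d) (R.length + 3)) {f : ℕ → ℕ} (hf : StrictMono f) (hfn : f R.length ≤ R.length + 3) :
    om F R L13 (fun i => (pm tau ∘ v) (f i)) = om F R L13 (fun i => v (f i)) := by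
  have hσ : PS tau := Or.inl rfl
  have hv' := (hσ.sym (d := d) M).mem H.adm hv
  have hsys : Sys M F (L13 :: R) := H.sys.tail.tail
  by_cases hg : GX R v
  · have hle : ∀ j, j ≤ R.length → f j ≤ R.length + 3 := fun j hj => (hf.monotone hj).trans hfn
    have key : ∀ l j, j ≤ R.length → F l ((pm tau ∘ v) (f j)) = F (lm tau l) (v (f j)) :=
      fun l j hj => H.eqv _ hσ l _ (X_S H.adm hv (hle j hj)) (hg _ (hle j hj))
    have h13 : lm tau L13 = L13 := by decide
    apply F2.cases
    · refine om_mono (hsys.genX' H.adm List.suffix_rfl hv' hf hfn)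
        (hsys.nz _ (X_S H.adm hv' (hle 0 (Nat.zero_le _))) _ List.mem_cons_self)
        (fun l hl => ⟨lm tau l, H.clt l hl, 1, fun j hj => ?_⟩) ⟨1, Or.inl rfl, fun j hj => ?_⟩
      · rw [one_mul, key _ j hj, lm_lm hσ]
      · rw [one_mul, key _ j hj, h13]
    · refine om_mono (hsys.genX' H.adm List.suffix_rfl hv hf hfn)
        (hsys.nz _ (X_S H.adm hv (hle 0 (Nat.zero_le _))) _ List.mem_cons_self)
        (fun l hl => ⟨lm tau l, H.clt l hl, 1, fun j hj => ?_⟩) ⟨1, Or.inl rfl, fun j hj => ?_⟩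
      · rw [one_mul, key _ j hj]
      · rw [one_mul, key _ j hj, h13]
  · rw [om_le_E (H.E_bad hv hg (fun _ h => h) hf hfn), om_le_E (H.E_bad hv' _ (fun _ h => h) hf hfn)]
    intro h
    apply hg
    have := GX_pm (σ := tau) h
    rwa [(hσ.sym (d := d) M).comp] at this

/-- one switching step -/
lemma sw (H : Setup M F R) {σ} (hσ : PS σ) (u : V d → F2) (hu : ∀ v, Good v → u (pm σ v) = u v + 1)
    (ψ : (ℕ → V d) → F2) (hψ : ∀ v ∈ X M (cD d) (R.length + 3), ψ (pm σ ∘ v) = ψ v) (hs : ∀ v ∈ X M (cD d) (R.length + 3), ψ v ≠ 0 → GX R v) :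
    ∑ v ∈ X M (cD d) (R.length + 3), u (v 0) * ψ v = ∑ v ∈ X M (cD d) (R.length + 3), u (v 1) * ψ v :=
  switch H.adm (hσ.sym M) ψ (fun v => u (v 0)) (fun v => u (v 1)) hψ
    (fun v hv h => hu _ (hs v hv h 0 (by omega))) (fun v hv h => hu _ (hs v hv h 1 (by omega)))

/-- Stokes with weight wh -/
lemma stokesH (H : Setup M F R) (Ω : (ℕ → V d) → F2) (hn : ∀ k, ∀ v ∈ X M (cD d) (R.length + 3), Ω (sh (ng k ∘ v)) = Ω (sh v))
    (ht : ∀ v ∈ X M (cD d) (R.length + 3), Ω (sh (pm tau ∘ v)) = Ω (sh v)) (hs : ∀ v ∈ X M (cD d) (R.length + 3), Ω (sh v) ≠ 0 → GX R v) :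
    Itg M (cD d) (R.length + 3) (fun v => wh (v 0) * dl (R.length + 3) Ω v) = 0 := by
  have e0 : Itg M (cD d) (R.length + 3) (fun v => wh (v 0) * dl (R.length + 3) Ω v) =
      ∑ v ∈ X M (cD d) (R.length + 3), (fun x => G x * wh x) (v 0) * dl (R.length + 3) Ω v := by
    unfold Itg; exact Finset.sum_congr rfl fun v _ => by ring
  rw [e0]
  refine (stokes_core H.adm (by omega) (fun x => G x * wh x) Ω).trans ?_
  have e1 := H.sw (Or.inl rfl) wh (fun v hv => wh_tau hv) (fun v => G (v 0) * Ω (sh v))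
    (fun v hv => by rw [ht v hv]; simp only [Function.comp, G_pm])
    (fun v hv h => hs v hv (right_ne_zero_of_mul h))
  have e2 := switch01 H.adm (n := R.length + 3) (D := cD d) (by omega) (fun v => wh (v 1) * Ω (sh v))
    (fun k v hv => by rw [hn k v hv]; simp only [Function.comp, wh_ng])
  have e3 := flip0 H.adm (n := R.length + 3) (D := cD d) (by omega)
    (fun x : ℕ → V d => G (x 0) * (wh (x 0) * Ω x))
  calc _ = ∑ v ∈ X M (cD d) (R.length + 3), wh (v 0) * (G (v 0) * Ω (sh v)) := Finset.sum_congr rfl fun v _ => by ring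
    _ = ∑ v ∈ X M (cD d) (R.length + 3), wh (v 1) * (G (v 0) * Ω (sh v)) := e1
    _ = ∑ v ∈ X M (cD d) (R.length + 3), G (v 0) * (wh (v 1) * Ω (sh v)) := Finset.sum_congr rfl fun v _ => by ring
    _ = _ := e2
    _ = 0 := e3

def ww (v : V d) : F2 := wa v * wb v * wh v

/-- Stokes with weight ww -/
lemma stokesW (H : Setup M F R) (Ω : (ℕ → V d) → F2) (hn : ∀ k, ∀ v ∈ X M (cD d) (R.length + 3), Ω (sh (ng k ∘ v)) = Ω (sh v))
    (ht : ∀ σ, PS σ → ∀ v ∈ X M (cD d) (R.length + 3), Ω (sh (pm σ ∘ v)) = Ω (sh v)) (hs : ∀ v ∈ X M (cD d) (R.length + 3), Ω (sh v) ≠ 0 → GX R v) :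
    Itg M (cD d) (R.length + 3) (fun v => ww (v 0) * dl (R.length + 3) Ω v) = 0 := by
  have e0 : Itg M (cD d) (R.length + 3) (fun v => ww (v 0) * dl (R.length + 3) Ω v) =
      ∑ v ∈ X M (cD d) (R.length + 3), (fun x => G x * ww x) (v 0) * dl (R.length + 3) Ω v := by
    unfold Itg; exact Finset.sum_congr rfl fun v _ => by ring
  rw [e0]
  refine (stokes_core H.adm (by omega) (fun x => G x * ww x) Ω).trans ?_
  have e1 := H.sw (Or.inl rfl) wh (fun v hv => wh_tau hv) (fun v => (G (v 0) * (wa (v 0) * wb (v 0))) * Ω (sh v))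
    (fun v hv => by rw [ht _ (Or.inl rfl) v hv]; simp only [Function.comp, G_pm, wa_tau, wb_tau]; ring)
    (fun v hv h => hs v hv (right_ne_zero_of_mul h))
  have e1a := H.sw (Or.inr (Or.inl rfl)) wa (fun v hv => wa_s01 hv)
    (fun v => (G (v 0) * (wh (v 1) * wb (v 0))) * Ω (sh v))
    (fun v hv => by rw [ht _ (Or.inr (Or.inl rfl)) v hv]; simp only [Function.comp, G_pm, wh_s01, wb_s01])
    (fun v hv h => hs v hv (right_ne_zero_of_mul h))
  have e1b := H.sw (Or.inr (Or.inr rfl)) wb (fun v hv => wb_s23 hv)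
    (fun v => (G (v 0) * (wh (v 1) * wa (v 1))) * Ω (sh v))
    (fun v hv => by rw [ht _ (Or.inr (Or.inr rfl)) v hv]; simp only [Function.comp, G_pm, wh_s23, wa_s23])
    (fun v hv h => hs v hv (right_ne_zero_of_mul h))
  have e2 := switch01 H.adm (n := R.length + 3) (D := cD d) (by omega) (fun v => ww (v 1) * Ω (sh v))
    (fun k v hv => by rw [hn k v hv]; simp only [Function.comp, ww, wa_ng, wb_ng, wh_ng])
  have e3 := flip0 H.adm (n := R.length + 3) (D := cD d) (by omega)
    (fun x : ℕ → V d => G (x 0) * (ww (x 0) * Ω x))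
  calc _ = ∑ v ∈ X M (cD d) (R.length + 3), wh (v 0) * ((G (v 0) * (wa (v 0) * wb (v 0))) * Ω (sh v)) :=
        Finset.sum_congr rfl fun v _ => by simp only [ww]; ring
    _ = _ := e1
    _ = ∑ v ∈ X M (cD d) (R.length + 3), wa (v 0) * ((G (v 0) * (wh (v 1) * wb (v 0))) * Ω (sh v)) :=
        Finset.sum_congr rfl fun v _ => by ring
    _ = _ := e1a
    _ = ∑ v ∈ X M (cD d) (R.length + 3), wb (v 0) * ((G (v 0) * (wh (v 1) * wa (v 1))) * Ω (sh v)) :=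
        Finset.sum_congr rfl fun v _ => by ring
    _ = _ := e1b
    _ = ∑ v ∈ X M (cD d) (R.length + 3), G (v 0) * (ww (v 1) * Ω (sh v)) :=
        Finset.sum_congr rfl fun v _ => by simp only [ww]; ring
    _ = _ := e2
    _ = 0 := e3

end Setup
end EQ


namespace EQ
open Finset

variable {d : ℕ}

lemma g_ng (M : ℤ) (hM : Adm M) {v : V d} (hv : S M v) (i k : Fin 4) :
    g i (ng k v) = g i v + if k = i then 1 else 0 := by
  by_cases h : k = i
  · subst h; rw [if_pos rfl, g_ng_same (S.ne hM hv k)]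
  · rw [if_neg h, g_ng_ne (Ne.symm h), add_zero]

lemma om2_ng (s s' b b' h : V d → F2) {x y x' y' : V d} (c c' : F2)
    (h1 : s x' = s x + c) (h2 : s y' = s y + c) (h3 : s' x' = s' x + c') (h4 : s' y' = s' y + c')
    (h5 : b x' = b x) (h6 : b y' = b y) (h7 : b' x' = b' x) (h8 : b' y' = b' y)
    (h9 : h x' = h x) (h10 : h y' = h y) : om2 s s' b b' h x' y' = om2 s s' b b' h x y := by
  unfold om2
  rw [h1, h2, h3, h4, h5, h6, h7, h8, h9, h10]
  have e1 : s x + c + (s y + c) = s x + s y := by grind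
  have e2 : s' x + c' + (s' y + c') = s' x + s' y := by grind
  rw [e1, e2]

lemma om2_tau (s s' b b' h : V d → F2) {x y x' y' : V d}
    (h1 : s x' = s' x) (h2 : s y' = s' y) (h3 : s' x' = s x) (h4 : s' y' = s y)
    (h5 : b x' = b' x) (h6 : b y' = b' y) (h7 : b' x' = b x) (h8 : b' y' = b y)
    (h9 : h x' = h x + 1) (h10 : h y' = h y + 1) : om2 s s' b b' h x' y' = om2 s s' b b' h x y := by
  unfold om2
  rw [h1, h2, h3, h4, h5, h6, h7, h8, h9, h10]
  grind

lemma Nf_ng (s s' h : V d → F2) {x y z x' y' z' : V d} (c c' : F2)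
    (h1 : s x' = s x + c) (h2 : s y' = s y + c) (h1' : s z' = s z + c)
    (h3 : s' x' = s' x + c') (h4 : s' y' = s' y + c') (h3' : s' z' = s' z + c')
    (h9 : h x' = h x) (h10 : h y' = h y) : Nf s s' h x' y' z' = Nf s s' h x y z := by
  unfold Nf
  rw [h1, h2, h3, h4, h9, h10, h1', h3']
  grind

lemma Nf_tau (s s' h : V d → F2) {x y z x' y' z' : V d}
    (h1 : s x' = s' x) (h2 : s y' = s' y) (h1' : s z' = s' z)
    (h3 : s' x' = s x) (h4 : s' y' = s y) (h3' : s' z' = s z)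
    (h9 : h x' = h x + 1) (h10 : h y' = h y + 1) : Nf s s' h x' y' z' = Nf s s' h x y z := by
  unfold Nf
  rw [h1, h2, h3, h4, h9, h10, h1', h3']
  grind

namespace Setup
variable {M : ℤ} {F : Lab → V d → ℝ} {R : List Lab} (H : Setup M F R)

lemma step1 (H : Setup M F R) : Itg M (cD d) (R.length + 3) (fun v => ww (v 0) *
    T2 (Nf (fun x => sg (F L01 x)) (fun x => sg (F L23 x)) wh) (E F (L13 :: R)) v) = 0 := by
  unfold Itg
  refine Finset.sum_eq_zero fun v hv => ?_
  obtain ⟨l, hl, hc⟩ := H.max v hv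
  have hcs : ∀ j, j ≤ R.length + 3 → sg (F l (v j)) = sg (F l (v 0)) := by
    intro j hj
    unfold sg
    rcases hc with h | h
    · rw [if_pos (h j hj), if_pos (h 0 (by omega))]
    · rw [if_neg (h j hj).not_gt, if_neg (h 0 (by omega)).not_gt]
  have hT : T2 (Nf (fun x => sg (F L01 x)) (fun x => sg (F L23 x)) wh) (E F (L13 :: R)) v = 0 := by
    unfold T2
    rw [List.mem_cons, List.mem_cons] at hl
    rcases hl with rfl | rfl | hl
    · unfold Nf
      simp only [hcs 1 (by omega), hcs 2 (by omega)]
      grind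
    · unfold Nf
      simp only [hcs 1 (by omega), hcs 2 (by omega)]
      grind
    · rw [show E F (L13 :: R) (sh (sh v)) = 0 from E_CS hl hc (f := fun i => i + 2) (fun a b h => by dsimp; omega)
        (by simp), mul_zero]
  beta_reduce
  rw [hT, mul_zero, mul_zero]

/-- half-sum lemma -/
lemma half (H : Setup M F R) {σ} (hσ : PS σ) (u : V d → F2) (hu : ∀ v, Good v → u (pm σ v) = u v + 1)
    (B : (ℕ → V d) → F2) (hs : ∀ v ∈ X M (cD d) (R.length + 3), B v ≠ 0 → GX R v) :
    ∑ v ∈ X M (cD d) (R.length + 3), u (v 0) * (B v + B (pm σ ∘ v)) = ∑ v ∈ X M (cD d) (R.length + 3), B v := by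
  have h1 := (hσ.sym (d := d) M).sum H.adm (D := cD d) (n := R.length + 3) (fun v => u ((pm σ ∘ v) 0) * B v)
  have h2 : ∀ v : ℕ → V d, (pm σ ∘ (pm σ ∘ v)) = v := fun v => (hσ.sym (d := d) M).comp v
  simp only [h2] at h1
  simp only [mul_add, Finset.sum_add_distrib]
  rw [h1, ← Finset.sum_add_distrib]
  refine Finset.sum_congr rfl fun v hv => ?_
  by_cases hB : B v = 0
  · rw [hB]; ring
  · have := hu _ (hs v hv hB 0 (by omega))
    rw [show (pm σ ∘ v) 0 = pm σ (v 0) from rfl, this]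
    grind

lemma E2_ng (H : Setup M F R) (R' : List Lab) (k) (v : ℕ → V d) :
    E F R' (sh (sh (ng k ∘ v))) = E F R' (sh (sh v)) := E_ng H.sys.odd R' k (sh (sh v))

lemma rest_bad (H : Setup M F R) {v : ℕ → V d} (hv : v ∈ X M (cD d) (R.length + 3)) (hb : ¬ GX R v) :
    E F (L13 :: R) (sh (sh v)) = 0 :=
  H.E_bad hv hb (fun l hl => List.mem_cons_of_mem _ hl) (f := fun i => i + 2)
    (fun a b h => by dsimp; omega) (by simp)

lemma rest_pm (H : Setup M F R) {σ} (hσ : PS σ) {v : ℕ → V d} (hv : v ∈ X M (cD d) (R.length + 3)) :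
    E F (L13 :: R) (sh (sh (pm σ ∘ v))) = E F (L13 :: R) (sh (sh v)) :=
  H.E_pm hσ (fun l hl => List.mem_cons_of_mem _ hl) (H.cl σ hσ) hv (f := fun i => i + 2)
    (fun a b h => by dsimp; omega) (by simp)

lemma step2 (H : Setup M F R) : Itg M (cD d) (R.length + 3) (fun v => ww (v 0) *
    T2 (Nf (fun x => g 0 x + g 1 x) (fun x => g 2 x + g 3 x) wh) (E F (L13 :: R)) v) = 0 := by
  set s : V d → F2 := fun x => sg (F L01 x) with hs
  set s' : V d → F2 := fun x => sg (F L23 x) with hs'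
  set b : V d → F2 := fun x => s x + (g 0 x + g 1 x) with hb
  set b' : V d → F2 := fun x => s' x + (g 2 x + g 3 x) with hb'
  have e1 : (fun x : V d => g 0 x + g 1 x) = fun x => s x + b x := by
    funext x; simp only [hb]; grind
  have e2 : (fun x : V d => g 2 x + g 3 x) = fun x => s' x + b' x := by
    funext x; simp only [hb']; grind
  rw [e1, e2]
  have e3 : Itg M (cD d) (R.length + 3) (fun v => ww (v 0) *
      T2 (Nf (fun x => s x + b x) (fun x => s' x + b' x) wh) (E F (L13 :: R)) v) =
      Itg M (cD d) (R.length + 3) (fun v => ww (v 0) * T2 (Nf s s' wh) (E F (L13 :: R)) v +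
        ww (v 0) * dl (R.length + 3) (T1 (om2 s s' b b' wh) (E F (L13 :: R))) v) := by
    refine Itg_congr fun v hv => ?_
    rw [dl_T1, show dl (R.length + 2) (E F (L13 :: R)) (sh v) = 0 from
      H.sys.tail.cocycle H.adm hv (f := fun i => i + 1) strictMono_succ (by simp)]
    simp only [T2]
    rw [Nf_change]
    ring
  rw [e3, Itg_add, H.step1, zero_add]
  have hsx : ∀ k x, S M x → s (ng k x) = s x + if k ∈ L01.1 then 1 else 0 :=
    fun k x hx => sg_ng H.sys x hx k
  have hsx' : ∀ k x, S M x → s' (ng k x) = s' x + if k ∈ L23.1 then 1 else 0 :=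
    fun k x hx => sg_ng H.sys.tail x hx k
  have hbx : ∀ k x, S M x → b (ng k x) = b x := by
    intro k x hx
    simp only [hb]
    rw [hsx k x hx, g_ng M H.adm hx, g_ng M H.adm hx]
    have : (if k ∈ L01.1 then 1 else 0 : F2) = (if k = 0 then 1 else 0) + (if k = 1 then 1 else 0) := by
      revert k; decide
    rw [this]; grind
  have hbx' : ∀ k x, S M x → b' (ng k x) = b' x := by
    intro k x hx
    simp only [hb']
    rw [hsx' k x hx, g_ng M H.adm hx, g_ng M H.adm hx]
    have : (if k ∈ L23.1 then 1 else 0 : F2) = (if k = 2 then 1 else 0) + (if k = 3 then 1 else 0) := by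
      revert k; decide
    rw [this]; grind
  apply H.stokesW
  · intro k v hv
    have hS : ∀ i, i ≤ R.length + 3 → S M (v i) := fun i hi => X_S H.adm hv hi
    have h1 := hS 1 (by omega)
    have h2 := hS 2 (by omega)
    simp only [T1]
    rw [H.E2_ng]
    congr 1
    exact om2_ng s s' b b' wh _ _ (hsx k _ h1) (hsx k _ h2) (hsx' k _ h1) (hsx' k _ h2)
      (hbx k _ h1) (hbx k _ h2) (hbx' k _ h1) (hbx' k _ h2) (wh_ng k _) (wh_ng k _)
  · intro σ hσ v hv
    simp only [T1]
    rw [H.rest_pm hσ hv]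
    by_cases hg : GX R v
    · congr 1
      have hS : ∀ i, i ≤ R.length + 3 → S M (v i) := fun i hi => X_S H.adm hv hi
      have h1 := hS 1 (by omega)
      have h2 := hS 2 (by omega)
      have g1 := hg 1 (by omega)
      have g2 := hg 2 (by omega)
      have hq : ∀ x, S M x → Good x → s (pm σ x) = sg (F (lm σ L01) x) ∧ s' (pm σ x) = sg (F (lm σ L23) x) :=
        fun x h1 h2 => ⟨congrArg sg (H.eqv σ hσ L01 x h1 h2), congrArg sg (H.eqv σ hσ L23 x h1 h2)⟩
      change om2 s s' b b' wh (pm σ (v 1)) (pm σ (v 2)) = om2 s s' b b' wh (v 1) (v 2)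
      rcases hσ with rfl | rfl | rfl
      · have ea : lm tau L01 = L23 := by decide
        have eb : lm tau L23 = L01 := by decide
        rw [ea, eb] at hq
        have hq2 : ∀ x, S M x → Good x → b (pm tau x) = b' x ∧ b' (pm tau x) = b x := by
          intro x h1 h2
          simp only [hb, hb', g_pm, tau_0, tau_1, tau_2, tau_3]
          rw [(hq x h1 h2).1, (hq x h1 h2).2]
          exact ⟨rfl, rfl⟩
        exact om2_tau s s' b b' wh (hq _ h1 g1).1 (hq _ h2 g2).1 (hq _ h1 g1).2 (hq _ h2 g2).2
          (hq2 _ h1 g1).1 (hq2 _ h2 g2).1 (hq2 _ h1 g1).2 (hq2 _ h2 g2).2 (wh_tau g1) (wh_tau g2)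
      · have ea : lm s01 L01 = L01 := by decide
        have eb : lm s01 L23 = L23 := by decide
        rw [ea, eb] at hq
        have hq2 : ∀ x, S M x → Good x → b (pm s01 x) = b x ∧ b' (pm s01 x) = b' x := by
          intro x h1 h2
          simp only [hb, hb', g_pm, s01_0, s01_1, s01_2, s01_3]
          rw [(hq x h1 h2).1, (hq x h1 h2).2]
          exact ⟨by ring, rfl⟩
        have z : ∀ x : F2, x = x + 0 := fun x => (add_zero x).symm
        exact om2_ng s s' b b' wh 0 0 ((hq _ h1 g1).1.trans (z _)) ((hq _ h2 g2).1.trans (z _))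
          ((hq _ h1 g1).2.trans (z _)) ((hq _ h2 g2).2.trans (z _))
          (hq2 _ h1 g1).1 (hq2 _ h2 g2).1 (hq2 _ h1 g1).2 (hq2 _ h2 g2).2 (wh_s01 _) (wh_s01 _)
      · have ea : lm s23 L01 = L01 := by decide
        have eb : lm s23 L23 = L23 := by decide
        rw [ea, eb] at hq
        have hq2 : ∀ x, S M x → Good x → b (pm s23 x) = b x ∧ b' (pm s23 x) = b' x := by
          intro x h1 h2
          simp only [hb, hb', g_pm, s23_0, s23_1, s23_2, s23_3]
          rw [(hq x h1 h2).1, (hq x h1 h2).2]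
          exact ⟨rfl, by ring⟩
        have z : ∀ x : F2, x = x + 0 := fun x => (add_zero x).symm
        exact om2_ng s s' b b' wh 0 0 ((hq _ h1 g1).1.trans (z _)) ((hq _ h2 g2).1.trans (z _))
          ((hq _ h1 g1).2.trans (z _)) ((hq _ h2 g2).2.trans (z _))
          (hq2 _ h1 g1).1 (hq2 _ h2 g2).1 (hq2 _ h1 g1).2 (hq2 _ h2 g2).2 (wh_s23 _) (wh_s23 _)
    · rw [H.rest_bad hv hg, mul_zero, mul_zero]
  · intro v hv h
    by_contra hg
    exact h (by simp only [T1]; rw [H.rest_bad hv hg, mul_zero])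

lemma step3 (H : Setup M F R) : Itg M (cD d) (R.length + 3) (fun v => wh (v 0) *
    T2 (Nf (g 0) (g 2) wh) (E F (L13 :: R)) v) = 0 := by
  have h2 := H.step2
  have a1 := H.half (Or.inr (Or.inl rfl)) wa (fun v hv => wa_s01 hv)
    (fun v => wb (v 0) * (G (v 0) * (wh (v 0) * T2 (Nf (g 0) (fun x => g 2 x + g 3 x) wh) (E F (L13 :: R)) v)))
    (fun v hv h => by
      by_contra hg
      exact h (by simp only [T2]; rw [H.rest_bad hv hg]; ring))
  have a2 := H.half (Or.inr (Or.inr rfl)) wb (fun v hv => wb_s23 hv)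
    (fun v => (G (v 0) * (wh (v 0) * T2 (Nf (g 0) (g 2) wh) (E F (L13 :: R)) v)))
    (fun v hv h => by
      by_contra hg
      exact h (by simp only [T2]; rw [H.rest_bad hv hg]; ring))
  unfold Itg at h2 ⊢
  rw [← a2, ← h2]
  calc _ = ∑ v ∈ X M (cD d) (R.length + 3), wb (v 0) * (G (v 0) * (wh (v 0) * T2 (Nf (g 0) (fun x => g 2 x + g 3 x) wh) (E F (L13 :: R)) v)) := by
        refine Finset.sum_congr rfl fun v hv => ?_
        congr 1
        simp only [T2]
        rw [H.rest_pm (Or.inr (Or.inr rfl)) hv]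
        simp only [Function.comp, G_pm, wh_s23, Nf, g_pm, s23_0, s23_2]
        ring
    _ = _ := a1.symm
    _ = _ := by
        refine Finset.sum_congr rfl fun v hv => ?_
        simp only [T2]
        rw [H.rest_pm (Or.inr (Or.inl rfl)) hv]
        simp only [Function.comp, G_pm, wh_s01, wb_s01, Nf, g_pm, s01_0, s01_2, s01_3, ww]
        ring

lemma R_bad (H : Setup M F R) {v : ℕ → V d} (hv : v ∈ X M (cD d) (R.length + 3)) (hb : ¬ GX R v) (p : ℕ) (hp : p ≤ 3) :
    E F R (fun i => v (i + p)) = 0 :=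
  H.E_bad hv hb (fun l hl => hl) (f := fun i => i + p)
    (fun a b h => by dsimp; omega) (by omega)

lemma R_tau (H : Setup M F R) {v : ℕ → V d} (hv : v ∈ X M (cD d) (R.length + 3)) (p : ℕ) (hp : p ≤ 3) :
    E F R (fun i => (pm tau ∘ v) (i + p)) = E F R (fun i => v (i + p)) :=
  H.E_pm (Or.inl rfl) (fun l hl => hl) H.clt hv (f := fun i => i + p)
    (fun a b h => by dsimp; omega) (by omega)

/-- steps 4 and 5 -/
lemma step5 (H : Setup M F R) : Itg M (cD d) (R.length + 3) (fun v => wh (v 0) *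
    T2 (Nf (g 0) (g 2) wh) (cup (fun x => g 1 x + g 3 x) (E F R)) v) = 0 := by
  set s : V d → F2 := fun x => sg (F L13 x) with hs
  set b : V d → F2 := fun x => s x + (g 1 x + g 3 x) with hb
  have hsys : Sys M F (L13 :: R) := H.sys.tail.tail
  have hco : ∀ v ∈ X M (cD d) (R.length + 3), dl (R.length + 1) (E F R) (sh (sh v)) = 0 := fun v hv =>
    hsys.cocycle H.adm hv (f := fun i => i + 2) (fun a b h => by dsimp; omega) (by omega)
  set Ω : (ℕ → V d) → F2 := T2 (Nf (g 0) (g 2) wh) (fun v => om F R L13 v + b (v 0) * E F R v) with hΩ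
  have e3 : Itg M (cD d) (R.length + 3) (fun v => wh (v 0) *
      T2 (Nf (g 0) (g 2) wh) (cup (fun x => g 1 x + g 3 x) (E F R)) v) =
      Itg M (cD d) (R.length + 3) (fun v => wh (v 0) * T2 (Nf (g 0) (g 2) wh) (E F (L13 :: R)) v +
        wh (v 0) * dl (R.length + 3) Ω v) := by
    refine Itg_congr fun v hv => ?_
    have hp := hsys.peel H.adm hv (f := fun i => i + 2) (fun a b h => by dsimp; omega) (by omega)
    change E F (L13 :: R) (sh (sh v)) = cup s (E F R) (sh (sh v)) + dl (R.length + 1) (om F R L13) (sh (sh v)) at hp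
    rw [hΩ, dl_T2, Nf_cocycle, zero_mul, zero_add]
    have e4 : dl (R.length + 1) (fun v => om F R L13 v + b (v 0) * E F R v) (sh (sh v)) =
        dl (R.length + 1) (om F R L13) (sh (sh v)) + cup b (E F R) (sh (sh v)) := by
      have e5 : ∀ u : ℕ → V d, dl (R.length + 1) (fun v => b (v 0) * E F R v) u =
          cup b (E F R) u + b (u 0) * dl (R.length + 1) (E F R) u := by
        intro u
        simp only [dl, cup]
        rw [Finset.sum_range_succ', Finset.sum_range_succ' (fun j => E F R (face j u)), mul_add, Finset.mul_sum]
        simp only [face_head, face_zero]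
        have : sh u 0 = u 1 := rfl
        rw [this]
        grind
      have e6 := e5 (sh (sh v))
      rw [hco v hv, mul_zero, add_zero] at e6
      rw [← e6]
      simp only [dl, Finset.sum_add_distrib]
    rw [e4]
    simp only [T2]
    rw [hp]
    have e7 : cup (fun x => g 1 x + g 3 x) (E F R) (sh (sh v)) = cup s (E F R) (sh (sh v)) + cup b (E F R) (sh (sh v)) := by
      rw [← cup_add]
      congr 1
      funext x
      simp only [hb]; grind
    rw [e7]
    grind
  rw [e3, Itg_add, H.step3, zero_add]
  have hbx : ∀ k x, S M x → b (ng k x) = b x := by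
    intro k x hx
    simp only [hb]
    rw [show s (ng k x) = _ from sg_ng hsys x hx k, g_ng M H.adm hx, g_ng M H.adm hx]
    have : (if k ∈ L13.1 then 1 else 0 : F2) = (if k = 1 then 1 else 0) + (if k = 3 then 1 else 0) := by
      revert k; decide
    rw [this]; grind
  apply H.stokesH
  · intro k v hv
    have hS : ∀ i, i ≤ R.length + 3 → S M (v i) := fun i hi => X_S H.adm hv hi
    have h1 := hS 1 (by omega)
    have h2 := hS 2 (by omega)
    have h3 := hS 3 (by omega)
    simp only [hΩ, T2]
    congr 1
    · exact Nf_ng (g 0) (g 2) wh _ _ (g_ng M H.adm h1 _ k) (g_ng M H.adm h2 _ k) (g_ng M H.adm h3 _ k)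
        (g_ng M H.adm h1 _ k) (g_ng M H.adm h2 _ k) (g_ng M H.adm h3 _ k) (wh_ng k _) (wh_ng k _)
    · congr 1
      · exact hsys.om_sh H.adm hv (f := fun i => i + 3) (fun a b h => by dsimp; omega) le_rfl k
      · congr 1
        · exact hbx k _ h3
        · exact E_ng H.sys.odd R k (sh (sh (sh v)))
  · intro v hv
    simp only [hΩ, T2]
    by_cases hg : GX R v
    · have hS : ∀ i, i ≤ R.length + 3 → S M (v i) := fun i hi => X_S H.adm hv hi
      have h3 := hS 3 (by omega)
      have g1 := hg 1 (by omega)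
      have g2 := hg 2 (by omega)
      have g3 := hg 3 (by omega)
      congr 1
      · refine Nf_tau (g 0) (g 2) wh ?_ ?_ ?_ ?_ ?_ ?_ (wh_tau g1) (wh_tau g2)
        all_goals
          change g _ (pm tau _) = _
          rw [g_pm]
          rfl
      · congr 1
        · exact H.om_pm hv (f := fun i => i + 3) (fun a b h => by dsimp; omega) le_rfl
        · congr 1
          · change b (pm tau (v 3)) = b (v 3)
            simp only [hb, hs]
            rw [H.eqv tau (Or.inl rfl) L13 _ h3 g3, g_pm, g_pm, tau_1, tau_3, show lm tau L13 = L13 by decide]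
            ring
          · exact H.R_tau hv 3 le_rfl
    · have hE := H.R_bad hv hg 3 le_rfl
      have hE' := (H.R_tau hv 3 le_rfl).trans hE
      have := om_le_E (a := L13) hE
      have := om_le_E (a := L13) hE'
      change _ * (om F R L13 (fun i => (pm tau ∘ v) (i+3)) + _ * E F R (fun i => (pm tau ∘ v) (i+3))) =
        _ * (om F R L13 (fun i => v (i+3)) + _ * E F R (fun i => v (i+3)))
      rw [hE, hE', om_le_E (a := L13) hE, om_le_E (a := L13) hE']
      ring
  · intro v hv h
    by_contra hg
    apply h
    have hE := H.R_bad hv hg 3 le_rfl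
    simp only [hΩ, T2]
    change _ * (om F R L13 (fun i => v (i+3)) + _ * E F R (fun i => v (i+3))) = 0
    rw [hE, om_le_E (a := L13) hE]
    ring

lemma step6 (H : Setup M F R) : Itg M (cD d) (R.length + 3)
    (T2 (Nf (g 0) (g 2) wh) (cup (g 3) (E F R))) = 0 := by
  have h5 := H.step5
  have a1 := H.half (Or.inl rfl) wh (fun v hv => wh_tau hv)
    (fun v => G (v 0) * T2 (Nf (g 0) (g 2) wh) (cup (g 3) (E F R)) v)
    (fun v hv h => by
      by_contra hg
      apply h
      simp only [T2, cup]
      rw [show E F R (sh (sh (sh v))) = 0 from H.R_bad hv hg 3 le_rfl]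
      ring)
  unfold Itg at h5 ⊢
  rw [← a1, ← h5]
  refine Finset.sum_congr rfl fun v hv => ?_
  simp only [T2, cup]
  rw [show E F R (sh (sh (sh (pm tau ∘ v)))) = E F R (sh (sh (sh v))) from H.R_tau hv 3 le_rfl]
  by_cases hg : GX R v
  · have g1 := hg 1 (by omega)
    have g0 := hg 0 (by omega)
    have hN : Nf (g 0) (g 2) wh ((pm tau ∘ v) 0) ((pm tau ∘ v) 1) ((pm tau ∘ v) 2) = Nf (g 0) (g 2) wh (v 0) (v 1) (v 2) := by
      refine Nf_tau (g 0) (g 2) wh ?_ ?_ ?_ ?_ ?_ ?_ (wh_tau g0) (wh_tau g1)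
      all_goals
        change g _ (pm tau _) = _
        rw [g_pm]
        rfl
    rw [hN]
    have k1 : G ((pm tau ∘ v) 0) = G (v 0) := G_pm _ _
    have k2 : ∀ i, g 3 (sh (sh (pm tau ∘ v)) i) = g 1 (sh (sh v) i) := fun i => by
      change g 3 (pm tau _) = _
      rw [g_pm]; rfl
    rw [k1, k2, k2]
    ring
  · rw [show E F R (sh (sh (sh v))) = 0 from H.R_bad hv hg 3 le_rfl]
    ring

lemma cupR (H : Setup M F R) (i : Fin 4) {D : Fin 4 → ℕ} {n : ℕ} {v : ℕ → V d} (hv : v ∈ X M D n)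
    {p : ℕ} (hp : R.length + 2 + p ≤ n) :
    dl (R.length + 2) (cup (g i) (E F R)) (fun j => v (j + p)) = 0 := by
  rw [cup_T1, dl_T1]
  have hsys : Sys M F (L13 :: R) := H.sys.tail.tail
  rw [show dl (R.length + 1) (E F R) (sh (fun j => v (j + p))) = 0 from
    hsys.cocycle H.adm hv (f := fun j => j + 1 + p) (fun a b h => by dsimp; omega) (by omega)]
  grind

lemma cup2R (H : Setup M F R) (i j : Fin 4) {D : Fin 4 → ℕ} {n : ℕ} {v : ℕ → V d} (hv : v ∈ X M D n)
    (hp : R.length + 3 ≤ n) :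
    dl (R.length + 3) (cup (g j) (cup (g i) (E F R))) v = 0 := by
  rw [cup_T1 (g j), dl_T1]
  rw [show dl (R.length + 2) (cup (g i) (E F R)) (sh v) = 0 from H.cupR i hv (p := 1) hp]
  grind

lemma step7 (H : Setup M F R) : Itg M (cD d) (R.length + 3)
    (cup (g 0) (cup (g 2) (cup (g 3) (E F R)))) = 0 := by
  set κ : V d → V d → F2 := fun x y => wh x * (g 0 x + g 0 y) * (g 2 x + g 2 y) with hκ
  have h6 := H.step6
  have e : Itg M (cD d) (R.length + 3) (T2 (Nf (g 0) (g 2) wh) (cup (g 3) (E F R))) =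
      Itg M (cD d) (R.length + 3) (fun v => cup (g 0) (cup (g 2) (cup (g 3) (E F R))) v +
        dl (R.length + 3) (T1 κ (cup (g 3) (E F R))) v) := by
    refine Itg_congr fun v hv => ?_
    rw [dl_T1, show dl (R.length + 2) (cup (g 3) (E F R)) (sh v) = 0 from H.cupR 3 hv (p := 1) (by omega)]
    rw [cup, cup]
    simp only [T2, Nf, hκ]
    have : sh v 0 = v 1 := rfl
    have : sh v 1 = v 2 := rfl
    grind
  rw [e, Itg_add] at h6
  have h8 : Itg M (cD d) (R.length + 3) (dl (R.length + 3) (T1 κ (cup (g 3) (E F R)))) = 0 := by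
    apply stokes H.adm (by omega)
    intro k v hv
    have hS : ∀ i, i ≤ R.length + 3 → S M (v i) := fun i hi => X_S H.adm hv hi
    have h1 := hS 1 (by omega)
    have h2 := hS 2 (by omega)
    have h3 := hS 3 (by omega)
    simp only [T1, cup, hκ]
    rw [show E F R (sh (sh (sh (ng k ∘ v)))) = E F R (sh (sh (sh v))) from E_ng H.sys.odd R k (sh (sh (sh v)))]
    have q1 : sh (ng k ∘ v) 0 = ng k (v 1) := rfl
    have q2 : sh (ng k ∘ v) 1 = ng k (v 2) := rfl
    have q3 : sh (sh (ng k ∘ v)) 0 = ng k (v 2) := rfl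
    have q4 : sh (sh (ng k ∘ v)) 1 = ng k (v 3) := rfl
    have p1 : sh v 0 = v 1 := rfl
    have p2 : sh v 1 = v 2 := rfl
    have p3 : sh (sh v) 0 = v 2 := rfl
    have p4 : sh (sh v) 1 = v 3 := rfl
    rw [q1, q2, q3, q4, p1, p2, p3, p4, g_ng M H.adm h1, g_ng M H.adm h2, g_ng M H.adm h1, g_ng M H.adm h2,
      g_ng M H.adm h2, g_ng M H.adm h3, wh_ng]
    grind
  rw [h8, add_zero] at h6
  exact h6

theorem result (H : Setup M F R) : Cf (({0}, 0) :: ({2}, 0) :: ({3}, 0) :: R) (cD d) = 0 := by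
  have hng1 : ∀ (i k : Fin 4) (D : Fin 4 → ℕ) (n : ℕ), 1 ≤ n → ∀ v ∈ X (d := d) M D (n + 1),
      cup (g i) (E F R) (sh (ng k ∘ v)) = cup (g i) (E F R) (sh v) := by
    intro i k D n hn v hv
    have h1 := X_S H.adm hv (i := 1) (by omega)
    have h2 := X_S H.adm hv (i := 2) (by omega)
    simp only [cup]
    rw [show E F R (sh (sh (ng k ∘ v))) = E F R (sh (sh v)) from E_ng H.sys.odd R k (sh (sh v))]
    change (g i (ng k (v 1)) + g i (ng k (v 2))) * _ = (g i (v 1) + g i (v 2)) * _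
    rw [g_ng M H.adm h1, g_ng M H.adm h2]
    grind
  have hng2 : ∀ (i j k : Fin 4) (D : Fin 4 → ℕ) (n : ℕ), 2 ≤ n → ∀ v ∈ X (d := d) M D (n + 1),
      cup (g j) (cup (g i) (E F R)) (sh (ng k ∘ v)) = cup (g j) (cup (g i) (E F R)) (sh v) := by
    intro i j k D n hn v hv
    have h1 := X_S H.adm hv (i := 1) (by omega)
    have h2 := X_S H.adm hv (i := 2) (by omega)
    have h3 := X_S H.adm hv (i := 3) (by omega)
    simp only [cup]
    rw [show E F R (sh (sh (sh (ng k ∘ v)))) = E F R (sh (sh (sh v))) from E_ng H.sys.odd R k (sh (sh (sh v)))]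
    change (g j (ng k (v 1)) + g j (ng k (v 2))) * ((g i (ng k (v 2)) + g i (ng k (v 3))) * _) =
      (g j (v 1) + g j (v 2)) * ((g i (v 2) + g i (v 3)) * _)
    rw [g_ng M H.adm h1, g_ng M H.adm h2, g_ng M H.adm h2, g_ng M H.adm h3]
    grind
  have hsys : Sys M F (L13 :: R) := H.sys.tail.tail
  have h7 := H.step7
  have hlt0 : ∀ i, cD d i < d + 1 := fun i => Nat.lt_succ_self d
  have hlt1 := low_lt hlt0 0
  have hlt2 := low_lt hlt1 2
  have hlt3 := low_lt hlt2 3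
  rw [front_g H.adm (n := R.length + 2) 0 (hlt0 _) _ (fun k v hv => hng2 _ _ k _ _ (by omega) v hv)
    (fun v hv => H.cup2R _ _ hv le_rfl),
    front_g H.adm (n := R.length + 1) 2 (hlt1 _) _ (fun k v hv => hng1 _ k _ _ (by omega) v hv)
    (fun v hv => H.cupR _ hv (p := 0) le_rfl),
    front_g H.adm (n := R.length) 3 (hlt2 _) _ (fun k v hv => E_ng H.sys.odd R k (sh v))
      (fun v hv => hsys.cocycle H.adm hv (f := id) strictMono_id le_rfl),
    Itg_E H.adm R _ hlt3 hsys.tail] at h7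
  rw [Cf, Finset.sum_singleton, Cf, Finset.sum_singleton, Cf, Finset.sum_singleton]
  exact h7

end Setup
end EQ


namespace EQ
open Finset

abbrev KA := AddMonoidAlgebra F2 (Fin 4 → ℤ)

namespace KA

instance : CharP KA 2 := by
  haveI : CharP F2 2 := inferInstanceAs (CharP (ZMod 2) 2)
  exact charP_of_injective_algebraMap (R := F2) (A := KA) (FaithfulSMul.algebraMap_injective F2 KA) 2

def mo (a b c e : ℤ) : KA := AddMonoidAlgebra.single ![a, b, c, e] 1
def co (p : KA) (a b c e : ℤ) : F2 := p.coeff ![a, b, c, e]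

lemma co_add (p q : KA) (a b c e : ℤ) : co (p + q) a b c e = co p a b c e + co q a b c e := by
  simp [co]

lemma co_mo_mul (p : KA) (a b c e a' b' c' e' : ℤ) :
    co (mo a b c e * p) a' b' c' e' = co p (a' - a) (b' - b) (c' - c) (e' - e) := by
  unfold co mo
  rw [AddMonoidAlgebra.coeff_single_mul_apply, one_mul]
  congr 1
  ext i; fin_cases i <;> simp <;> ring

lemma mo_mul (a b c e a' b' c' e' : ℤ) : mo a b c e * mo a' b' c' e' = mo (a + a') (b + b') (c + c') (e + e') := by
  unfold mo
  rw [AddMonoidAlgebra.single_mul_single, one_mul]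
  congr 1
  ext i; fin_cases i <;> simp

lemma co_mo (a b c e a' b' c' e' : ℤ) : co (mo a b c e) a' b' c' e' =
    if a = a' ∧ b = b' ∧ c = c' ∧ e = e' then 1 else 0 := by
  unfold co mo
  rw [AddMonoidAlgebra.coeff_single, Finsupp.single_apply]
  congr 1
  simp

lemma co_zero (a b c e : ℤ) : co 0 a b c e = 0 := by simp [co]

def x0 : KA := mo 1 0 0 0
def x1 : KA := mo 0 1 0 0
def x2 : KA := mo 0 0 1 0
def x3 : KA := mo 0 0 0 1

lemma mo_pow (a b c e : ℤ) (n : ℕ) : mo a b c e ^ n = mo (n * a) (n * b) (n * c) (n * e) := by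
  induction n with
  | zero => simp [mo, AddMonoidAlgebra.one_def]; congr 1; ext i; fin_cases i <;> simp
  | succ n ih => rw [pow_succ, ih, mo_mul]; congr 1 <;> push_cast <;> ring

lemma mo_eq (a b c e : ℕ) : x0 ^ a * x1 ^ b * x2 ^ c * x3 ^ e = mo a b c e := by
  unfold x0 x1 x2 x3
  simp only [mo_pow, mo_mul]
  congr 1 <;> simp

/-- squares -/
lemma co_sq (p : KA) : (∀ a b c e, co (p ^ 2) (2 * a) (2 * b) (2 * c) (2 * e) = co p a b c e) ∧
    (∀ a b c e, (Odd a ∨ Odd b ∨ Odd c ∨ Odd e) → co (p ^ 2) a b c e = 0) := by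
  induction p using AddMonoidAlgebra.induction_linear with
  | zero => simp [co_zero]
  | add p q hp hq =>
    have : (p + q) ^ 2 = p ^ 2 + q ^ 2 := add_pow_char p q 2
    rw [this]
    refine ⟨fun a b c e => ?_, fun a b c e h => ?_⟩
    · rw [co_add, co_add, hp.1, hq.1]
    · rw [co_add, hp.2 _ _ _ _ h, hq.2 _ _ _ _ h, add_zero]
  | single z r =>
    have hz : z = ![z 0, z 1, z 2, z 3] := by ext i; fin_cases i <;> rfl
    have hr : r = 0 ∨ r = 1 := by revert r; decide
    rcases hr with rfl | rfl
    · simp [co_zero]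
    · have : (AddMonoidAlgebra.single z 1 : KA) = mo (z 0) (z 1) (z 2) (z 3) := by
        unfold mo; rw [← hz]
      rw [this, mo_pow]
      refine ⟨fun a b c e => ?_, fun a b c e h => ?_⟩
      · rw [co_mo, co_mo]
        congr 1
        push_cast
        simp
      · rw [co_mo, if_neg]
        push_cast
        rintro ⟨rfl, rfl, rfl, rfl⟩
        rcases h with h | h | h | h <;> exact absurd h (by simp)

def alt (a b c e : ℕ) : KA :=
  mo a b c e + mo a b e c + mo a c b e + mo a c e b + mo a e b c + mo a e c b +
  mo b a c e + mo b a e c + mo b c a e + mo b c e a + mo b e a c + mo b e c a +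
  mo c a b e + mo c a e b + mo c b a e + mo c b e a + mo c e a b + mo c e b a +
  mo e a b c + mo e a c b + mo e b a c + mo e b c a + mo e c a b + mo e c b a

/-- the key coefficient extraction -/
lemma alt_sq (p : KA) (a b c e : ℕ) (u0 u1 u2 u3 : ℤ) :
    co (alt (2 * a + 1) (2 * b + 1) (2 * c) (2 * e) * p ^ 2) (2 * u0 + 1) (2 * u1) (2 * u2 + 1) (2 * u3) =
      co p (u0 - a) (u1 - c) (u2 - b) (u3 - e) + co p (u0 - a) (u1 - e) (u2 - b) (u3 - c) +
      co p (u0 - b) (u1 - c) (u2 - a) (u3 - e) + co p (u0 - b) (u1 - e) (u2 - a) (u3 - c) := by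
  have h1 := fun A B C E => ((co_sq p).1 A B C E)
  have h2 := fun A B C E h => ((co_sq p).2 A B C E h)
  unfold alt
  simp only [add_mul, co_add, co_mo_mul]
  have o1 : ∀ (u : ℤ) (c : ℕ), Odd (2 * u + 1 - ((2 * c : ℕ) : ℤ)) := fun u c => ⟨u - c, by push_cast; ring⟩
  have o2 : ∀ (u : ℤ) (c : ℕ), Odd (2 * u - ((2 * c + 1 : ℕ) : ℤ)) := fun u c => ⟨u - c - 1, by push_cast; ring⟩
  have e1 : ∀ (u : ℤ) (c : ℕ), (2 * u - ((2 * c : ℕ) : ℤ)) = 2 * (u - c) := fun u c => by push_cast; ring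
  have e2 : ∀ (u : ℤ) (c : ℕ), (2 * u + 1 - ((2 * c + 1 : ℕ) : ℤ)) = 2 * (u - c) := fun u c => by push_cast; ring
  have v0 : ∀ (u : ℤ) (c : ℕ) B C E, co (p ^ 2) (2 * u + 1 - ((2 * c : ℕ) : ℤ)) B C E = 0 :=
    fun u c B C E => h2 _ _ _ _ (Or.inl (o1 u c))
  have v2 : ∀ (u : ℤ) (c : ℕ) A B E, co (p ^ 2) A B (2 * u + 1 - ((2 * c : ℕ) : ℤ)) E = 0 :=
    fun u c B C E => h2 _ _ _ _ (Or.inr (Or.inr (Or.inl (o1 u c))))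
  have v1 : ∀ (u : ℤ) (c : ℕ) B C E, co (p ^ 2) B (2 * u - ((2 * c + 1 : ℕ) : ℤ)) C E = 0 :=
    fun u c B C E => h2 _ _ _ _ (Or.inr (Or.inl (o2 u c)))
  simp only [v0, v1, v2]
  simp only [e1, e2, h1]
  ring

def VV : KA := (x0 + x1) * (x0 + x2) * (x0 + x3) * (x1 + x2) * (x1 + x3) * (x2 + x3)
def RR : KA := x0 * x1 * x2 * x3 * (x1 + x2 + x3) * (x0 + x2 + x3) * (x0 + x1 + x3) * (x0 + x1 + x2)

lemma neg_eq (p : KA) : -p = p := CharTwo.neg_eq p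
lemma sub_eq (p q : KA) : p - q = p + q := CharTwo.sub_eq_add p q


def altP {A : Type*} [CommRing A] (y0 y1 y2 y3 : A) (a b c e : ℕ) : A :=
  y0^a*y1^b*y2^c*y3^e + y0^a*y1^c*y2^e*y3^b + y0^a*y1^e*y2^b*y3^c + y0^b*y1^a*y2^e*y3^c + y0^b*y1^c*y2^a*y3^e + y0^b*y1^e*y2^c*y3^a + y0^c*y1^a*y2^b*y3^e + y0^c*y1^b*y2^e*y3^a + y0^c*y1^e*y2^a*y3^b + y0^e*y1^a*y2^c*y3^b + y0^e*y1^b*y2^a*y3^c + y0^e*y1^c*y2^b*y3^a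
def altN {A : Type*} [CommRing A] (y0 y1 y2 y3 : A) (a b c e : ℕ) : A :=
  y0^a*y1^b*y2^e*y3^c + y0^a*y1^c*y2^b*y3^e + y0^a*y1^e*y2^c*y3^b + y0^b*y1^a*y2^c*y3^e + y0^b*y1^c*y2^e*y3^a + y0^b*y1^e*y2^a*y3^c + y0^c*y1^a*y2^e*y3^b + y0^c*y1^b*y2^a*y3^e + y0^c*y1^e*y2^b*y3^a + y0^e*y1^a*y2^b*y3^c + y0^e*y1^b*y2^c*y3^a + y0^e*y1^c*y2^a*y3^b

lemma idV {A : Type*} [CommRing A] (y0 y1 y2 y3 : A) :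
    (y0 - y1) * (y0 - y2) * (y0 - y3) * (y1 - y2) * (y1 - y3) * (y2 - y3) =
      altP y0 y1 y2 y3 3 2 1 0 - altN y0 y1 y2 y3 3 2 1 0 := by
  unfold altP altN; ring

lemma idR {A : Type*} [CommRing A] (y0 y1 y2 y3 : A) :
    (altP y0 y1 y2 y3 3 2 1 0 - altN y0 y1 y2 y3 3 2 1 0) *
     (y0 * y1 * y2 * y3 * (y1 + y2 + y3) * (y0 + y2 + y3) * (y0 + y1 + y3) * (y0 + y1 + y2)) =
      (altP y0 y1 y2 y3 7 4 2 1 - altN y0 y1 y2 y3 7 4 2 1) +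
      (altP y0 y1 y2 y3 6 5 2 1 - altN y0 y1 y2 y3 6 5 2 1) +
      (altP y0 y1 y2 y3 6 4 3 1 - altN y0 y1 y2 y3 6 4 3 1) +
      (altP y0 y1 y2 y3 5 4 3 2 - altN y0 y1 y2 y3 5 4 3 2) := by
  unfold altP altN; ring

lemma altPN (a b c e : ℕ) : altP x0 x1 x2 x3 a b c e + altN x0 x1 x2 x3 a b c e = alt a b c e := by
  unfold altP altN
  simp only [mo_eq]
  unfold alt
  ring

lemma alt_perm (a b c e : ℕ) : alt a b c e = alt a c b e ∧ alt a b c e = alt b c a e ∧ alt a b c e = alt a e b c := by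
  unfold alt
  refine ⟨by ring, by ring, by ring⟩

lemma VV_eq : VV = alt 3 2 1 0 := by
  have h := idV x0 x1 x2 x3
  simp only [sub_eq, altPN] at h
  exact h

lemma VR_eq : VV * RR = alt 7 4 2 1 + alt 6 5 2 1 + alt 6 4 3 1 + alt 5 4 3 2 := by
  have h := idR x0 x1 x2 x3
  simp only [sub_eq, altPN] at h
  rw [VV_eq]
  exact h

def pmA (σ : Equiv.Perm (Fin 4)) : (Fin 4 → ℤ) →+ (Fin 4 → ℤ) where
  toFun z := z ∘ σ
  map_zero' := rfl
  map_add' _ _ := rfl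

def ER (σ : Equiv.Perm (Fin 4)) : KA →+* KA := AddMonoidAlgebra.mapDomainRingHom F2 (pmA σ)

lemma ER_co (σ : Equiv.Perm (Fin 4)) {p : KA} (h : ER σ p = p) (z : Fin 4 → ℤ) : p.coeff (z ∘ σ) = p.coeff z := by
  have hinj : Function.Injective (pmA σ) := fun z w h => by
    funext i
    have := congrFun h (σ.symm i)
    simpa [pmA] using this
  have := congrArg (fun q => q.coeff (z ∘ σ)) h
  refine this.symm.trans ?_
  exact Finsupp.mapDomain_apply hinj p.coeff z

lemma ER_mo (σ : Equiv.Perm (Fin 4)) (a b c e a' b' c' e' : ℤ) (h : ![a, b, c, e] ∘ σ = ![a', b', c', e']) :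
    ER σ (mo a b c e) = mo a' b' c' e' := by
  unfold ER mo
  rw [← h]
  simp [pmA]

def t01 : Equiv.Perm (Fin 4) := Equiv.swap 0 1
def t12 : Equiv.Perm (Fin 4) := Equiv.swap 1 2
def t23 : Equiv.Perm (Fin 4) := Equiv.swap 2 3

lemma t01v (a b c e : ℤ) : ![a, b, c, e] ∘ t01 = ![b, a, c, e] := by
  ext i; fin_cases i <;> rfl
lemma t12v (a b c e : ℤ) : ![a, b, c, e] ∘ t12 = ![a, c, b, e] := by
  ext i; fin_cases i <;> rfl
lemma t23v (a b c e : ℤ) : ![a, b, c, e] ∘ t23 = ![a, b, e, c] := by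
  ext i; fin_cases i <;> rfl

lemma E01 : ER t01 x0 = x1 ∧ ER t01 x1 = x0 ∧ ER t01 x2 = x2 ∧ ER t01 x3 = x3 :=
  ⟨ER_mo _ _ _ _ _ _ _ _ _ (t01v ..), ER_mo _ _ _ _ _ _ _ _ _ (t01v ..), ER_mo _ _ _ _ _ _ _ _ _ (t01v ..),
    ER_mo _ _ _ _ _ _ _ _ _ (t01v ..)⟩
lemma E12 : ER t12 x0 = x0 ∧ ER t12 x1 = x2 ∧ ER t12 x2 = x1 ∧ ER t12 x3 = x3 :=
  ⟨ER_mo _ _ _ _ _ _ _ _ _ (t12v ..), ER_mo _ _ _ _ _ _ _ _ _ (t12v ..), ER_mo _ _ _ _ _ _ _ _ _ (t12v ..),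
    ER_mo _ _ _ _ _ _ _ _ _ (t12v ..)⟩
lemma E23 : ER t23 x0 = x0 ∧ ER t23 x1 = x1 ∧ ER t23 x2 = x3 ∧ ER t23 x3 = x2 :=
  ⟨ER_mo _ _ _ _ _ _ _ _ _ (t23v ..), ER_mo _ _ _ _ _ _ _ _ _ (t23v ..), ER_mo _ _ _ _ _ _ _ _ _ (t23v ..),
    ER_mo _ _ _ _ _ _ _ _ _ (t23v ..)⟩

lemma VV01 : ER t01 VV = VV := by
  obtain ⟨h0, h1, h2, h3⟩ := E01
  simp only [VV, map_mul, map_add, h0, h1, h2, h3]; ring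
lemma VV12 : ER t12 VV = VV := by
  obtain ⟨h0, h1, h2, h3⟩ := E12
  simp only [VV, map_mul, map_add, h0, h1, h2, h3]; ring
lemma VV23 : ER t23 VV = VV := by
  obtain ⟨h0, h1, h2, h3⟩ := E23
  simp only [VV, map_mul, map_add, h0, h1, h2, h3]; ring
lemma RR01 : ER t01 RR = RR := by
  obtain ⟨h0, h1, h2, h3⟩ := E01
  simp only [RR, map_mul, map_add, h0, h1, h2, h3]; ring
lemma RR12 : ER t12 RR = RR := by
  obtain ⟨h0, h1, h2, h3⟩ := E12
  simp only [RR, map_mul, map_add, h0, h1, h2, h3]; ring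
lemma RR23 : ER t23 RR = RR := by
  obtain ⟨h0, h1, h2, h3⟩ := E23
  simp only [RR, map_mul, map_add, h0, h1, h2, h3]; ring

/-- symmetric and vanishing on repeated exponents -/
structure Al (p : KA) : Prop where
  s01 : ∀ a b c e, co p b a c e = co p a b c e
  s12 : ∀ a b c e, co p a c b e = co p a b c e
  s23 : ∀ a b c e, co p a b e c = co p a b c e
  z01 : ∀ a c e, co p a a c e = 0

lemma Al.z02 {p} (h : Al p) (a b e) : co p a b a e = 0 := by rw [← h.s12]; exact h.z01 _ _ _
lemma Al.z12 {p} (h : Al p) (a b e) : co p b a a e = 0 := by rw [← h.s01]; exact h.z02 _ _ _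
lemma Al.z03 {p} (h : Al p) (a b e) : co p a b e a = 0 := by rw [← h.s23]; exact h.z02 _ _ _
lemma Al.z13 {p} (h : Al p) (a b e) : co p b a e a = 0 := by rw [← h.s23]; exact h.z12 _ _ _
lemma Al.z23 {p} (h : Al p) (a b e) : co p b e a a = 0 := by rw [← h.s12]; exact h.z13 _ _ _

def gp (i j : ℕ) : KA := VV ^ (i + 1) * RR ^ j

lemma gp_Al (i j : ℕ) : Al (gp i j) := by
  have h1 : ER t01 (gp i j) = gp i j := by unfold gp; simp only [map_mul, map_pow, VV01, RR01]
  have h2 : ER t12 (gp i j) = gp i j := by unfold gp; simp only [map_mul, map_pow, VV12, RR12]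
  have h3 : ER t23 (gp i j) = gp i j := by unfold gp; simp only [map_mul, map_pow, VV23, RR23]
  refine ⟨fun a b c e => ?_, fun a b c e => ?_, fun a b c e => ?_, fun a c e => ?_⟩
  · unfold co; rw [← t01v]; exact ER_co _ h1 _
  · unfold co; rw [← t12v]; exact ER_co _ h2 _
  · unfold co; rw [← t23v]; exact ER_co _ h3 _
  · set k : KA := ((x0 + x2) * (x0 + x3) * (x1 + x2) * (x1 + x3) * (x2 + x3)) * (VV ^ i * RR ^ j) with hk
    have e1 : gp i j = x0 * k + x1 * k := by
      rw [hk]; unfold gp; rw [pow_succ]; nth_rewrite 2 [VV]; ring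
    have e2 : ER t01 k = k := by
      obtain ⟨h0, h1, h2, h3⟩ := E01
      rw [hk]
      simp only [map_mul, map_pow, VV01, RR01, map_add, h0, h1, h2, h3]; ring
    rw [e1, co_add, x0, x1, co_mo_mul, co_mo_mul]
    have e3 : co k (a - 0) (a - 1) (c - 0) (e - 0) = co k (a - 1) (a - 0) (c - 0) (e - 0) := by
      unfold co; rw [← t01v]; exact ER_co _ e2 _
    rw [e3]
    exact CharTwo.add_self_eq_zero _

theorem parity (q : ℕ) : ∀ t : ℕ, 1 ≤ t → t ≤ 2 ^ q → ∀ d : ℤ, d = 7 * 2 ^ q - 2 * t →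
    co (gp (2 ^ (q + 1) - 2) (2 ^ (q + 1) - t)) (d - 3) (d - 2) (d - 1) d = 1 := by
  induction q with
  | zero =>
    intro t h1 h2 d hd
    obtain rfl : t = 1 := by simp at h2; omega
    have : d = 5 := by rw [hd]; norm_num
    subst this
    have : gp (2 ^ (0 + 1) - 2) (2 ^ (0 + 1) - 1) = VV * RR := by unfold gp; norm_num
    rw [this, VR_eq]
    unfold alt
    simp only [co_add, co_mo]
    norm_num
  | succ q ih =>
    intro t h1 h2 d hd
    have hQ : 1 ≤ 2 ^ q := Nat.one_le_two_pow
    rcases Nat.even_or_odd' t with ⟨s, rfl | rfl⟩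
    · have hs := ih s (by omega) (by rw [pow_succ] at h2; omega) (d := 7 * 2 ^ q - 2 * s) rfl
      set D : ℤ := 7 * 2 ^ q - 2 * s with hD
      have hd2 : d = 2 * D := by rw [hd, hD]; push_cast; ring
      have e : gp (2 ^ (q + 1 + 1) - 2) (2 ^ (q + 1 + 1) - 2 * s) = VV * gp (2 ^ (q + 1) - 2) (2 ^ (q + 1) - s) ^ 2 := by
        unfold gp
        have a1 : 2 ^ (q + 1 + 1) - 2 + 1 = 1 + 2 * (2 ^ (q + 1) - 2 + 1) := by
          rw [pow_succ 2 (q+1), pow_succ]; omega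
        have a2 : 2 ^ (q + 1 + 1) - 2 * s = 2 * (2 ^ (q + 1) - s) := by
          rw [pow_succ 2 (q+1), pow_succ]; omega
        rw [a1, a2, pow_add, pow_mul, pow_mul]; ring
      have hal := gp_Al (2 ^ (q + 1) - 2) (2 ^ (q + 1) - s)
      rw [e, VV_eq]
      set p := gp (2 ^ (q + 1) - 2) (2 ^ (q + 1) - s)
      have k := alt_sq p 1 0 1 0 (D - 2) (D - 1) (D - 1) D
      have al : alt (2 * 1 + 1) (2 * 0 + 1) (2 * 1) (2 * 0) = alt 3 2 1 0 := (alt_perm 3 1 2 0).1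
      rw [al] at k
      rw [show d - 3 = 2 * (D - 2) + 1 by omega, show d - 2 = 2 * (D - 1) by omega,
        show d - 1 = 2 * (D - 1) + 1 by omega, show d = 2 * D by omega, k]
      push_cast
      rw [show D - 2 - 1 = D - 3 by ring, show D - 1 - 1 = D - 2 by ring, sub_zero, sub_zero, sub_zero, hs,
        hal.z12, hal.z01, hal.z02]
      rfl
    · have hs := ih (s + 1) (by omega) (by rw [pow_succ] at h2; omega) (d := 7 * 2 ^ q - 2 * (s + 1 : ℕ)) rfl
      set D : ℤ := 7 * 2 ^ q - 2 * (s + 1 : ℕ) with hD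
      have hd2 : d = 2 * (D + 1) := by rw [hd, hD]; push_cast; ring
      have e : gp (2 ^ (q + 1 + 1) - 2) (2 ^ (q + 1 + 1) - (2 * s + 1)) =
          (VV * RR) * gp (2 ^ (q + 1) - 2) (2 ^ (q + 1) - (s + 1)) ^ 2 := by
        unfold gp
        have a1 : 2 ^ (q + 1 + 1) - 2 + 1 = 1 + 2 * (2 ^ (q + 1) - 2 + 1) := by
          rw [pow_succ 2 (q+1), pow_succ]; omega
        have a2 : 2 ^ (q + 1 + 1) - (2 * s + 1) = 1 + 2 * (2 ^ (q + 1) - (s + 1)) := by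
          rw [pow_succ 2 (q+1)]; rw [pow_succ] at h2 ⊢; omega
        rw [a1, a2]
        generalize 2 ^ (q + 1) - 2 + 1 = A
        generalize 2 ^ (q + 1) - (s + 1) = B
        ring
      have hal := gp_Al (2 ^ (q + 1) - 2) (2 ^ (q + 1) - (s + 1))
      rw [e, VR_eq]
      set p := gp (2 ^ (q + 1) - 2) (2 ^ (q + 1) - (s + 1))
      have k1 := alt_sq p 3 0 2 1 (D - 1) D D (D + 1)
      have k2 := alt_sq p 2 0 3 1 (D - 1) D D (D + 1)
      have k3 := alt_sq p 1 0 3 2 (D - 1) D D (D + 1)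
      have k4 := alt_sq p 2 1 2 1 (D - 1) D D (D + 1)
      have al1 : alt (2 * 3 + 1) (2 * 0 + 1) (2 * 2) (2 * 1) = alt 7 4 2 1 := by unfold alt; norm_num; ring
      have al2 : alt (2 * 2 + 1) (2 * 0 + 1) (2 * 3) (2 * 1) = alt 6 5 2 1 := by unfold alt; norm_num; ring
      have al3 : alt (2 * 1 + 1) (2 * 0 + 1) (2 * 3) (2 * 2) = alt 6 4 3 1 := by unfold alt; norm_num; ring
      have al4 : alt (2 * 2 + 1) (2 * 1 + 1) (2 * 2) (2 * 1) = alt 5 4 3 2 := by unfold alt; norm_num; ring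
      rw [al1] at k1
      rw [al2] at k2
      rw [al3] at k3
      rw [al4] at k4
      rw [show d - 3 = 2 * (D - 1) + 1 by omega, show d - 2 = 2 * D by omega,
        show d - 1 = 2 * D + 1 by omega, show d = 2 * (D + 1) by omega]
      simp only [add_mul, co_add]
      rw [k1, k2, k3, k4]
      push_cast
      rw [show D - 1 - 3 = D - 4 by ring, show D + 1 - 1 = D by ring, sub_zero, sub_zero,
        show D + 1 - 2 = D - 1 by ring, show D - 1 - 2 = D - 3 by ring, show D + 1 - 3 = D - 2 by ring,
        show D - 1 - 1 = D - 2 by ring]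
      simp only [hal.z01, hal.z02, hal.z03, hal.z12, hal.z13, hal.z23, zero_add, add_zero]
      have p1 : co p (D - 1) (D - 2) (D - 3) D = 1 :=
        (hal.s01 _ _ _ _).trans ((hal.s12 _ _ _ _).trans ((hal.s01 _ _ _ _).trans hs))
      have p2 : co p (D - 3) (D - 1) D (D - 2) = 1 :=
        (hal.s23 _ _ _ _).trans ((hal.s12 _ _ _ _).trans hs)
      have p3 : co p (D - 1) (D - 3) (D - 2) D = 1 :=
        (hal.s01 _ _ _ _).trans ((hal.s12 _ _ _ _).trans hs)
      have p4 : co p (D - 2) (D - 3) D (D - 1) = 1 :=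
        (hal.s01 _ _ _ _).trans ((hal.s23 _ _ _ _).trans hs)
      rw [p1, p2, p3, p4, hs]
      decide

theorem parity' (q t : ℕ) (h1 : 1 ≤ t) (h2 : t ≤ 2 ^ q) (d : ℤ) (hd : d = 7 * 2 ^ q - 2 * t) :
    co (x0 * x2 * x3 * ((x0 + x2) * (x0 + x3) * (x1 + x2)) *
      gp (2 ^ (q + 1) - 2) (2 ^ (q + 1) - t)) d d d d = 1 := by
  have hs := parity q t h1 h2 d hd
  have hal := gp_Al (2 ^ (q + 1) - 2) (2 ^ (q + 1) - t)
  set p := gp (2 ^ (q + 1) - 2) (2 ^ (q + 1) - t)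
  have e : x0 * x2 * x3 * ((x0 + x2) * (x0 + x3) * (x1 + x2)) * p =
      mo 3 1 1 1 * p + mo 3 0 2 1 * p + mo 2 1 1 2 * p + mo 2 0 2 2 * p +
      mo 2 1 2 1 * p + mo 2 0 3 1 * p + mo 1 1 2 2 * p + mo 1 0 3 2 * p := by
    have k := fun a b c e : ℕ => (mo_eq a b c e).symm
    have k1 := k 3 1 1 1
    have k2 := k 3 0 2 1
    have k3 := k 2 1 1 2
    have k4 := k 2 0 2 2
    have k5 := k 2 1 2 1
    have k6 := k 2 0 3 1
    have k7 := k 1 1 2 2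
    have k8 := k 1 0 3 2
    push_cast at k1 k2 k3 k4 k5 k6 k7 k8
    rw [k1, k2, k3, k4, k5, k6, k7, k8]
    ring
  rw [e]
  simp only [co_add, co_mo_mul]
  simp only [hal.z01, hal.z02, hal.z03, hal.z12, hal.z13, hal.z23, zero_add, add_zero, sub_zero]
  have p2 : co p (d - 3) d (d - 2) (d - 1) = 1 :=
    (hal.s12 _ _ _ _).trans ((hal.s23 _ _ _ _).trans hs)
  have p3 : co p (d - 2) d (d - 3) (d - 1) = 1 :=
    (hal.s12 _ _ _ _).trans ((hal.s01 _ _ _ _).trans ((hal.s23 _ _ _ _).trans hs))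
  have p4 : co p (d - 1) d (d - 3) (d - 2) = 1 :=
    (hal.s12 _ _ _ _).trans ((hal.s01 _ _ _ _).trans ((hal.s23 _ _ _ _).trans ((hal.s12 _ _ _ _).trans hs)))
  rw [p2, p3, p4]
  decide

def xx (i : Fin 4) : KA := AddMonoidAlgebra.single (Pi.single i 1) 1

lemma xx0 : xx 0 = x0 := by unfold xx x0 mo; congr 1; ext i; fin_cases i <;> rfl
lemma xx1 : xx 1 = x1 := by unfold xx x1 mo; congr 1; ext i; fin_cases i <;> rfl
lemma xx2 : xx 2 = x2 := by unfold xx x2 mo; congr 1; ext i; fin_cases i <;> rfl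
lemma xx3 : xx 3 = x3 := by unfold xx x3 mo; congr 1; ext i; fin_cases i <;> rfl

def lf (a : Lab) : KA := ∑ i ∈ a.1, xx i

def PL (R : List Lab) : KA := (R.map lf).prod

lemma PL_cons (a : Lab) (R : List Lab) (z : Fin 4 → ℤ) :
    (PL (a :: R)).coeff z = ∑ i ∈ a.1, (PL R).coeff (z - Pi.single i 1) := by
  unfold PL
  rw [List.map_cons, List.prod_cons, lf, Finset.sum_mul, AddMonoidAlgebra.coeff_sum, Finsupp.finset_sum_apply]
  refine Finset.sum_congr rfl fun i _ => ?_
  unfold xx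
  rw [AddMonoidAlgebra.coeff_single_mul_apply, one_mul]
  congr 1
  abel

lemma PL_neg (R : List Lab) : ∀ (z : Fin 4 → ℤ) (i : Fin 4), z i < 0 → (PL R).coeff z = 0 := by
  induction R with
  | nil =>
    intro z i hz
    simp only [PL, List.map_nil, List.prod_nil, AddMonoidAlgebra.one_def, AddMonoidAlgebra.coeff_single,
      Finsupp.single_apply]
    rw [if_neg]
    rintro rfl
    simp at hz
  | cons a R ih =>
    intro z i hz
    rw [PL_cons]
    refine Finset.sum_eq_zero fun j _ => ih _ i ?_
    have : 0 ≤ (Pi.single j 1 : Fin 4 → ℤ) i := by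
      by_cases h : i = j
      · subst h; simp
      · simp [h]
    simp only [Pi.sub_apply]
    omega

lemma Cf_PL (R : List Lab) : ∀ D : Fin 4 → ℕ, Cf R D = (PL R).coeff (fun i => (D i : ℤ)) := by
  induction R with
  | nil =>
    intro D
    simp only [PL, List.map_nil, List.prod_nil, AddMonoidAlgebra.one_def, AddMonoidAlgebra.coeff_single,
      Finsupp.single_apply, Cf]
    congr 1
    simp only [funext_iff, eq_iff_iff]
    refine forall_congr' fun i => ?_
    simp [eq_comm]
  | cons a R ih =>
    intro D
    rw [PL_cons, Cf]
    refine Finset.sum_congr rfl fun i _ => ?_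
    split_ifs with h
    · rw [ih]
      congr 1
      funext j
      unfold low
      by_cases hj : j = i
      · subst hj; simp; omega
      · simp [hj]
    · refine (PL_neg R _ i ?_).symm
      simp; omega
end KA
end EQ


namespace EQ
open Finset

def prs : Finset (Finset (Fin 4)) := powersetCard 2 univ
def sts : Finset (Finset (Fin 4)) := powersetCard 1 univ ∪ powersetCard 3 univ

def RsA : Finset Lab := {({0, 2}, 0), ({0, 3}, 0), ({1, 2}, 0)}
def Rs (K m : ℕ) : Finset Lab := RsA ∪ (prs ×ˢ Icc 1 K ∪ sts ×ˢ range m)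

def RL (K m : ℕ) : List Lab := (Rs K m).toList

lemma mem_RsA {l : Lab} : l ∈ RsA ↔ l.2 = 0 ∧ l.1.card = 2 ∧ l.1 ≠ {0, 1} ∧ l.1 ≠ {2, 3} ∧ l.1 ≠ {1, 3} := by
  obtain ⟨a, k⟩ := l
  have : ∀ a : Finset (Fin 4), (a = {0, 2} ∨ a = {0, 3} ∨ a = {1, 2}) ↔
    (a.card = 2 ∧ a ≠ {0, 1} ∧ a ≠ {2, 3} ∧ a ≠ {1, 3}) := by decide
  unfold RsA
  simp only [Finset.mem_insert, Finset.mem_singleton, Prod.mk.injEq]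
  rw [← this]
  tauto

lemma mem_RL {K m : ℕ} {l : Lab} : l ∈ RL K m ↔
    (l.2 = 0 ∧ l.1.card = 2 ∧ l.1 ≠ {0, 1} ∧ l.1 ≠ {2, 3} ∧ l.1 ≠ {1, 3}) ∨
    (l.1.card = 2 ∧ 1 ≤ l.2 ∧ l.2 ≤ K) ∨ ((l.1.card = 1 ∨ l.1.card = 3) ∧ l.2 < m) := by
  unfold RL Rs
  rw [Finset.mem_toList, Finset.mem_union, mem_RsA]
  simp [prs, sts, Finset.mem_powersetCard]
  tauto

lemma RL_nodup (K m : ℕ) : (L01 :: L23 :: L13 :: RL K m).Nodup := by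
  have h : (RL K m).Nodup := Finset.nodup_toList _
  have h1 : L01 ∉ RL K m := by rw [mem_RL]; simp [L01]
  have h2 : L23 ∉ RL K m := by rw [mem_RL]; simp [L23]
  have h3 : L13 ∉ RL K m := by rw [mem_RL]; simp [L13]
  have e1 : L01 ≠ L23 := by unfold L01 L23; decide
  have e2 : L01 ≠ L13 := by unfold L01 L13; decide
  have e3 : L23 ≠ L13 := by unfold L23 L13; decide
  simp [h, h1, h2, h3, e1, e2, e3]

lemma mem_full {K m : ℕ} {l : Lab} : l ∈ (L01 :: L23 :: L13 :: RL K m) ↔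
    (l.1.card = 2 ∧ l.2 ≤ K) ∨ ((l.1.card = 1 ∨ l.1.card = 3) ∧ l.2 < m) := by
  obtain ⟨a, k⟩ := l
  simp only [List.mem_cons, mem_RL, L01, L23, L13, Prod.mk.injEq]
  by_cases h1 : a = {0, 1}
  · subst h1; simp; omega
  by_cases h2 : a = {2, 3}
  · subst h2; simp; omega
  by_cases h3 : a = {1, 3}
  · subst h3; simp; omega
  simp [h1, h2, h3]
  omega

lemma lm_card (σ) (l : Lab) : (lm σ l).1.card = l.1.card := by simp [lm]

lemma RL_cl (K m : ℕ) : ∀ σ, PS σ → ∀ l ∈ (L13 :: RL K m), lm σ l ∈ (L13 :: RL K m) := by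
  intro σ hσ l hl
  have key : ∀ l : Lab, l ∈ (L13 :: RL K m) ↔ (l.2 = 0 ∧ l.1.card = 2 ∧ l.1 ≠ {0, 1} ∧ l.1 ≠ {2, 3}) ∨
    (l.1.card = 2 ∧ 1 ≤ l.2 ∧ l.2 ≤ K) ∨ ((l.1.card = 1 ∨ l.1.card = 3) ∧ l.2 < m) := by
    rintro ⟨a, k⟩
    simp only [List.mem_cons, mem_RL, L13, Prod.mk.injEq]
    by_cases h3 : a = {1, 3}
    · subst h3
      have e1 : ({1, 3} : Finset (Fin 4)) ≠ {0, 1} := by decide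
      have e2 : ({1, 3} : Finset (Fin 4)) ≠ {2, 3} := by decide
      simp [e1, e2]
    · simp [h3]
  rw [key] at hl ⊢
  rw [lm_card]
  have h2 : (lm σ l).2 = l.2 := rfl
  rw [h2]
  have h3 : ∀ a : Finset (Fin 4), (a ≠ {0, 1} ∧ a ≠ {2, 3}) →
      (a.map σ.toEmbedding ≠ {0, 1} ∧ a.map σ.toEmbedding ≠ {2, 3}) := by
    rcases hσ with rfl | rfl | rfl <;> decide
  have h4 := h3 l.1
  have h5 : (lm σ l).1 = l.1.map σ.toEmbedding := rfl
  rw [h5]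
  tauto

lemma RL_clt (K m : ℕ) : ∀ l ∈ RL K m, lm tau l ∈ RL K m := by
  intro l hl
  rw [mem_RL] at hl ⊢
  rw [lm_card]
  have h2 : (lm tau l).2 = l.2 := rfl
  rw [h2]
  have h3 : ∀ a : Finset (Fin 4), (a ≠ {0, 1} ∧ a ≠ {2, 3} ∧ a ≠ {1, 3}) →
      (a.map tau.toEmbedding ≠ {0, 1} ∧ a.map tau.toEmbedding ≠ {2, 3} ∧ a.map tau.toEmbedding ≠ {1, 3}) := by
    decide
  have h4 := h3 l.1
  have h5 : (lm tau l).1 = l.1.map tau.toEmbedding := rfl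
  rw [h5]
  tauto

namespace KA

lemma PL_RL (K m : ℕ) : PL (RL K m) = (x0 + x2) * (x0 + x3) * (x1 + x2) * (VV ^ K * RR ^ m) := by
  have hl : ∀ a k, lf (a, k) = ∑ i ∈ a, xx i := fun a k => rfl
  unfold PL RL
  rw [Finset.prod_map_toList, Rs, Finset.prod_union, Finset.prod_union, Finset.prod_product, Finset.prod_product]
  · congr 1
    · unfold RsA
      rw [Finset.prod_insert (by decide), Finset.prod_insert (by decide), Finset.prod_singleton]
      simp only [hl]
      rw [Finset.sum_pair (by decide), Finset.sum_pair (by decide), Finset.sum_pair (by decide), xx0, xx1, xx2, xx3]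
      ring
    · congr 1
      · simp only [hl, Finset.prod_const, Nat.card_Icc, Nat.add_sub_cancel]
        rw [Finset.prod_pow]
        congr 1
        have : prs = {{0,1},{0,2},{0,3},{1,2},{1,3},{2,3}} := by decide
        rw [this]
        rw [Finset.prod_insert (by decide), Finset.prod_insert (by decide), Finset.prod_insert (by decide),
          Finset.prod_insert (by decide), Finset.prod_insert (by decide), Finset.prod_singleton]
        rw [Finset.sum_pair (by decide), Finset.sum_pair (by decide), Finset.sum_pair (by decide),
          Finset.sum_pair (by decide), Finset.sum_pair (by decide), Finset.sum_pair (by decide), xx0, xx1, xx2, xx3]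
        unfold VV
        ring
      · simp only [hl, Finset.prod_const, Finset.card_range]
        rw [Finset.prod_pow]
        congr 1
        have : sts = {{0},{1},{2},{3},{1,2,3},{0,2,3},{0,1,3},{0,1,2}} := by decide
        rw [this]
        rw [Finset.prod_insert (by decide), Finset.prod_insert (by decide), Finset.prod_insert (by decide),
          Finset.prod_insert (by decide), Finset.prod_insert (by decide), Finset.prod_insert (by decide),
          Finset.prod_insert (by decide), Finset.prod_singleton]
        have h3 : ∀ a b c : Fin 4, a ≠ b → a ≠ c → b ≠ c → ∑ i ∈ ({a, b, c} : Finset (Fin 4)), xx i = xx a + xx b + xx c := by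
          intro a b c h1 h2 h3
          rw [Finset.sum_insert (by simp [h1, h2]), Finset.sum_pair h3, add_assoc]
        rw [h3 _ _ _ (by decide) (by decide) (by decide), h3 _ _ _ (by decide) (by decide) (by decide),
          h3 _ _ _ (by decide) (by decide) (by decide), h3 _ _ _ (by decide) (by decide) (by decide)]
        simp only [Finset.sum_singleton, xx0, xx1, xx2, xx3]
        unfold RR
        ring
  · rw [Finset.disjoint_left]
    rintro ⟨a, k⟩ h1 h2
    simp [prs, sts, Finset.mem_powersetCard] at h1 h2
    omega
  · rw [Finset.disjoint_left]
    rintro ⟨a, k⟩ h1 h2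
    rw [mem_RsA] at h1
    simp [prs, sts, Finset.mem_powersetCard] at h1 h2
    omega

theorem Cf_one (q t : ℕ) (h1 : 1 ≤ t) (h2 : t ≤ 2 ^ q) (d : ℕ) (hd : d = 7 * 2 ^ q - 2 * t) :
    Cf (({0}, 0) :: ({2}, 0) :: ({3}, 0) :: RL (2 ^ (q + 1) - 1) (2 ^ (q + 1) - t)) (cD d) = 1 := by
  have hp := parity' q t h1 h2 (d : ℤ) (by rw [hd]; rw [Nat.cast_sub (by omega)]; push_cast; ring)
  rw [Cf_PL, ← hp]
  unfold co
  have e : PL (({0}, 0) :: ({2}, 0) :: ({3}, 0) :: RL (2 ^ (q + 1) - 1) (2 ^ (q + 1) - t)) =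
    x0 * x2 * x3 * ((x0 + x2) * (x0 + x3) * (x1 + x2)) * gp (2 ^ (q + 1) - 2) (2 ^ (q + 1) - t) := by
    have : ∀ (a : Lab) R, PL (a :: R) = lf a * PL R := fun a R => by simp [PL]
    rw [this, this, this, PL_RL]
    have hK : 2 ^ (q + 1) - 1 = 2 ^ (q + 1) - 2 + 1 := by
      have : 1 ≤ 2 ^ q := Nat.one_le_two_pow
      rw [pow_succ]; omega
    simp only [lf, Finset.sum_singleton, xx0, xx2, xx3, gp, hK]
    ring
  rw [e]
  congr 1
  funext i; fin_cases i <;> simp [cD]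

end KA

theorem no_setup (q t : ℕ) (h1 : 1 ≤ t) (h2 : t ≤ 2 ^ q) (d : ℕ) (hd : d = 7 * 2 ^ q - 2 * t)
    (M : ℤ) (F : Lab → V d → ℝ) (H : Setup M F (RL (2 ^ (q + 1) - 1) (2 ^ (q + 1) - t))) : False := by
  have h := H.result
  rw [KA.Cf_one q t h1 h2 d hd] at h
  exact absurd h (by decide)

end EQ


namespace EQ
open Finset

variable {d : ℕ}

lemma exists_nonroot {K ι : Type*} [Fintype ι] (P : ι → MvPolynomial K ℝ) (hP : ∀ i, P i ≠ 0) {ε : ℝ} (hε : 0 < ε) :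
    ∃ x : K → ℝ, (∀ k, |x k| < ε) ∧ ∀ i, MvPolynomial.eval x (P i) ≠ 0 := by
  by_contra hcon
  push Not at hcon
  have h : (∏ i, P i) = 0 := by
    refine MvPolynomial.funext_set (fun _ : K => Set.Ioo (-ε) ε) (fun _ => Set.Ioo_infinite (by linarith)) ?_
    intro x hx
    obtain ⟨i, hi⟩ := hcon x fun k => abs_lt.mpr (hx k trivial)
    rw [map_prod, map_zero]
    exact Finset.prod_eq_zero (Finset.mem_univ i) hi
  rw [Finset.prod_eq_zero_iff] at h
  obtain ⟨i, _, hi⟩ := h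
  exact hP i hi

/-- signs of blocks -/
def es (i : Fin 4) (v : V d) : ℝ := if ∀ r, v (i, r) = 0 then 0 else if g i v = 1 then 1 else -1

def el (l : Lab) (v : V d) : ℝ := ∏ i ∈ l.1, es i v

abbrev Key (d : ℕ) := ℕ × Finset (Fin (d+1) → ℤ) × ℕ × Option (Finset (Fin 4))

open Classical in
def key (l : Lab) (v : V d) : Key d :=
  (dim v, l.1.image (fun k => nb k v), l.2, if Good v then none else some l.1)

lemma dim_ng (k : Fin 4) (v : V d) : dim (ng k v) = dim v := by
  unfold dim
  congr 1
  refine Finset.filter_congr fun c _ => ?_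
  unfold ng
  split_ifs
  · exact odd_neg
  · exact Iff.rfl

lemma dim_pm (σ) (v : V d) : dim (pm σ v) = dim v := by
  unfold dim
  refine Finset.card_bij (fun c _ => (σ c.1, c.2)) ?_ ?_ ?_
  · intro c hc
    exact Finset.mem_filter.mpr ⟨Finset.mem_univ _, (Finset.mem_filter.mp hc).2⟩
  · rintro ⟨a, b⟩ _ ⟨a', b'⟩ _ h
    simpa using h
  · rintro ⟨a, b⟩ h
    refine ⟨(σ.symm a, b), Finset.mem_filter.mpr ⟨Finset.mem_univ _, ?_⟩, by simp⟩
    have := (Finset.mem_filter.mp h).2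
    unfold pm
    simpa using this

lemma es_ng (i k : Fin 4) (v : V d) : es i (ng k v) = (if i = k then -1 else 1) * es i v := by
  unfold es
  by_cases hz : ∀ r, v (i, r) = 0
  · rw [if_pos hz, if_pos, mul_zero]
    intro r
    unfold ng
    split_ifs <;> simp [hz]
  · rw [if_neg hz, if_neg]
    swap
    · intro h
      apply hz
      intro r
      have := h r
      unfold ng at this
      split_ifs at this
      · simpa using this
      · exact this
    by_cases h : i = k
    · subst h
      push Not at hz
      rw [g_ng_same hz, if_pos rfl]
      generalize g i v = x
      have : x = 0 ∨ x = 1 := by revert x; decide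
      rcases this with rfl | rfl
      · rw [if_pos (by decide), if_neg (by decide)]; norm_num
      · rw [if_neg (by decide), if_pos (by decide)]; norm_num
    · rw [g_ng_ne h, if_neg h, one_mul]

lemma es_pm (i : Fin 4) (σ) (v : V d) : es i (pm σ v) = es (σ i) v := by
  unfold es
  rw [g_pm]
  rfl

lemma el_ng (l : Lab) (k : Fin 4) (v : V d) : el l (ng k v) = (if k ∈ l.1 then -1 else 1) * el l v := by
  unfold el
  simp only [es_ng, Finset.prod_mul_distrib]
  congr 1
  rw [Finset.prod_ite_eq' l.1 k]

lemma el_pm (l : Lab) (σ) (v : V d) : el l (pm σ v) = el (lm σ l) v := by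
  unfold el lm
  simp [es_pm]

lemma Good_ng (k : Fin 4) (v : V d) : Good (ng k v) ↔ Good v := by
  unfold Good
  simp only [nb_ng]

lemma key_ng (l : Lab) (k : Fin 4) (v : V d) : key l (ng k v) = key l v := by
  unfold key
  rw [dim_ng]
  simp only [nb_ng]
  congr 3
  by_cases h : Good v
  · rw [if_pos h, if_pos ((Good_ng k v).mpr h)]
  · rw [if_neg h, if_neg (fun h2 => h ((Good_ng k v).mp h2))]

lemma key_pm (l : Lab) (σ) (v : V d) (hv : Good v) : key l (pm σ v) = key (lm σ l) v := by
  unfold key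
  rw [if_pos hv, if_pos (Good.pm.mpr hv), dim_pm]
  simp only [nb_pm, lm]
  congr 2
  rw [Finset.map_eq_image, Finset.image_image]
  rfl

lemma key_inj {l l' : Lab} {v v' : V d} (h : key l v = key l' v') (hd : dim v = dim v' → v = v') :
    l = l' ∧ v = v' := by
  unfold key at h
  simp only [Prod.mk.injEq] at h
  obtain ⟨h1, h2, h3, h4⟩ := h
  have hv := hd h1
  subst hv
  refine ⟨Prod.ext ?_ h3, rfl⟩
  by_cases hg : Good v
  · exact Finset.image_injective hg h2
  · rw [if_neg hg, if_neg hg] at h4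
    exact Option.some_injective _ h4

lemma es_abs (i : Fin 4) (v : V d) : |es i v| ≤ 1 := by
  unfold es; split_ifs <;> simp

lemma el_abs (l : Lab) (v : V d) : |el l v| ≤ 1 := by
  unfold el
  rw [Finset.abs_prod]
  exact Finset.prod_le_one (fun _ _ => abs_nonneg _) (fun i _ => es_abs i v)

lemma el_sq {M : ℤ} (hM : Adm M) (l : Lab) {v : V d} (hv : S M v) : el l v * el l v = 1 := by
  unfold el
  rw [← Finset.prod_mul_distrib]
  refine Finset.prod_eq_one fun i _ => ?_
  have := S.ne hM hv i
  unfold es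
  rw [if_neg (by push Not; exact this)]
  split_ifs <;> norm_num

def entry (f : Lab → V d → ℝ) (l : Lab) (v : V d) : MvPolynomial (Key d) ℝ :=
  MvPolynomial.C (f l v) + MvPolynomial.C (el l v) * MvPolynomial.X (key l v)

lemma entry_eval (f : Lab → V d → ℝ) (l : Lab) (v : V d) (x : Key d → ℝ) :
    MvPolynomial.eval x (entry f l v) = f l v + el l v * x (key l v) := by
  simp [entry]

lemma det_ne {M : ℤ} (hM : Adm M) (f : Lab → V d → ℝ) {r : ℕ} (la : Fin r → Lab) (hla : Function.Injective la)
    (p : Fin r → V d) (hp : ∀ j, S M (p j)) (hd : ∀ i j, dim (p i) = dim (p j) → i = j) :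
    (Matrix.of fun i j => entry f (la i) (p j)).det ≠ 0 := by
  classical
  have hinj : Function.Injective (fun c : Fin r × Fin r => key (la c.1) (p c.2)) := by
    rintro ⟨i, j⟩ ⟨i', j'⟩ h
    simp only at h
    have hj : j = j' := by
      apply hd
      unfold key at h
      simp only [Prod.mk.injEq] at h
      exact h.1
    subst hj
    have := key_inj h (fun _ => rfl)
    rw [hla this.1]
  set x : Key d → ℝ := Function.extend (fun c : Fin r × Fin r => key (la c.1) (p c.2))
    (fun c => el (la c.1) (p c.2) * ((1 : Matrix (Fin r) (Fin r) ℝ) c.1 c.2 - f (la c.1) (p c.2))) 0 with hx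
  intro h0
  have h1 : MvPolynomial.eval x (Matrix.of fun i j => entry f (la i) (p j)).det = 0 := by rw [h0, map_zero]
  rw [RingHom.map_det] at h1
  have h2 : (MvPolynomial.eval x).mapMatrix (Matrix.of fun i j => entry f (la i) (p j)) = 1 := by
    ext i j
    rw [RingHom.mapMatrix_apply, Matrix.map_apply, Matrix.of_apply, entry_eval]
    have := hinj.extend_apply
      (fun c => el (la c.1) (p c.2) * ((1 : Matrix (Fin r) (Fin r) ℝ) c.1 c.2 - f (la c.1) (p c.2))) 0 (i, j)
    simp only at this
    rw [hx, this, ← mul_assoc, el_sq hM _ (hp j)]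
    ring
  rw [h2, Matrix.det_one] at h1
  exact one_ne_zero h1

theorem perturb {M : ℤ} (hM : Adm M) (f : Lab → V d → ℝ)
    (hodd : ∀ l v k, f l (ng k v) = (if k ∈ l.1 then (-1) else 1) * f l v)
    (heqv : ∀ σ l v, f l (pm σ v) = f (lm σ l) v)
    (R : List Lab) (hR : R.Nodup) {ε : ℝ} (hε : 0 < ε) :
    ∃ F : Lab → V d → ℝ, Sys M F R ∧ (∀ σ l v, Good v → F l (pm σ v) = F (lm σ l) v) ∧
      ∀ l v, |F l v - f l v| < ε := by
  classical
  haveI : Finite {v : V d | S M v} := (finite_S M).to_subtype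
  haveI : Fintype {v : V d | S M v} := Fintype.ofFinite _
  set I := Σ r : Fin (R.length + 1), (Fin r.1 → Fin R.length) × (Fin r.1 → {v : V d | S M v}) with hI
  let mat : (i : I) → Matrix (Fin i.1.1) (Fin i.1.1) (MvPolynomial (Key d) ℝ) := fun i =>
    Matrix.of fun a b => entry f (R.get (i.2.1 a)) (i.2.2 b).1
  let ok : I → Prop := fun i => Function.Injective i.2.1 ∧
    ∀ a b, dim (i.2.2 a).1 = dim (i.2.2 b).1 → a = b
  obtain ⟨x, hx1, hx2⟩ := exists_nonroot (fun i : I => if ok i then (mat i).det else 1) (by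
    intro i
    split_ifs with h
    · refine det_ne hM f _ ?_ _ (fun j => (i.2.2 j).2) h.2
      exact (List.nodup_iff_injective_get.mp hR).comp h.1
    · exact one_ne_zero) hε
  have hdet : ∀ r : ℕ, r ≤ R.length → ∀ la : Fin r → Fin R.length, Function.Injective la →
      ∀ p : Fin r → V d, (∀ j, S M (p j)) → (∀ i j, dim (p i) = dim (p j) → i = j) →
      (Matrix.of fun i j => f (R.get (la i)) (p j) + el (R.get (la i)) (p j) * x (key (R.get (la i)) (p j))).det ≠ 0 := by
    intro r hr la hla p hp hd
    have h := hx2 ⟨⟨r, by omega⟩, la, fun j => ⟨p j, hp j⟩⟩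
    rw [if_pos ⟨hla, hd⟩, RingHom.map_det] at h
    convert h using 2
    ext i j
    simp [mat, entry_eval]
  refine ⟨fun l v => f l v + el l v * x (key l v), ⟨?_, ?_, ?_⟩, ?_, ?_⟩
  · intro l v k
    rw [hodd, el_ng, key_ng]
    ring
  · intro v hv l hl
    obtain ⟨n, hn⟩ := List.get_of_mem hl
    have h := hdet 1 (by have := n.2; omega) (fun _ => n) (fun a b _ => Subsingleton.elim a b) (fun _ => v)
      (fun _ => hv) (fun a b _ => Subsingleton.elim a b)
    rw [Matrix.det_fin_one, Matrix.of_apply, hn] at h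
    exact h
  · intro R' hs n v hv hd w hw hE
    by_contra hcon
    set T : Finset ℕ := (range (n+1)).filter fun j => w j ≠ 0 with hT
    have hE' : ∀ l ∈ R', ∑ j ∈ range (n+1), w j * (f l (v j) + el l (v j) * x (key l (v j))) = 0 := hE
    have hTc : T.card ≤ R'.length := by
      exact hw
    have hlen := hs.length_le
    let p : Fin T.card → ℕ := T.orderEmbOfFin rfl
    have hpT : ∀ j, p j ∈ T := fun j => Finset.orderEmbOfFin_mem T rfl j
    have hpn : ∀ j, p j ≤ n := fun j => by
      have := (Finset.mem_filter.mp (hpT j)).1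
      rw [Finset.mem_range] at this; omega
    have hpi : Function.Injective p := (T.orderEmbOfFin rfl).injective
    have hla : ∀ i : Fin T.card, R.length - R'.length + i.1 < R.length := fun i => by
      have := i.2; omega
    have h := hdet T.card (by omega) (fun i => ⟨R.length - R'.length + i.1, hla i⟩) (by
      intro a b hab
      simp only [Fin.mk.injEq] at hab
      exact Fin.ext (by omega)) (fun j => v (p j)) (fun j => hv _ (hpn j)) (by
      intro i j hij
      apply hpi
      rcases lt_trichotomy (p i) (p j) with h | h | h
      · exact absurd hij (hd _ _ h (hpn j)).ne
      · exact h
      · exact absurd hij (hd _ _ h (hpn i)).ne')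
    apply hcon
    have hw0 : (fun j => w (p j)) = 0 := by
      refine Matrix.eq_zero_of_mulVec_eq_zero h ?_
      funext i
      have hi : R.get ⟨R.length - R'.length + i.1, hla i⟩ ∈ R' := by
        obtain ⟨R0, rfl⟩ := hs
        rw [List.get_eq_getElem, List.getElem_append_right (by simp)]
        exact List.getElem_mem _
      have h2 := hE' _ hi
      rw [Pi.zero_apply, ← h2, Matrix.mulVec, dotProduct]
      have h3 : ∀ G : ℕ → ℝ, ∑ j ∈ range (n+1), w j * G j = ∑ j ∈ T, w j * G j := by
        intro G
        symm
        refine Finset.sum_subset (Finset.filter_subset _ _) ?_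
        intro j hj hj2
        have : w j = 0 := by
          by_contra h
          exact hj2 (Finset.mem_filter.mpr ⟨hj, h⟩)
        rw [this, zero_mul]
      rw [h3]
      have h4 : ∀ G : ℕ → ℝ, ∑ j ∈ T, G j = ∑ j, G (p j) := by
        intro G
        have := Finset.sum_map Finset.univ (T.orderEmbOfFin rfl).toEmbedding G
        rw [Finset.map_orderEmbOfFin_univ] at this
        exact this
      rw [h4]
      refine Finset.sum_congr rfl fun j _ => ?_
      rw [Matrix.of_apply, mul_comm]
    intro j hj
    by_contra h
    have hjT : j ∈ T := Finset.mem_filter.mpr ⟨Finset.mem_range.mpr (by omega), h⟩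
    have : j ∈ Set.range (T.orderEmbOfFin rfl) := by rw [Finset.range_orderEmbOfFin]; exact hjT
    obtain ⟨i, rfl⟩ := this
    exact h (congrFun hw0 i)
  · intro σ l v hv
    simp only
    rw [heqv, el_pm, key_pm l σ v hv]
  · intro l v
    simp only [add_sub_cancel_left, abs_mul]
    calc |el l v| * |x (key l v)| ≤ 1 * |x (key l v)| := mul_le_mul_of_nonneg_right (el_abs l v) (abs_nonneg _)
      _ < ε := by rw [one_mul]; exact hx1 _

end EQ


namespace EQ
open Finset

variable {d : ℕ}

abbrev W (d : ℕ) := Fin 4 × Fin (d+1) → ℝ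

def KK (d : ℕ) : Set (W d) := {z | (∀ c, |z c| ≤ 1) ∧ ∀ k, ∃ r, |z (k, r)| = 1}

def DD (d : ℕ) : Set (W d) :=
  {z | ∃ i j : Fin 4, i ≠ j ∧ ((∀ r, z (i, r) = z (j, r)) ∨ (∀ r, z (i, r) = - z (j, r)))}

def ngR (k : Fin 4) (z : W d) : W d := fun c => if c.1 = k then - z c else z c
def pmR (σ : Equiv.Perm (Fin 4)) (z : W d) : W d := fun c => z (σ c.1, c.2)

lemma KK_compact : IsCompact (KK d) := by
  have h1 : IsCompact (Set.pi Set.univ fun _ : Fin 4 × Fin (d+1) => Set.Icc (-1 : ℝ) 1) :=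
    isCompact_univ_pi fun _ => isCompact_Icc
  refine h1.of_isClosed_subset ?_ ?_
  · have : KK d = (⋂ c, {z : W d | |z c| ≤ 1}) ∩ ⋂ k, ⋃ r, {z : W d | |z (k, r)| = 1} := by
      ext z
      simp [KK]
    rw [this]
    refine IsClosed.inter (isClosed_iInter fun c => ?_) (isClosed_iInter fun k => isClosed_iUnion_of_finite fun r => ?_)
    · exact isClosed_le ((continuous_apply c).abs) continuous_const
    · exact isClosed_eq ((continuous_apply _).abs) continuous_const
  · intro z hz c _
    exact abs_le.mp (hz.1 c)

lemma DD_closed : IsClosed (DD d) := by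
  have : DD d = ⋃ i : Fin 4, ⋃ j : Fin 4, ⋃ _ : i ≠ j,
      ((⋂ r, {z : W d | z (i, r) = z (j, r)}) ∪ ⋂ r, {z : W d | z (i, r) = - z (j, r)}) := by
    ext z
    simp [DD]
  rw [this]
  refine isClosed_iUnion_of_finite fun i => isClosed_iUnion_of_finite fun j => isClosed_iUnion_of_finite fun _ => ?_
  refine IsClosed.union (isClosed_iInter fun r => ?_) (isClosed_iInter fun r => ?_)
  · exact isClosed_eq (continuous_apply _) (continuous_apply _)
  · exact isClosed_eq (continuous_apply _) (continuous_apply _).neg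

lemma lower_bound {Z : Set (W d)} (hZ : IsCompact Z) (φ : Lab → W d → ℝ) (s : List Lab)
    (hc : ∀ l ∈ s, ContinuousOn (φ l) Z) (hn : ∀ z ∈ Z, ∃ l ∈ s, φ l z ≠ 0) :
    ∃ δ > 0, ∀ z ∈ Z, ∃ l ∈ s, δ ≤ |φ l z| := by
  set Φ : W d → ({l // l ∈ s.toFinset} → ℝ) := fun z l => φ l.1 z with hΦ
  have hΦc : ContinuousOn Φ Z := continuousOn_pi.mpr fun l => hc l.1 (List.mem_toFinset.mp l.2)
  rcases Z.eq_empty_or_nonempty with rfl | hne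
  · exact ⟨1, one_pos, by simp⟩
  obtain ⟨z0, hz0, hmin⟩ := hZ.exists_isMinOn hne hΦc.norm
  have hpos : 0 < ‖Φ z0‖ := by
    rw [norm_pos_iff]
    intro h
    obtain ⟨l, hl, h2⟩ := hn z0 hz0
    exact h2 (congrFun h ⟨l, List.mem_toFinset.mpr hl⟩)
  refine ⟨‖Φ z0‖, hpos, fun z hz => ?_⟩
  by_contra hcon
  push Not at hcon
  have h1 : ‖Φ z‖ < ‖Φ z0‖ := by
    rw [pi_norm_lt_iff hpos]
    intro l
    exact hcon l.1 (List.mem_toFinset.mp l.2)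
  exact absurd (hmin hz) (not_le.mpr h1)

lemma unif {Z : Set (W d)} (hZ : IsCompact Z) (φ : Lab → W d → ℝ) (s : List Lab)
    (hc : ∀ l ∈ s, ContinuousOn (φ l) Z) {ε : ℝ} (hε : 0 < ε) :
    ∃ η > 0, ∀ z ∈ Z, ∀ z' ∈ Z, dist z z' < η → ∀ l ∈ s, |φ l z - φ l z'| < ε := by
  set Φ : W d → ({l // l ∈ s.toFinset} → ℝ) := fun z l => φ l.1 z with hΦ
  have hΦc : ContinuousOn Φ Z := continuousOn_pi.mpr fun l => hc l.1 (List.mem_toFinset.mp l.2)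
  have hu := hZ.uniformContinuousOn_of_continuous hΦc
  rw [Metric.uniformContinuousOn_iff] at hu
  obtain ⟨η, hη, h⟩ := hu ε hε
  refine ⟨η, hη, fun z hz z' hz' hd l hl => ?_⟩
  have h2 := h z hz z' hz' hd
  rw [dist_pi_lt_iff hε] at h2
  exact h2 ⟨l, List.mem_toFinset.mpr hl⟩

def sc (M : ℤ) (v : V d) : W d := fun c => (v c : ℝ) / M

lemma sc_mem {M : ℤ} (hM : 0 < M) {v : V d} (hv : S M v) : sc M v ∈ KK d := by
  have hM' : (0 : ℝ) < M := by exact_mod_cast hM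
  constructor
  · intro c
    unfold sc
    have h1 : (-M : ℝ) ≤ v c := by exact_mod_cast (hv.1 c).1
    have h2 : (v c : ℝ) ≤ M := by exact_mod_cast (hv.1 c).2
    rw [abs_div, abs_of_pos hM', div_le_one hM', abs_le]
    exact ⟨h1, h2⟩
  · intro k
    obtain ⟨r, hr⟩ := hv.2 k
    refine ⟨r, ?_⟩
    unfold sc
    rcases hr with h | h
    · rw [h, div_self hM'.ne', abs_one]
    · rw [h]; push_cast
      rw [neg_div, div_self hM'.ne', abs_neg, abs_one]

lemma sc_ng (M : ℤ) (k) (v : V d) : sc M (ng k v) = ngR k (sc M v) := by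
  funext c
  unfold sc ngR ng
  split_ifs
  · push_cast; ring
  · rfl

lemma sc_pm (M : ℤ) (σ) (v : V d) : sc M (pm σ v) = pmR σ (sc M v) := rfl

lemma sc_bad (M : ℤ) {v : V d} (hv : ¬ Good v) : sc M v ∈ DD d := by
  unfold Good Function.Injective at hv
  push Not at hv
  obtain ⟨i, j, h, hij⟩ := hv
  refine ⟨i, j, hij, ?_⟩
  have h' : ∀ r, nb i v r = nb j v r := fun r => congrFun h r
  unfold nb at h'
  unfold sc
  by_cases h1 : g i v = 1 <;> by_cases h2 : g j v = 1
  · left; intro r; have := h' r; simp only [h1, h2, if_true] at this; rw [this]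
  · right; intro r; have := h' r; simp only [h1, h2, if_true, if_false] at this; rw [this]; push_cast; ring
  · right; intro r; have := h' r; simp only [h1, h2, if_true, if_false] at this
    have h3 : v (i, r) = - v (j, r) := by omega
    rw [h3]; push_cast; ring
  · left; intro r; have := h' r; simp only [h1, h2, if_false] at this
    have h3 : v (i, r) = v (j, r) := by omega
    rw [h3]

lemma sc_dist {M : ℤ} (hM : 0 < M) {D : Fin 4 → ℕ} {n : ℕ} {v : ℕ → V d} (hv : Chain M D n v)
    {i j : ℕ} (hi : i ≤ n) (hj : j ≤ n) : dist (sc M (v i)) (sc M (v j)) ≤ 1 / M := by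
  have hM' : (0 : ℝ) < M := by exact_mod_cast hM
  wlog hij : i ≤ j generalizing i j
  · rw [dist_comm]; exact this hj hi (by omega)
  obtain ⟨k, rfl⟩ := Nat.exists_eq_add_of_le hij
  rw [dist_pi_le_iff (by positivity)]
  intro c
  rw [Real.dist_eq]
  unfold sc
  rw [← sub_div, abs_div, abs_of_pos hM']
  gcongr
  rcases hv.close c i k hj with h | ⟨_, _, h | h⟩
  · rw [h]; simp
  · rw [h]; push_cast; simp
  · rw [h]; push_cast; simp

theorem topo (q t : ℕ) (h1 : 1 ≤ t) (h2 : t ≤ 2 ^ q) (d : ℕ) (hd : d = 7 * 2 ^ q - 2 * t)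
    (φ : Lab → W d → ℝ)
    (hodd : ∀ l z k, φ l (ngR k z) = (if k ∈ l.1 then (-1) else 1) * φ l z)
    (heqv : ∀ σ l z, φ l (pmR σ z) = φ (lm σ l) z)
    (hc : ∀ l ∈ (L01 :: L23 :: L13 :: RL (2 ^ (q + 1) - 1) (2 ^ (q + 1) - t)), ContinuousOn (φ l) (KK d))
    (hbad : ∀ z ∈ KK d, z ∈ DD d → ∃ l ∈ RL (2 ^ (q + 1) - 1) (2 ^ (q + 1) - t), φ l z ≠ 0) :
    ∃ z ∈ KK d, ∀ l ∈ (L01 :: L23 :: L13 :: RL (2 ^ (q + 1) - 1) (2 ^ (q + 1) - t)), φ l z = 0 := by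
  by_contra hcon
  push Not at hcon
  set R := RL (2 ^ (q + 1) - 1) (2 ^ (q + 1) - t) with hR
  obtain ⟨δ1, hδ1, hl1⟩ := lower_bound KK_compact φ _ hc hcon
  obtain ⟨δ2, hδ2, hl2⟩ := lower_bound (KK_compact.inter_right DD_closed) φ R
    (fun l hl => (hc l (by simp [hl])).mono Set.inter_subset_left) (fun z hz => hbad z hz.1 hz.2)
  set δ := min δ1 δ2 with hδ
  have hδ0 : 0 < δ := lt_min hδ1 hδ2
  obtain ⟨η, hη, hu⟩ := unif KK_compact φ _ hc (show 0 < δ / 3 by positivity)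
  obtain ⟨N, hN⟩ := exists_nat_one_div_lt hη
  set M : ℤ := 2 * (N + 1) with hMdef
  have hM0 : 0 < M := by omega
  have hM : Adm M := ⟨⟨N + 1, by omega⟩, hM0⟩
  have hMη : (1 : ℝ) / M < η := by
    refine lt_of_le_of_lt ?_ hN
    rw [hMdef]; push_cast
    apply one_div_le_one_div_of_le <;> linarith [(Nat.cast_nonneg N : (0:ℝ) ≤ N)]
  obtain ⟨F, hF1, hF2, hF3⟩ := perturb hM (fun l v => φ l (sc M v))
    (fun l v k => by rw [sc_ng, hodd]) (fun σ l v => by rw [sc_pm, heqv])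
    (L01 :: L23 :: L13 :: R) (RL_nodup _ _) (show 0 < δ / 3 by positivity)
  have hCS : ∀ v ∈ X M (cD d) (R.length + 3), ∀ i, i ≤ R.length + 3 → ∀ l ∈ (L01 :: L23 :: L13 :: R),
      δ ≤ |φ l (sc M (v i))| → CS F l (R.length + 3) v := by
    intro v hv i hi l hl hge
    have hch := (mem_X hM).mp hv
    have hcl : ∀ j, j ≤ R.length + 3 → |φ l (sc M (v i)) - φ l (sc M (v j))| < δ / 3 := by
      intro j hj
      exact hu _ (sc_mem hM0 (X_S hM hv hi)) _ (sc_mem hM0 (X_S hM hv hj))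
        ((sc_dist hM0 hch hi hj).trans_lt hMη) l hl
    rcases le_abs.mp hge with h | h
    · left
      intro j hj
      have e1 := abs_lt.mp (hcl j hj)
      have e2 := abs_lt.mp (hF3 l (v j))
      linarith [e1.1, e1.2, e2.1, e2.2]
    · right
      intro j hj
      have e1 := abs_lt.mp (hcl j hj)
      have e2 := abs_lt.mp (hF3 l (v j))
      linarith [e1.1, e1.2, e2.1, e2.2]
  refine no_setup q t h1 h2 d hd M F ⟨hM, hF1, ?_, ?_, ?_, RL_cl _ _, RL_clt _ _⟩
  · intro v hv i hi hg
    obtain ⟨l, hl, hge⟩ := hl2 (sc M (v i)) ⟨sc_mem hM0 (X_S hM hv hi), sc_bad M hg⟩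
    exact ⟨l, hl, hCS v hv i hi l (by simp [hR] at hl ⊢; simp [hl]) ((min_le_right _ _).trans hge)⟩
  · intro v hv
    obtain ⟨l, hl, hge⟩ := hl1 (sc M (v 0)) (sc_mem hM0 (X_S hM hv (Nat.zero_le _)))
    exact ⟨l, hl, hCS v hv 0 (Nat.zero_le _) l hl ((min_le_left _ _).trans hge)⟩
  · intro σ _ l v _ hv
    exact hF2 σ l v hv

end EQ


namespace EQ
open Finset MeasureTheory RealInnerProductSpace

variable {d : ℕ}

abbrev ES (d : ℕ) := EuclideanSpace ℝ (Fin d)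

def na (z : W d) (i : Fin 4) : ES d := WithLp.toLp 2 fun r => z (i, r.castSucc)
def nbb (z : W d) (i : Fin 4) : ℝ := z (i, Fin.last d)
def hh (z : W d) (i : Fin 4) (x : ES d) : ℝ := ⟪na z i, x⟫ - nbb z i

lemma hh_cont_x (z : W d) (i : Fin 4) : Continuous (hh z i) := by
  unfold hh; fun_prop

lemma na_cont (i : Fin 4) : Continuous fun z : W d => na z i := by
  unfold na; fun_prop

lemma hh_cont_z (i : Fin 4) (x : ES d) : Continuous fun z : W d => hh z i x := by
  unfold hh
  have h1 := na_cont (d := d) i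
  have h2 : Continuous fun z : W d => nbb z i := by unfold nbb; fun_prop
  exact (h1.inner continuous_const).sub h2

lemma na_ng (z : W d) (k i : Fin 4) : na (ngR k z) i = (if i = k then (-1 : ℝ) else 1) • na z i := by
  ext r
  unfold na ngR
  by_cases h : i = k <;> simp [h]

lemma hh_ng (z : W d) (k i : Fin 4) (x : ES d) : hh (ngR k z) i x = (if i = k then (-1 : ℝ) else 1) * hh z i x := by
  unfold hh
  rw [na_ng, inner_smul_left]
  have : nbb (ngR k z) i = (if i = k then (-1 : ℝ) else 1) * nbb z i := by
    unfold nbb ngR; by_cases h : i = k <;> simp [h]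
  rw [this]
  by_cases h : i = k
  · simp only [h, if_true]; simp; ring
  · simp only [h, if_false]; simp

lemma hh_pm (z : W d) (σ) (i : Fin 4) (x : ES d) : hh (pmR σ z) i x = hh z (σ i) x := rfl

lemma sign_mul (c x : ℝ) (hc : c = 1 ∨ c = -1) : Real.sign (c * x) = c * Real.sign x := by
  rcases hc with rfl | rfl
  · simp
  · rw [neg_one_mul, neg_one_mul, Real.sign_neg]

lemma sign_meas : Measurable Real.sign := by
  unfold Real.sign
  exact Measurable.ite measurableSet_Iio measurable_const
    (Measurable.ite measurableSet_Ioi measurable_const measurable_const)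

lemma sign_contAt {x : ℝ} (hx : x ≠ 0) : ContinuousAt Real.sign x := by
  rcases lt_or_gt_of_ne hx with h | h
  · refine (continuousAt_const (y := (-1 : ℝ))).congr ?_
    filter_upwards [Iio_mem_nhds h] with y hy
    exact (Real.sign_of_neg hy).symm
  · refine (continuousAt_const (y := (1 : ℝ))).congr ?_
    filter_upwards [Ioi_mem_nhds h] with y hy
    exact (Real.sign_of_pos hy).symm

lemma sign_abs (x : ℝ) : |Real.sign x| ≤ 1 := by
  rcases Real.sign_apply_eq x with h | h | h <;> rw [h] <;> simp

def pr (J : Finset (Fin 4)) (z : W d) (x : ES d) : ℝ := ∏ i ∈ J, Real.sign (hh z i x)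

def II (J : Finset (Fin 4)) (ν : Measure (ES d)) (z : W d) : ℝ := ∫ x, pr J z x ∂ν

lemma pr_meas (J : Finset (Fin 4)) (z : W d) : Measurable (pr J z) := by
  unfold pr
  exact Finset.measurable_prod _ fun i _ => sign_meas.comp (hh_cont_x z i).measurable

lemma pr_abs (J : Finset (Fin 4)) (z : W d) (x : ES d) : |pr J z x| ≤ 1 := by
  unfold pr
  rw [Finset.abs_prod]
  exact Finset.prod_le_one (fun _ _ => abs_nonneg _) fun i _ => sign_abs _

lemma pr_int (J : Finset (Fin 4)) (z : W d) (ν : Measure (ES d)) [IsFiniteMeasure ν] : Integrable (pr J z) ν := by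
  refine Integrable.of_bound (pr_meas J z).aestronglyMeasurable 1 (Filter.Eventually.of_forall fun x => ?_)
  rw [Real.norm_eq_abs]; exact pr_abs J z x

lemma II_ng (J : Finset (Fin 4)) (ν : Measure (ES d)) (z : W d) (k : Fin 4) :
    II J ν (ngR k z) = (if k ∈ J then (-1) else 1) * II J ν z := by
  unfold II
  rw [← integral_const_mul]
  congr 1
  funext x
  unfold pr
  have : ∀ i, Real.sign (hh (ngR k z) i x) = (if i = k then (-1 : ℝ) else 1) * Real.sign (hh z i x) := by
    intro i
    rw [hh_ng, sign_mul]
    split_ifs <;> simp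
  simp only [this, Finset.prod_mul_distrib]
  congr 1
  rw [Finset.prod_ite_eq' J k]

lemma II_pm (J : Finset (Fin 4)) (ν : Measure (ES d)) (z : W d) (σ : Equiv.Perm (Fin 4)) :
    II J ν (pmR σ z) = II (J.map σ.toEmbedding) ν z := by
  unfold II pr
  simp [hh_pm]

lemma hyper_null {a : ES d} {b : ℝ} (h : a ≠ 0 ∨ b ≠ 0) : volume {x : ES d | ⟪a, x⟫ - b = 0} = 0 := by
  rcases Set.eq_empty_or_nonempty {x : ES d | ⟪a, x⟫ - b = 0} with he | ⟨x0, hx0⟩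
  · rw [he, measure_empty]
  have hx0' : ⟪a, x0⟫ = b := sub_eq_zero.mp hx0
  have ha : a ≠ 0 := by
    rintro rfl
    rw [inner_zero_left] at hx0'
    rcases h with h | h
    · exact h rfl
    · exact h hx0'.symm
  set K : Submodule ℝ (ES d) := LinearMap.ker (innerSL ℝ a).toLinearMap with hK
  have hKt : K ≠ ⊤ := by
    intro ht
    have : a ∈ K := by rw [ht]; trivial
    rw [hK, LinearMap.mem_ker] at this
    exact ha (inner_self_eq_zero.mp this)
  have : {x : ES d | ⟪a, x⟫ - b = 0} = (fun x => x + (-x0)) ⁻¹' (K : Set (ES d)) := by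
    ext x
    simp only [Set.mem_setOf_eq, Set.mem_preimage, SetLike.mem_coe, hK, LinearMap.mem_ker]
    change _ ↔ ⟪a, x + -x0⟫ = 0
    rw [inner_add_right, inner_neg_right, hx0']
    rfl
  rw [this, measure_preimage_add_right]
  exact Measure.addHaar_submodule _ K hKt

def nzb (z : W d) : Prop := ∀ i, na z i ≠ 0 ∨ nbb z i ≠ 0

lemma na_zero {z : W d} {i : Fin 4} (h : na z i = 0) (r : Fin d) : z (i, r.castSucc) = 0 := by
  have := congrArg (fun y : ES d => y r) h
  simpa [na] using this

lemma KK_nzb {z : W d} (hz : z ∈ KK d) : nzb z := by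
  intro i
  by_contra hcon
  push Not at hcon
  obtain ⟨r, hr⟩ := hz.2 i
  have : z (i, r) = 0 := by
    refine Fin.lastCases ?_ (fun j => ?_) r
    · exact hcon.2
    · exact na_zero hcon.1 j
  rw [this] at hr
  simp at hr

lemma ae_ne {ν : Measure (ES d)} (hν : ν ≪ volume) {z : W d} (hz : nzb z) : ∀ᵐ x ∂ν, ∀ i, hh z i x ≠ 0 := by
  rw [ae_all_iff]
  intro i
  rw [ae_iff]
  apply hν
  have := hyper_null (hz i)
  simpa [hh] using this

lemma II_cont (J : Finset (Fin 4)) {ν : Measure (ES d)} [IsFiniteMeasure ν] (hν : ν ≪ volume) :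
    ContinuousOn (II J ν) (KK d) := by
  intro z hz
  apply ContinuousAt.continuousWithinAt
  unfold II
  refine continuousAt_of_dominated (bound := fun _ => 1) ?_ ?_ (integrable_const _) ?_
  · exact Filter.Eventually.of_forall fun w => (pr_meas J w).aestronglyMeasurable
  · refine Filter.Eventually.of_forall fun w => Filter.Eventually.of_forall fun x => ?_
    rw [Real.norm_eq_abs]; exact pr_abs J w x
  · filter_upwards [ae_ne hν (KK_nzb hz)] with x hx
    unfold pr
    refine tendsto_finset_prod _ fun i _ => ?_
    exact ContinuousAt.comp (f := fun w => hh w i x) (sign_contAt (hx i)) (hh_cont_z i x).continuousAt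

/-- orthogonality function -/
def OO (J : Finset (Fin 4)) (z : W d) : ℝ := ∑ r : Fin d, ∏ i ∈ J, z (i, r.castSucc)

lemma OO_ng (J : Finset (Fin 4)) (z : W d) (k : Fin 4) :
    OO J (ngR k z) = (if k ∈ J then (-1) else 1) * OO J z := by
  unfold OO
  rw [Finset.mul_sum]
  refine Finset.sum_congr rfl fun r _ => ?_
  have : ∀ i, ngR k z (i, r.castSucc) = (if i = k then (-1 : ℝ) else 1) * z (i, r.castSucc) := by
    intro i; unfold ngR; by_cases h : i = k <;> simp [h]
  simp only [this, Finset.prod_mul_distrib]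
  congr 1
  rw [Finset.prod_ite_eq' J k]

lemma OO_pm (J : Finset (Fin 4)) (z : W d) (σ : Equiv.Perm (Fin 4)) :
    OO J (pmR σ z) = OO (J.map σ.toEmbedding) z := by
  unfold OO
  simp [pmR]

lemma OO_cont (J : Finset (Fin 4)) : Continuous (OO (d := d) J) := by
  unfold OO; fun_prop

lemma OO_pair (z : W d) {i j : Fin 4} (h : i ≠ j) : OO {i, j} z = ⟪na z i, na z j⟫ := by
  unfold OO na
  rw [PiLp.inner_apply]
  refine Finset.sum_congr rfl fun r _ => ?_
  rw [Finset.prod_pair h]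
  simp [mul_comm]

def idx (l : Lab) : ℕ := if l.1.card = 2 ∧ 2 ≤ l.2 then l.2 - 1 else l.2

def phi (ν : ℕ → Measure (ES d)) (l : Lab) (z : W d) : ℝ :=
  if l.1.card = 2 ∧ l.2 = 1 then OO l.1 z else II l.1 (ν (idx l)) z

lemma phi_ng (ν : ℕ → Measure (ES d)) (l : Lab) (z : W d) (k : Fin 4) :
    phi ν l (ngR k z) = (if k ∈ l.1 then (-1) else 1) * phi ν l z := by
  unfold phi
  by_cases h : l.1.card = 2 ∧ l.2 = 1
  · rw [if_pos h, if_pos h, OO_ng]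
  · rw [if_neg h, if_neg h, II_ng]

lemma phi_pm (ν : ℕ → Measure (ES d)) (σ) (l : Lab) (z : W d) : phi ν l (pmR σ z) = phi ν (lm σ l) z := by
  unfold phi
  have h2 : (lm σ l).2 = l.2 := rfl
  have h1 : (lm σ l).1 = l.1.map σ.toEmbedding := rfl
  unfold idx
  rw [lm_card, h2, h1, OO_pm, II_pm]

lemma II_single_ne {ν : Measure (ES d)} [IsFiniteMeasure ν] (hν : ν ≠ 0) {z : W d} {i : Fin 4} (h : na z i = 0)
    (hb : nbb z i ≠ 0) : II {i} ν z ≠ 0 := by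
  unfold II pr
  simp only [Finset.prod_singleton, hh, h, inner_zero_left, zero_sub]
  rw [integral_const, smul_eq_mul]
  refine mul_ne_zero ?_ ?_
  · rw [Measure.real, ENNReal.toReal_ne_zero]
    exact ⟨fun h0 => hν (Measure.measure_univ_eq_zero.mp h0), measure_ne_top _ _⟩
  · rw [ne_eq, Real.sign_eq_zero_iff]; simpa using hb

theorem exists_zero (q t : ℕ) (h1 : 1 ≤ t) (h2 : t ≤ 2 ^ q) (d : ℕ) (hd : d = 7 * 2 ^ q - 2 * t)
    (ν : ℕ → Measure (ES d)) (hf : ∀ r, IsFiniteMeasure (ν r)) (hac : ∀ r, ν r ≪ volume) (h0 : ∀ r, ν r ≠ 0) :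
    ∃ z : W d, nzb z ∧ (∀ i, na z i ≠ 0) ∧ (∀ i j, i ≠ j → ⟪na z i, na z j⟫ = (0:ℝ)) ∧
      ∀ r, r < 2 ^ (q + 1) - t → ∀ J : Finset (Fin 4), 1 ≤ J.card → J.card ≤ 3 → II J (ν r) z = 0 := by
  have hQ : 1 ≤ 2 ^ q := Nat.one_le_two_pow
  have hm : 2 ^ (q + 1) - t ≤ 2 ^ (q + 1) - 1 := by omega
  have hm1 : 1 ≤ 2 ^ (q + 1) - t := by rw [pow_succ]; omega
  have hs : ∀ z : W d, nzb z → ∀ i, phi ν ({i}, 0) z = 0 → na z i ≠ 0 := by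
    intro z hz i h0' ha
    have hb : nbb z i ≠ 0 := by
      rcases hz i with h | h
      · exact absurd ha h
      · exact h
    haveI := hf 0
    refine II_single_ne (h0 0) ha hb ?_
    simpa [phi, idx] using h0'
  obtain ⟨z, hz, hzz⟩ := topo q t h1 h2 d hd (phi ν) (phi_ng ν) (phi_pm ν) (by
      intro l _
      unfold phi
      by_cases h : l.1.card = 2 ∧ l.2 = 1
      · simp only [if_pos h]; exact (OO_cont _).continuousOn
      · simp only [if_neg h]; haveI := hf (idx l); exact II_cont _ (hac _))
    (by
      rintro z hz ⟨i, j, hij, hD⟩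
      by_contra hcon
      push Not at hcon
      have ha := hs z (KK_nzb hz) i (hcon _ (by rw [mem_RL]; simp; omega))
      have ho := hcon ({i, j}, 1) (by rw [mem_RL]; simp [Finset.card_pair hij]; omega)
      have ho' : OO {i, j} z = 0 := by simpa [phi, Finset.card_pair hij] using ho
      rw [OO_pair z hij] at ho'
      rcases hD with hD | hD
      · have : na z j = na z i := by ext r; simp [na, hD]
        rw [this, inner_self_eq_zero] at ho'
        exact ha ho'
      · have : na z j = - na z i := by ext r; simp [na, hD]
        rw [this, inner_neg_right, neg_eq_zero, inner_self_eq_zero] at ho'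
        exact ha ho')
  have hn := KK_nzb hz
  refine ⟨z, hn, fun i => hs z hn i (hzz _ (by rw [mem_full]; simp; omega)), ?_, ?_⟩
  · intro i j hij
    have ho := hzz ({i, j}, 1) (by rw [mem_full]; simp [Finset.card_pair hij]; omega)
    rw [← OO_pair z hij]
    simpa [phi, Finset.card_pair hij] using ho
  · intro r hr J hJ1 hJ3
    by_cases hJ : J.card = 2
    · by_cases hr0 : r = 0
      · subst hr0
        have := hzz (J, 0) (by rw [mem_full]; simp [hJ])
        simpa [phi, idx] using this
      · have := hzz (J, r + 1) (by rw [mem_full]; simp [hJ]; omega)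
        unfold phi idx at this
        rw [if_neg (by simp; omega), if_pos (by simp [hJ]; omega)] at this
        simpa using this
    · have := hzz (J, r) (by rw [mem_full]; simp [hJ]; omega)
      unfold phi idx at this
      rw [if_neg (by simp [hJ]), if_neg (by simp [hJ])] at this
      exact this

end EQ


namespace EQ
open Finset

variable {d : ℕ}

def eb (ε : Bool) : ℝ := if ε then 1 else -1

lemma half_ind (z : W d) (i : Fin 4) (ε : Bool) (x : ES d) (h : hh z i x ≠ 0) :
    (halfSpace (na z i) (nbb z i) ε).indicator (fun _ => (1:ℝ)) x = (1 + eb ε * Real.sign (hh z i x)) / 2 := by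
  unfold halfSpace eb
  rcases lt_or_gt_of_ne h with h' | h'
  · rw [Real.sign_of_neg h']
    have h2 : ⟪na z i, x⟫ < nbb z i := by unfold hh at h'; linarith
    cases ε
    · rw [Set.indicator_of_mem]
      · norm_num
      · simpa using h2.le
    · rw [Set.indicator_of_notMem]
      · norm_num
      · simpa using h2
  · rw [Real.sign_of_pos h']
    have h2 : nbb z i < ⟪na z i, x⟫ := by unfold hh at h'; linarith
    cases ε
    · rw [Set.indicator_of_notMem]
      · norm_num
      · simpa using h2
    · rw [Set.indicator_of_mem]
      · norm_num
      · simpa using h2.le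

lemma half_meas (a : ES d) (b : ℝ) (ε : Bool) : MeasurableSet (halfSpace a b ε) := by
  unfold halfSpace
  cases ε
  · simp only [Bool.false_eq_true, if_false]
    exact (isClosed_le (by fun_prop) (by fun_prop)).measurableSet
  · simp only [if_true]
    exact (isClosed_le (by fun_prop) (by fun_prop)).measurableSet

lemma region_meas (a : Fin 4 → ES d) (b : Fin 4 → ℝ) (s : Finset (Fin 4)) (ε : Fin 4 → Bool) :
    MeasurableSet (region a b s ε) := by
  unfold region
  exact Finset.measurableSet_biInter _ fun i _ => half_meas _ _ _

lemma region_ind (a : Fin 4 → ES d) (b : Fin 4 → ℝ) (s : Finset (Fin 4)) (ε : Fin 4 → Bool) (x : ES d) :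
    (region a b s ε).indicator (fun _ => (1:ℝ)) x =
      ∏ i ∈ s, (halfSpace (a i) (b i) (ε i)).indicator (fun _ => (1:ℝ)) x := by
  classical
  by_cases h : x ∈ region a b s ε
  · rw [Set.indicator_of_mem h]
    symm
    refine Finset.prod_eq_one fun i hi => ?_
    unfold region at h
    rw [Set.mem_iInter₂] at h
    rw [Set.indicator_of_mem (h i hi)]
  · rw [Set.indicator_of_notMem h]
    unfold region at h
    rw [Set.mem_iInter₂] at h
    push Not at h
    obtain ⟨i, hi, hx⟩ := h
    symm
    exact Finset.prod_eq_zero hi (Set.indicator_of_notMem hx _)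

lemma region_measure {ν : Measure (ES d)} [IsFiniteMeasure ν] (hν : ν ≪ volume) {z : W d} (hz : nzb z)
    (hI : ∀ J : Finset (Fin 4), 1 ≤ J.card → J.card ≤ 3 → II J ν z = 0) (s : Finset (Fin 4)) (hs : s.card = 3)
    (ε : Fin 4 → Bool) : ν (region (na z) (nbb z) s ε) = ν Set.univ / 2 ^ 3 := by
  have h1 : ν.real (region (na z) (nbb z) s ε) = ν.real Set.univ / 8 := by
    have e1 : ∫ x, (region (na z) (nbb z) s ε).indicator (fun _ => (1:ℝ)) x ∂ν =
        ν.real (region (na z) (nbb z) s ε) := by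
      rw [integral_indicator (region_meas _ _ _ _)]
      simp
    rw [← e1]
    have e2 : ∫ x, (region (na z) (nbb z) s ε).indicator (fun _ => (1:ℝ)) x ∂ν =
        ∫ x, ∑ T ∈ s.powerset, ((1/8 : ℝ) * ∏ i ∈ T, eb (ε i)) * pr T z x ∂ν := by
      refine integral_congr_ae ?_
      filter_upwards [ae_ne hν hz] with x hx
      rw [region_ind]
      have : ∀ i ∈ s, (halfSpace (na z i) (nbb z i) (ε i)).indicator (fun _ => (1:ℝ)) x =
        (1 + eb (ε i) * Real.sign (hh z i x)) / 2 := fun i _ => half_ind z i (ε i) x (hx i)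
      rw [Finset.prod_congr rfl this, Finset.prod_div_distrib, Finset.prod_const, hs, Finset.prod_one_add,
        Finset.sum_div]
      refine Finset.sum_congr rfl fun T _ => ?_
      rw [Finset.prod_mul_distrib]
      unfold pr
      ring
    rw [e2, integral_finset_sum _ fun T _ => (pr_int T z ν).const_mul _]
    rw [Finset.sum_eq_single ∅]
    · rw [integral_const_mul]
      simp [pr]
      ring
    · intro T hT hT0
      rw [integral_const_mul]
      have : II T ν z = 0 := hI T (Finset.card_pos.mpr (Finset.nonempty_iff_ne_empty.mpr hT0))
        (by rw [← hs]; exact Finset.card_le_card (Finset.mem_powerset.mp hT))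
      unfold II at this
      rw [this, mul_zero]
    · intro h
      exact absurd (Finset.empty_mem_powerset s) h
  rw [← ENNReal.toReal_eq_toReal_iff' (measure_ne_top _ _)
    (ENNReal.div_ne_top (measure_ne_top _ _) (by norm_num)), ENNReal.toReal_div]
  unfold Measure.real at h1
  rw [h1]
  norm_num

end EQ

theorem stmt_3 (q t : ℕ) (ht1 : 1 ≤ t) (ht2 : t ≤ 2 ^ q)
    (m d : ℕ) (hm : m = 2 ^ (q + 1) - t) (hd : d = 7 * 2 ^ q - 2 * t)
    (μ : Fin m → Measure (EuclideanSpace ℝ (Fin d)))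
    (hfin : ∀ r, IsFiniteMeasure (μ r))
    (hac : ∀ r, μ r ≪ volume) :
    ∃ (a : Fin 4 → EuclideanSpace ℝ (Fin d)) (b : Fin 4 → ℝ),
      (∀ i, a i ≠ 0) ∧
      (∀ i j, i ≠ j → ⟪a i, a j⟫ = (0 : ℝ)) ∧
      ∀ r : Fin m, ∀ s : Finset (Fin 4), s.card = 3 → ∀ ε : Fin 4 → Bool,
        μ r (region a b s ε) = μ r Set.univ / 2 ^ 3 := by
  classical
  set ρ : Measure (EuclideanSpace ℝ (Fin d)) := volume.restrict (Metric.ball 0 1) with hρ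
  have hρf : IsFiniteMeasure ρ := ⟨by
    rw [hρ, Measure.restrict_apply_univ]; exact measure_ball_lt_top⟩
  have hρ0 : ρ ≠ 0 := by
    intro h
    have h2 : ρ Set.univ = 0 := by rw [h]; rfl
    rw [hρ, Measure.restrict_apply_univ] at h2
    exact (Metric.measure_ball_pos volume _ one_pos).ne' h2
  have hρa : ρ ≪ volume := Measure.restrict_le_self.absolutelyContinuous
  let ν : ℕ → Measure (EuclideanSpace ℝ (Fin d)) := fun r =>
    if h : r < m then (if μ ⟨r, h⟩ = 0 then ρ else μ ⟨r, h⟩) else ρ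
  obtain ⟨z, hz, h1, h2, h3⟩ := EQ.exists_zero q t ht1 ht2 d hd ν
    (by intro r; dsimp only [ν]; split_ifs; exacts [hρf, hfin _, hρf])
    (by intro r; dsimp only [ν]; split_ifs; exacts [hρa, hac _, hρa])
    (by intro r; dsimp only [ν]; split_ifs with _ h; exacts [hρ0, h, hρ0])
  refine ⟨EQ.na z, EQ.nbb z, h1, h2, ?_⟩
  intro r s hs ε
  by_cases h0 : μ r = 0
  · rw [h0]; simp
  · have hν : ν r.1 = μ r := by dsimp only [ν]; rw [dif_pos r.2, if_neg h0]
    haveI := hfin r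
    refine EQ.region_measure (hac r) hz ?_ s hs ε
    intro J hJ1 hJ3
    rw [← hν]
    exact h3 r.1 (by rw [← hm]; exact r.2) J hJ1 hJ3
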